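/- Under the hypotheses and Setup of the Basic Identity, for all integers r ≥ 0 and s ≥ 1, there exist a polynomial q^r_s on J^{r+2sl}_{N,N}, nonnegative integers a^r_s, b^r_s, and a germ Ψ^{r,s} : (ℂ × E^{r+2sl} × ℂ^{(2s+1)N}, ℂ × E^{r+2sl}_0 × {0}) → (E^r, E^r_0) (into (E^0,0) when r = 0) with components in R^{r+2sl}_{(2s+1)N}, such that for every k-equivalence H = (F,G) between (M,0) and (M',0) with k > 2sl + r: (a) q^r_s(j^{r+2sl}H(0)) = (det F_z(0))^{a^r_s} · conj(det F_z(0))^{b^r_s}; (b) 𝒥^r H(Z) = Ψ^{r,s}(1/q^r_s(j^{r+2sl}H(Z^s)), 𝒥^{r+2sl}H(Z^s), Z, ζ^1, Z^1, …, ζ^s, Z^s) + R_H^{r,s}(Z, ζ^1, Z^1, …, ζ^s, Z^s), where R_H^{r,s} is a germ at 0 of a holomorphic map from ℂ^{(2s+1)N} to E^r whose restriction to the iterated complexification 𝓜^{2s} vanishes of order k − r − 2sl at 0. -/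

import Mathlib

open scoped BigOperators
open Complex

noncomputable section

abbrev Cn (N : ℕ) : Type := Fin N → ℂ
abbrev Rn (m : ℕ) : Type := Fin m → ℝ

/-- A local defining function for `M` near `p`. -/
def IsDefiningFun (N d : ℕ) (M : Set (Cn N)) (p : Cn N)
    (U : Set (Cn N)) (ρ : Cn N → Rn d) : Prop :=
  IsOpen U ∧ p ∈ U ∧ AnalyticOnNhd ℝ ρ U ∧
  (∀ z ∈ U, (z ∈ M ↔ ρ z = 0)) ∧
  ∀ z ∈ U, Function.Surjective (fderiv ℝ ρ z)

/-- `M` is a real-analytic submanifold of `ℂ^N` of (real) codimension `d`. -/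
def IsRASubmanifold (N d : ℕ) (M : Set (Cn N)) : Prop :=
  ∀ p ∈ M, ∃ U ρ, IsDefiningFun N d M p U ρ

/-- A real-analytic local parametrization of `M` (of codimension `d`) at `p`. -/
def IsLocalParam (N d : ℕ) (M : Set (Cn N)) (p : Cn N)
    (Ω : Set (Rn (2*N - d))) (Z : Rn (2*N - d) → Cn N) : Prop :=
  IsOpen Ω ∧ (0 : Rn (2*N-d)) ∈ Ω ∧ Z 0 = p ∧ AnalyticOnNhd ℝ Z Ω ∧
  Set.InjOn Z Ω ∧ (∀ x ∈ Ω, Function.Injective (fderiv ℝ Z x)) ∧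
  ∃ U : Set (Cn N), IsOpen U ∧ p ∈ U ∧ Z '' Ω = M ∩ U

/-- `H` is a `k`-equivalence between `(M,p)` and `(M',p')`. -/
def IsKEquivalence (N d : ℕ) (M M' : Set (Cn N)) (p p' : Cn N) (k : ℕ)
    (H : Cn N → Cn N) : Prop :=
  AnalyticAt ℂ H p ∧ H p = p' ∧ Function.Bijective (fderiv ℂ H p) ∧
  ∃ Ω Z, IsLocalParam N d M p Ω Z ∧
    ∀ U' ρ', IsDefiningFun N d M' p' U' ρ' →
      ∃ C ε : ℝ, 0 < ε ∧ ∀ x : Rn (2*N - d), ‖x‖ < ε →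
        ‖ρ' (H (Z x))‖ ≤ C * ‖x‖ ^ k

/-- `H` is a biholomorphic equivalence between `(M,p)` and `(M',p')`. -/
def IsBiholEquivalence (N : ℕ) (M M' : Set (Cn N)) (p p' : Cn N)
    (H : Cn N → Cn N) : Prop :=
  ∃ (U U' : Set (Cn N)) (Hinv : Cn N → Cn N),
    IsOpen U ∧ IsOpen U' ∧ p ∈ U ∧ p' ∈ U' ∧ H p = p' ∧
    AnalyticOnNhd ℂ H U ∧ AnalyticOnNhd ℂ Hinv U' ∧
    Set.BijOn H U U' ∧ (∀ z ∈ U, Hinv (H z) = z) ∧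
    H '' (M ∩ U) = M' ∩ U'

/-- `V` is a real-analytic subvariety of `M`: closed in `M` and locally the common zero
set of finitely many real-valued real-analytic functions. -/
def IsRASubvarietyOf (N : ℕ) (M V : Set (Cn N)) : Prop :=
  V ⊆ M ∧ (∃ C : Set (Cn N), IsClosed C ∧ V = M ∩ C) ∧
  ∀ p ∈ M, ∃ (U : Set (Cn N)) (m : ℕ) (f : Fin m → (Cn N → ℝ)),
    IsOpen U ∧ p ∈ U ∧ (∀ i, AnalyticOnNhd ℝ (f i) U) ∧
    V ∩ U = {z ∈ M ∩ U | ∀ i, f i z = 0}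

/-- Componentwise complex conjugation on `ℂ^N`. -/
def conjV (N : ℕ) (z : Cn N) : Cn N := fun i => (starRingEnd ℂ) (z i)

/-- The germ `H̄` whose power series coefficients are the complex conjugates of those
of `H`: `H̄(ζ) = conj (H (conj ζ))`. -/
def conjMap (N : ℕ) (H : Cn N → Cn N) : Cn N → Cn N :=
  fun ζ => conjV N (H (conjV N ζ))

/-! Coordinates `Z = (z,w,u) ∈ ℂ^n × ℂ^{d₁} × ℂ^{d₂}` on `ℂ^N`, `N = n + (d₁ + d₂)`,
and `(z',w') ∈ ℂ^n × ℂ^d`, `d = d₁ + d₂`, on the target. -/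

def zIdx (n d₁ d₂ : ℕ) (i : Fin n) : Fin (n + (d₁ + d₂)) := Fin.castAdd (d₁ + d₂) i
def wIdx (n d₁ d₂ : ℕ) (j : Fin d₁) : Fin (n + (d₁ + d₂)) := Fin.natAdd n (Fin.castAdd d₂ j)
def uIdx (n d₁ d₂ : ℕ) (j : Fin d₂) : Fin (n + (d₁ + d₂)) := Fin.natAdd n (Fin.natAdd d₁ j)
def wfIdx (n d₁ d₂ : ℕ) (j : Fin (d₁ + d₂)) : Fin (n + (d₁ + d₂)) := Fin.natAdd n j

def zPart (n d₁ d₂ : ℕ) (Z : Cn (n + (d₁ + d₂))) : Cn n := fun i => Z (zIdx n d₁ d₂ i)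
def wPart (n d₁ d₂ : ℕ) (Z : Cn (n + (d₁ + d₂))) : Cn d₁ := fun j => Z (wIdx n d₁ d₂ j)
def uPart (n d₁ d₂ : ℕ) (Z : Cn (n + (d₁ + d₂))) : Cn d₂ := fun j => Z (uIdx n d₁ d₂ j)
def wfPart (n d₁ d₂ : ℕ) (Z : Cn (n + (d₁ + d₂))) : Cn (d₁ + d₂) := fun j => Z (wfIdx n d₁ d₂ j)

/-- The point `(z,w,u) ∈ ℂ^N`. -/
def mk3 (n d₁ d₂ : ℕ) (z : Cn n) (w : Cn d₁) (u : Cn d₂) : Cn (n + (d₁ + d₂)) :=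
  Fin.append z (Fin.append w u)

/-- `M` is given near `0` by `u ∈ ℝ^{d₂}`, `w = Q(z, z̄, w̄, u)`, where `Q` is holomorphic
near `0` and satisfies the normality conditions `Q(z,0,τ,u) ≡ Q(0,χ,τ,u) ≡ τ`. -/
def QDescribes (n d₁ d₂ : ℕ) (Q : Cn n → Cn n → Cn d₁ → Cn d₂ → Cn d₁)
    (M : Set (Cn (n + (d₁ + d₂)))) : Prop :=
  AnalyticAt ℂ (fun p : (Cn n × Cn n) × (Cn d₁ × Cn d₂) => Q p.1.1 p.1.2 p.2.1 p.2.2) 0 ∧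
  (∃ ε : ℝ, 0 < ε ∧ ∀ (z χ : Cn n) (τ : Cn d₁) (u : Cn d₂),
    ‖z‖ < ε → ‖χ‖ < ε → ‖τ‖ < ε → ‖u‖ < ε → (Q z 0 τ u = τ ∧ Q 0 χ τ u = τ)) ∧
  ∃ ε : ℝ, 0 < ε ∧ ∀ Z : Cn (n + (d₁ + d₂)), ‖Z‖ < ε →
    (Z ∈ M ↔ ((∀ j, (Z (uIdx n d₁ d₂ j)).im = 0) ∧
      ∀ j, Z (wIdx n d₁ d₂ j) =
        Q (zPart n d₁ d₂ Z) (fun i => (starRingEnd ℂ) (zPart n d₁ d₂ Z i))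
          (fun i => (starRingEnd ℂ) (wPart n d₁ d₂ Z i)) (uPart n d₁ d₂ Z) j))

/-- `M'` is given near `0` in normal coordinates by `w' = Q'(z', z̄', w̄')`. -/
def QpDescribes (n d₁ d₂ : ℕ) (Q' : Cn n → Cn n → Cn (d₁ + d₂) → Cn (d₁ + d₂))
    (M' : Set (Cn (n + (d₁ + d₂)))) : Prop :=
  AnalyticAt ℂ (fun p : (Cn n × Cn n) × Cn (d₁ + d₂) => Q' p.1.1 p.1.2 p.2) 0 ∧
  (∃ ε : ℝ, 0 < ε ∧ ∀ (z χ : Cn n) (τ : Cn (d₁ + d₂)),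
    ‖z‖ < ε → ‖χ‖ < ε → ‖τ‖ < ε → (Q' z 0 τ = τ ∧ Q' 0 χ τ = τ)) ∧
  ∃ ε : ℝ, 0 < ε ∧ ∀ Z : Cn (n + (d₁ + d₂)), ‖Z‖ < ε →
    (Z ∈ M' ↔ ∀ j, Z (wfIdx n d₁ d₂ j) =
      Q' (zPart n d₁ d₂ Z) (fun i => (starRingEnd ℂ) (zPart n d₁ d₂ Z i))
        (fun i => (starRingEnd ℂ) (wfPart n d₁ d₂ Z i)) j)

/-- Iterated directional derivative along a list of directions. -/
def iterDeriv {E F : Type*} [NormedAddCommGroup E] [NormedSpace ℂ E]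
    [NormedAddCommGroup F] [NormedSpace ℂ F] : List E → (E → F) → E → F
  | [], f => f
  | v :: vs, f => iterDeriv vs fun x => fderiv ℂ f x v

/-- `M'`, given in normal coordinates by `Q'`, is `l`-nondegenerate at `0`:
`span_ℂ{Q'^j_{z'^β χ'}(0,0,0) : 1 ≤ j ≤ d, 1 ≤ |β| ≤ l} = ℂ^n`. -/
def QpLNondeg (n dd l : ℕ) (Q' : Cn n → Cn n → Cn dd → Cn dd) : Prop :=
  Submodule.span ℂ {v : Cn n | ∃ (j : Fin dd) (β : Fin n → ℕ),
    1 ≤ (∑ i, β i) ∧ (∑ i, β i) ≤ l ∧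
    v = fun i => iterDeriv
      ((((0 : Cn n), Pi.single i (1:ℂ), (0 : Cn dd)) : Cn n × Cn n × Cn dd) ::
        ((List.finRange n).flatMap fun i' => List.replicate (β i')
          (((Pi.single i' (1:ℂ) : Cn n), (0 : Cn n), (0 : Cn dd)) : Cn n × Cn n × Cn dd)))
      (fun P => Q' P.1 P.2.1 P.2.2 j) 0} = ⊤

/-- Multi-indices of total degree at most `r` in `m` variables. -/
abbrev MIdx (m r : ℕ) : Type := {dd : Fin m → Fin (r+1) // (∑ i, (dd i : ℕ)) ≤ r}

/-- The jet space `J^r_{m,l}` of `r`-jets at `0` of holomorphic maps `ℂ^m → ℂ^l`. -/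
abbrev JetSp (r m lt : ℕ) : Type := MIdx m r → (Fin lt → ℂ)

/-- The partial derivative `∂^β f` where the variables are selected by `idx`. -/
def mderivIdx {N : ℕ} {F : Type*} [NormedAddCommGroup F] [NormedSpace ℂ F]
    (m : ℕ) (idx : Fin m → Fin N) (β : Fin m → ℕ) (f : Cn N → F) : Cn N → F :=
  iterDeriv ((List.finRange m).flatMap fun i =>
    List.replicate (β i) ((Pi.single (idx i) (1:ℂ) : Cn N))) f

/-- The full `r`-jet `j^r H(Z) = (∂^α H(Z))_{|α| ≤ r}`. -/
def jetFull (N r : ℕ) (H : Cn N → Cn N) (Z : Cn N) : JetSp r N N :=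
  fun dd => mderivIdx N id (fun i => ((dd.1 i : ℕ))) H Z

/-- The component `F` of `H = (F,G)`. -/
def Fpart (n d₁ d₂ : ℕ) (H : Cn (n + (d₁ + d₂)) → Cn (n + (d₁ + d₂)))
    (Z : Cn (n + (d₁ + d₂))) : Cn n := fun i => H Z (zIdx n d₁ d₂ i)

/-- The component `G` of `H = (F,G)`. -/
def Gpart (n d₁ d₂ : ℕ) (H : Cn (n + (d₁ + d₂)) → Cn (n + (d₁ + d₂)))
    (Z : Cn (n + (d₁ + d₂))) : Cn (d₁ + d₂) := fun j => H Z (wfIdx n d₁ d₂ j)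

/-- The jet `(∂^ν_z G(Z))_{|ν| ≤ r}` of derivatives of `G` with respect to `z` only. -/
def jetZG (n d₁ d₂ r : ℕ) (H : Cn (n + (d₁ + d₂)) → Cn (n + (d₁ + d₂)))
    (Z : Cn (n + (d₁ + d₂))) : JetSp r n (d₁ + d₂) :=
  fun ν => mderivIdx n (zIdx n d₁ d₂) (fun i => ((ν.1 i : ℕ)))
    (fun W => Gpart n d₁ d₂ H W) Z

/-- The space `E^r = J^r_{N,N} × J^r_{n,d} × ℂ^n`, grouped as `E^r_0 × E^r_1`. -/
abbrev ESp (n d₁ d₂ r : ℕ) : Type :=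
  JetSp r (n + (d₁ + d₂)) (n + (d₁ + d₂)) × (JetSp r n (d₁ + d₂) × Cn n)

/-- `𝒥^r H(Z) = (j^r H(Z), (∂^ν_z G(Z))_ν, F(Z)) ∈ E^r`. -/
def calJ (n d₁ d₂ r : ℕ) (H : Cn (n + (d₁ + d₂)) → Cn (n + (d₁ + d₂)))
    (Z : Cn (n + (d₁ + d₂))) : ESp n d₁ d₂ r :=
  (jetFull (n + (d₁ + d₂)) r H Z, (jetZG n d₁ d₂ r H Z, Fpart n d₁ d₂ H Z))

/-- `det F_z(Z)`, the determinant of the Jacobian of `F` with respect to `z`. -/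
def detFz (n d₁ d₂ : ℕ) (H : Cn (n + (d₁ + d₂)) → Cn (n + (d₁ + d₂)))
    (Z : Cn (n + (d₁ + d₂))) : ℂ :=
  (Matrix.of fun i i' : Fin n =>
    fderiv ℂ (fun W => H W (zIdx n d₁ d₂ i)) Z (Pi.single (zIdx n d₁ d₂ i') 1)).det

/-- The complexification relation: `(Z,ζ) ∈ 𝓜` iff `v = u` and `w = Q(z,χ,τ,u)`. -/
def cxRel (n d₁ d₂ : ℕ) (Q : Cn n → Cn n → Cn d₁ → Cn d₂ → Cn d₁)
    (Z ζ : Cn (n + (d₁ + d₂))) : Prop :=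
  (∀ j, ζ (uIdx n d₁ d₂ j) = Z (uIdx n d₁ d₂ j)) ∧
  ∀ j, Z (wIdx n d₁ d₂ j) =
    Q (zPart n d₁ d₂ Z) (zPart n d₁ d₂ ζ) (wPart n d₁ d₂ ζ) (uPart n d₁ d₂ Z) j

/-- Polynomial functions on a complex vector space. -/
inductive IsPolyFun {V : Type*} [AddCommGroup V] [Module ℂ V] : (V → ℂ) → Prop
  | const (c : ℂ) : IsPolyFun fun _ => c
  | linear (φ : V →ₗ[ℂ] ℂ) : IsPolyFun fun x => φ x
  | add {f g : V → ℂ} : IsPolyFun f → IsPolyFun g → IsPolyFun fun x => f x + g x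
  | mul {f g : V → ℂ} : IsPolyFun f → IsPolyFun g → IsPolyFun fun x => f x * g x

/-- The ring `R(V₀ × V₁, V₀)` of germs along `V₀ × {0}` of holomorphic functions all of
whose partial derivatives restrict to polynomial functions on `V₀ × {0}`. -/
def MemRing (V0 V1 : Type*) [NormedAddCommGroup V0] [NormedSpace ℂ V0]
    [NormedAddCommGroup V1] [NormedSpace ℂ V1] (f : V0 × V1 → ℂ) : Prop :=
  (∃ Ω : Set (V0 × V1), IsOpen Ω ∧ (∀ x0 : V0, ((x0, 0) : V0 × V1) ∈ Ω) ∧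
    AnalyticOnNhd ℂ f Ω) ∧
  ∀ vs : List (V0 × V1), IsPolyFun fun x0 : V0 => iterDeriv vs f ((x0, 0) : V0 × V1)

/-- A map has components in the ring `R(V₀ × V₁, V₀)`. -/
def MemRingMap (V0 V1 F : Type*) [NormedAddCommGroup V0] [NormedSpace ℂ V0]
    [NormedAddCommGroup V1] [NormedSpace ℂ V1] [NormedAddCommGroup F] [NormedSpace ℂ F]
    (Ψ : V0 × V1 → F) : Prop :=
  ∀ φ : F →ₗ[ℂ] ℂ, MemRing V0 V1 fun x => φ (Ψ x)

/-- The iterated complexification `𝓜^{2s}`: the point `(Z, ζ¹, Z¹, …, ζ^s, Z^s)` is recorded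
as `(Z, W)` with `W t = (ζ^{t+1}, Z^{t+1})`. -/
def McxChain (n d₁ d₂ s : ℕ) (Q : Cn n → Cn n → Cn d₁ → Cn d₂ → Cn d₁)
    (P : Cn (n + (d₁ + d₂)) × (Fin s → Cn (n + (d₁ + d₂)) × Cn (n + (d₁ + d₂)))) : Prop :=
  (∀ h0 : 0 < s, cxRel n d₁ d₂ Q P.1 (P.2 ⟨0, h0⟩).1) ∧
  (∀ t, cxRel n d₁ d₂ Q (P.2 t).2 (P.2 t).1) ∧
  (∀ t : Fin s, ∀ h : (t : ℕ) + 1 < s, cxRel n d₁ d₂ Q (P.2 t).2 (P.2 ⟨t + 1, h⟩).1)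

open Filter Topology Asymptotics

section IterDeriv

variable {E F G : Type*} [NormedAddCommGroup E] [NormedSpace ℂ E]
  [NormedAddCommGroup F] [NormedSpace ℂ F] [NormedAddCommGroup G] [NormedSpace ℂ G]

theorem iterDeriv_append (vs ws : List E) (f : E → F) :
    iterDeriv (vs ++ ws) f = iterDeriv ws (iterDeriv vs f) := by
  induction vs generalizing f with
  | nil => rfl
  | cons v vs ih => exact ih _

theorem iterDeriv_concat (vs : List E) (v : E) (f : E → F) :
    iterDeriv (vs ++ [v]) f = fun x => fderiv ℂ (iterDeriv vs f) x v := by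
  rw [iterDeriv_append]; rfl

theorem iterDeriv_congr (vs : List E) {f g : E → F} {x : E} (h : f =ᶠ[𝓝 x] g) :
    iterDeriv vs f =ᶠ[𝓝 x] iterDeriv vs g := by
  induction vs generalizing f g with
  | nil => exact h
  | cons v vs ih =>
    apply ih
    filter_upwards [h.fderiv (𝕜 := ℂ)] with y hy
    rw [hy]

theorem AnalyticAt.fderiv_apply_const [CompleteSpace F] {f : E → F} {x : E}
    (h : AnalyticAt ℂ f x) (v : E) : AnalyticAt ℂ (fun y => fderiv ℂ f y v) x :=
  ((ContinuousLinearMap.apply ℂ F v).analyticAt _).comp h.fderiv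

theorem analyticAt_iterDeriv [CompleteSpace F] (vs : List E) {f : E → F} {x : E}
    (h : AnalyticAt ℂ f x) : AnalyticAt ℂ (iterDeriv vs f) x := by
  induction vs generalizing f with
  | nil => exact h
  | cons v vs ih => exact ih (h.fderiv_apply_const v)

theorem iterDeriv_add [CompleteSpace F] (vs : List E) {f g : E → F} {x : E}
    (hf : AnalyticAt ℂ f x) (hg : AnalyticAt ℂ g x) :
    iterDeriv vs (fun y => f y + g y) =ᶠ[𝓝 x] fun y => iterDeriv vs f y + iterDeriv vs g y := by
  induction vs generalizing f g with
  | nil => exact EventuallyEq.rfl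
  | cons v vs ih =>
    refine (iterDeriv_congr vs ?_).trans (ih (hf.fderiv_apply_const v) (hg.fderiv_apply_const v))
    filter_upwards [hf.eventually_analyticAt, hg.eventually_analyticAt] with y h1 h2
    rw [fderiv_fun_add h1.differentiableAt h2.differentiableAt]; rfl

theorem iterDeriv_clm_comp [CompleteSpace F] (L : F →L[ℂ] G) (vs : List E) {f : E → F} {x : E}
    (hf : AnalyticAt ℂ f x) :
    iterDeriv vs (fun y => L (f y)) =ᶠ[𝓝 x] fun y => L (iterDeriv vs f y) := by
  induction vs generalizing f with
  | nil => exact EventuallyEq.rfl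
  | cons v vs ih =>
    refine (iterDeriv_congr vs ?_).trans (ih (hf.fderiv_apply_const v))
    filter_upwards [hf.eventually_analyticAt] with y h1
    have := (L.hasFDerivAt.comp y h1.differentiableAt.hasFDerivAt).fderiv
    simp only [Function.comp_def] at this
    rw [this]; rfl

theorem iterDeriv_comp_clm [CompleteSpace F] (L : G →L[ℂ] E) (vs : List G) {f : E → F} {x : G}
    (hf : AnalyticAt ℂ f (L x)) :
    iterDeriv vs (fun y => f (L y)) =ᶠ[𝓝 x] fun y => iterDeriv (vs.map L) f (L y) := by
  induction vs generalizing f with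
  | nil => exact EventuallyEq.rfl
  | cons v vs ih =>
    refine (iterDeriv_congr vs ?_).trans (ih (hf.fderiv_apply_const (L v)))
    filter_upwards [L.continuous.continuousAt.eventually hf.eventually_analyticAt] with y h1
    have := (h1.differentiableAt.hasFDerivAt.comp y L.hasFDerivAt).fderiv
    simp only [Function.comp_def] at this
    rw [this]; rfl

theorem iterDeriv_perm [CompleteSpace F] {vs ws : List E} (h : vs.Perm ws) {f : E → F} {x : E}
    (hf : AnalyticAt ℂ f x) : iterDeriv vs f =ᶠ[𝓝 x] iterDeriv ws f := by
  induction h generalizing f with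
  | nil => exact EventuallyEq.rfl
  | cons v _ ih => exact ih (hf.fderiv_apply_const v)
  | swap v w l =>
    refine iterDeriv_congr l ?_
    filter_upwards [hf.eventually_analyticAt] with y hy
    have hs : IsSymmSndFDerivAt ℂ f y := (hy.contDiffAt (n := ⊤)).isSymmSndFDerivAt_of_omega
    have e : ∀ v w : E, fderiv ℂ (fun x => fderiv ℂ f x v) y w = fderiv ℂ (fderiv ℂ f) y w v := by
      intro v w
      have := ((ContinuousLinearMap.apply ℂ F v).hasFDerivAt.comp y
        hy.fderiv.differentiableAt.hasFDerivAt).fderiv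
      simp only [Function.comp_def, ContinuousLinearMap.apply_apply] at this
      rw [this]; rfl
    rw [e, e, hs.eq]
  | trans _ _ ih1 ih2 => exact (ih1 hf).trans (ih2 hf)

end IterDeriv

section Poly

variable {V W F : Type*} [AddCommGroup V] [Module ℂ V] [AddCommGroup W] [Module ℂ W]
  [AddCommGroup F] [Module ℂ F]

theorem IsPolyFun.comp {p : V → ℂ} (hp : IsPolyFun p) {g : W → V}
    (hg : ∀ φ : V →ₗ[ℂ] ℂ, IsPolyFun fun x => φ (g x)) : IsPolyFun fun x => p (g x) := by
  induction hp with
  | const c => exact .const c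
  | linear φ => exact hg φ
  | add _ _ h1 h2 => exact .add h1 h2
  | mul _ _ h1 h2 => exact .mul h1 h2

theorem IsPolyFun.comp_linear {p : V → ℂ} (hp : IsPolyFun p) (L : W →ₗ[ℂ] V) :
    IsPolyFun fun x => p (L x) :=
  hp.comp fun φ => .linear (φ ∘ₗ L)

theorem IsPolyFun.pow {p : V → ℂ} (hp : IsPolyFun p) (c : ℕ) : IsPolyFun fun x => p x ^ c := by
  induction c with
  | zero => simpa using IsPolyFun.const 1
  | succ c ih => simpa [pow_succ] using ih.mul hp

theorem IsPolyFun.sum {ι : Type*} (s : Finset ι) {p : ι → V → ℂ} (hp : ∀ i, IsPolyFun (p i)) :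
    IsPolyFun fun x => ∑ i ∈ s, p i x := by
  classical
  induction s using Finset.induction_on with
  | empty => simpa using IsPolyFun.const 0
  | insert a s ha ih => simpa [Finset.sum_insert ha] using (hp a).add ih

theorem IsPolyFun.prod {ι : Type*} (s : Finset ι) {p : ι → V → ℂ} (hp : ∀ i, IsPolyFun (p i)) :
    IsPolyFun fun x => ∏ i ∈ s, p i x := by
  classical
  induction s using Finset.induction_on with
  | empty => simpa using IsPolyFun.const 1
  | insert a s ha ih => simpa [Finset.prod_insert ha] using (hp a).mul ih

theorem IsPolyFun.clear_denominator {q : V → ℂ} (hq : IsPolyFun q) {p : ℂ × V → ℂ}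
    (hp : IsPolyFun p) : ∃ (c : ℕ) (P : V → ℂ), IsPolyFun P ∧
      ∀ x, q x ≠ 0 → P x = q x ^ c * p (1 / q x, x) := by
  induction hp with
  | const a => exact ⟨0, fun _ => a, .const a, fun x _ => by simp⟩
  | linear φ =>
    refine ⟨1, fun x => φ (1, 0) + q x * φ (0, x), (IsPolyFun.const _).add
      (hq.mul (.linear (φ ∘ₗ LinearMap.inr ℂ ℂ V))), fun x hx => ?_⟩
    have : ((1 / q x, x) : ℂ × V) = (1 / q x) • ((1, 0) : ℂ × V) + (0, x) := by simp
    simp only [this, map_add, map_smul, smul_eq_mul]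
    field_simp
  | add _ _ h1 h2 =>
    obtain ⟨c1, P1, hP1, h1⟩ := h1
    obtain ⟨c2, P2, hP2, h2⟩ := h2
    refine ⟨c1 + c2, fun x => q x ^ c2 * P1 x + q x ^ c1 * P2 x,
      ((hq.pow c2).mul hP1).add ((hq.pow c1).mul hP2), fun x hx => ?_⟩
    simp only [h1 x hx, h2 x hx]; ring
  | mul _ _ h1 h2 =>
    obtain ⟨c1, P1, hP1, h1⟩ := h1
    obtain ⟨c2, P2, hP2, h2⟩ := h2
    refine ⟨c1 + c2, fun x => P1 x * P2 x, hP1.mul hP2, fun x hx => ?_⟩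
    simp only [h1 x hx, h2 x hx]; ring

end Poly

section Ring

variable {V0 V1 W0 W1 F G : Type*} [NormedAddCommGroup V0] [NormedSpace ℂ V0]
  [NormedAddCommGroup V1] [NormedSpace ℂ V1] [NormedAddCommGroup W0] [NormedSpace ℂ W0]
  [NormedAddCommGroup W1] [NormedSpace ℂ W1] [NormedAddCommGroup F] [NormedSpace ℂ F]
  [NormedAddCommGroup G] [NormedSpace ℂ G]

theorem memRing_iff {f : V0 × V1 → ℂ} : MemRing V0 V1 f ↔
    (∀ x0 : V0, AnalyticAt ℂ f (x0, 0)) ∧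
    ∀ vs : List (V0 × V1), IsPolyFun fun x0 : V0 => iterDeriv vs f (x0, 0) := by
  constructor
  · rintro ⟨⟨Ω, _, h, ha⟩, hp⟩
    exact ⟨fun x0 => ha _ (h x0), hp⟩
  · rintro ⟨ha, hp⟩
    exact ⟨⟨{x | AnalyticAt ℂ f x}, isOpen_analyticAt ℂ f, ha, fun x hx => hx⟩, hp⟩

theorem MemRing.analyticAt {f : V0 × V1 → ℂ} (hf : MemRing V0 V1 f) (x0 : V0) :
    AnalyticAt ℂ f (x0, 0) := (memRing_iff.1 hf).1 x0

theorem MemRing.isPolyFun {f : V0 × V1 → ℂ} (hf : MemRing V0 V1 f) :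
    IsPolyFun fun x0 : V0 => f (x0, 0) := (memRing_iff.1 hf).2 []

theorem MemRing.congr {f g : V0 × V1 → ℂ} (hf : MemRing V0 V1 f)
    (h : ∀ x0 : V0, f =ᶠ[𝓝 (x0, 0)] g) : MemRing V0 V1 g := by
  rw [memRing_iff] at hf ⊢
  refine ⟨fun x0 => (hf.1 x0).congr (h x0), fun vs => ?_⟩
  convert hf.2 vs using 2 with x0
  exact (iterDeriv_congr vs (h x0)).eq_of_nhds.symm

theorem MemRing.fderiv {f : V0 × V1 → ℂ} (hf : MemRing V0 V1 f) (v : V0 × V1) :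
    MemRing V0 V1 fun x => fderiv ℂ f x v := by
  rw [memRing_iff] at hf ⊢
  exact ⟨fun x0 => (hf.1 x0).fderiv_apply_const v, fun vs => hf.2 (v :: vs)⟩

theorem MemRing.add {f g : V0 × V1 → ℂ} (hf : MemRing V0 V1 f) (hg : MemRing V0 V1 g) :
    MemRing V0 V1 fun x => f x + g x := by
  rw [memRing_iff] at hf hg ⊢
  refine ⟨fun x0 => (hf.1 x0).fun_add (hg.1 x0), fun vs => ?_⟩
  convert (hf.2 vs).add (hg.2 vs) using 2 with x0
  exact (iterDeriv_add vs (hf.1 x0) (hg.1 x0)).eq_of_nhds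

theorem memRing_const (c : ℂ) : MemRing V0 V1 fun _ => c := by
  rw [memRing_iff]
  refine ⟨fun _ => analyticAt_const, fun vs => ?_⟩
  induction vs generalizing c with
  | nil => exact .const c
  | cons v vs ih => simpa [iterDeriv] using ih 0

theorem memRing_of_fderiv {f : V0 × V1 → ℂ} (ha : ∀ x0 : V0, AnalyticAt ℂ f (x0, 0))
    (hp : IsPolyFun fun x0 : V0 => f (x0, 0))
    (hd : ∀ v, MemRing V0 V1 fun x => fderiv ℂ f x v) : MemRing V0 V1 f := by
  rw [memRing_iff]
  refine ⟨ha, fun vs => ?_⟩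
  cases vs with
  | nil => exact hp
  | cons v vs => exact (memRing_iff.1 (hd v)).2 vs

theorem memRing_linear (φ : V0 × V1 →L[ℂ] ℂ) : MemRing V0 V1 fun x => φ x := by
  refine memRing_of_fderiv (fun x0 => φ.analyticAt _)
    (.linear ((φ : V0 × V1 →ₗ[ℂ] ℂ) ∘ₗ LinearMap.inl ℂ V0 V1)) fun v => ?_
  simpa using memRing_const (φ v)

theorem MemRing.mul {f g : V0 × V1 → ℂ} (hf : MemRing V0 V1 f) (hg : MemRing V0 V1 g) :
    MemRing V0 V1 fun x => f x * g x := by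
  rw [memRing_iff]
  refine ⟨fun x0 => (hf.analyticAt x0).fun_mul (hg.analyticAt x0), fun vs => ?_⟩
  induction vs generalizing f g with
  | nil => exact hf.isPolyFun.mul hg.isPolyFun
  | cons v vs ih =>
    have e : ∀ x0 : V0, iterDeriv (v :: vs) (fun x => f x * g x) (x0, 0) =
        iterDeriv vs (fun x => f x * _root_.fderiv ℂ g x v) (x0, 0) +
        iterDeriv vs (fun x => g x * _root_.fderiv ℂ f x v) (x0, 0) := by
      intro x0
      have ha := hf.analyticAt x0
      have hb := hg.analyticAt x0
      have : iterDeriv (v :: vs) (fun x => f x * g x) =ᶠ[𝓝 ((x0, 0) : V0 × V1)]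
          iterDeriv vs fun x => f x * _root_.fderiv ℂ g x v + g x * _root_.fderiv ℂ f x v := by
        refine iterDeriv_congr vs ?_
        filter_upwards [ha.eventually_analyticAt, hb.eventually_analyticAt] with y h1 h2
        rw [fderiv_fun_mul h1.differentiableAt h2.differentiableAt]
        simp
      exact (this.trans (iterDeriv_add vs (ha.fun_mul (hb.fderiv_apply_const v))
        (hb.fun_mul (ha.fderiv_apply_const v)))).eq_of_nhds
    simp only [e]
    exact (ih hf (hg.fderiv v)).add (ih hg (hf.fderiv v))

theorem MemRing.sum {ι : Type*} (s : Finset ι) {f : ι → V0 × V1 → ℂ}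
    (hf : ∀ i, MemRing V0 V1 (f i)) : MemRing V0 V1 fun x => ∑ i ∈ s, f i x := by
  classical
  induction s using Finset.induction_on with
  | empty => simpa using memRing_const 0
  | insert a s ha ih => simpa [Finset.sum_insert ha] using (hf a).add ih

theorem MemRing.prod {ι : Type*} (s : Finset ι) {f : ι → V0 × V1 → ℂ}
    (hf : ∀ i, MemRing V0 V1 (f i)) : MemRing V0 V1 fun x => ∏ i ∈ s, f i x := by
  classical
  induction s using Finset.induction_on with
  | empty => simpa using memRing_const 1
  | insert a s ha ih => simpa [Finset.prod_insert ha] using (hf a).mul ih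

theorem MemRing.of_isPolyFun [FiniteDimensional ℂ V0] {p : V0 → ℂ} (hp : IsPolyFun p) :
    MemRing V0 V1 fun x => p x.1 := by
  induction hp with
  | const c => exact memRing_const c
  | linear φ =>
    exact memRing_linear ((LinearMap.toContinuousLinearMap φ).comp (.fst ℂ V0 V1))
  | add _ _ h1 h2 => exact h1.add h2
  | mul _ _ h1 h2 => exact h1.mul h2

theorem MemRing.of_analyticAt {f : V1 → ℂ} (hf : AnalyticAt ℂ f 0) :
    MemRing V0 V1 fun x => f x.2 := by
  rw [memRing_iff]
  have hf' : ∀ x0 : V0, AnalyticAt ℂ f (ContinuousLinearMap.snd ℂ V0 V1 (x0, 0)) := fun _ => hf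
  refine ⟨fun x0 => (hf' x0).comp ((ContinuousLinearMap.snd ℂ V0 V1).analyticAt (x0, 0)),
    fun vs => ?_⟩
  convert IsPolyFun.const (iterDeriv (vs.map (ContinuousLinearMap.snd ℂ V0 V1)) f 0) using 2 with x0
  exact (iterDeriv_comp_clm (ContinuousLinearMap.snd ℂ V0 V1) vs (hf' x0)).eq_of_nhds

section Maps

variable [FiniteDimensional ℂ F]

theorem analyticAt_of_forall_linear {E : Type*} [NormedAddCommGroup E] [NormedSpace ℂ E]
    {g : E → F} {x : E} (h : ∀ φ : F →ₗ[ℂ] ℂ, AnalyticAt ℂ (fun y => φ (g y)) x) :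
    AnalyticAt ℂ g x := by
  let e : F ≃L[ℂ] (Fin (Module.finrank ℂ F) → ℂ) :=
    (Module.finBasis ℂ F).equivFun.toContinuousLinearEquiv
  have h1 : AnalyticAt ℂ (fun y => e (g y)) x := by
    rw [analyticAt_pi_iff]
    intro i
    exact h ((LinearMap.proj i) ∘ₗ (Module.finBasis ℂ F).equivFun.toLinearMap)
  have := ((e.symm : _ →L[ℂ] F).analyticAt _).comp h1
  simpa [Function.comp_def] using this

theorem MemRingMap.analyticAt {g : V0 × V1 → F} (hg : MemRingMap V0 V1 F g) (x0 : V0) :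
    AnalyticAt ℂ g (x0, 0) :=
  analyticAt_of_forall_linear fun φ => (hg φ).analyticAt x0

omit [FiniteDimensional ℂ F] in
theorem MemRingMap.isPolyFun {g : V0 × V1 → F} (hg : MemRingMap V0 V1 F g) {p : F → ℂ}
    (hp : IsPolyFun p) : IsPolyFun fun x0 : V0 => p (g (x0, 0)) :=
  hp.comp fun φ => (hg φ).isPolyFun

omit [FiniteDimensional ℂ F] in
theorem MemRingMap.linear_comp {g : V0 × V1 → F} (hg : MemRingMap V0 V1 F g) (L : F →ₗ[ℂ] G) :
    MemRingMap V0 V1 G fun x => L (g x) := fun φ => hg (φ ∘ₗ L)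

omit [FiniteDimensional ℂ F] in
theorem MemRingMap.prodMk {f : V0 × V1 → F} {g : V0 × V1 → G} (hf : MemRingMap V0 V1 F f)
    (hg : MemRingMap V0 V1 G g) : MemRingMap V0 V1 (F × G) fun x => (f x, g x) := by
  intro φ
  refine ((hf (φ ∘ₗ LinearMap.inl ℂ F G)).add (hg (φ ∘ₗ LinearMap.inr ℂ F G))).congr
    fun x0 => Eventually.of_forall fun x => ?_
  simp [← map_add]

theorem MemRing.toMap {f : V0 × V1 → ℂ} (hf : MemRing V0 V1 f) : MemRingMap V0 V1 ℂ f := by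
  intro φ
  refine ((memRing_const (φ 1)).mul hf).congr fun x0 => Eventually.of_forall fun x => ?_
  have := φ.map_smul (f x) 1
  simp only [smul_eq_mul, mul_one] at this
  simp only [this, mul_comm]

theorem memRingMap_pi {ι : Type*} [Fintype ι] {F : ι → Type*} [∀ i, NormedAddCommGroup (F i)]
    [∀ i, NormedSpace ℂ (F i)] {g : V0 × V1 → ∀ i, F i}
    (hg : ∀ i, MemRingMap V0 V1 (F i) fun x => g x i) : MemRingMap V0 V1 (∀ i, F i) g := by
  classical
  intro φ
  refine (MemRing.sum Finset.univ fun i => hg i (φ ∘ₗ LinearMap.single ℂ F i)).congr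
    fun x0 => Eventually.of_forall fun x => ?_
  simp only [LinearMap.comp_apply, LinearMap.coe_single]
  rw [← map_sum, Finset.univ_sum_single]

omit [FiniteDimensional ℂ F] in
theorem memRingMap_linear [FiniteDimensional ℂ V0] [FiniteDimensional ℂ V1]
    (L : V0 × V1 →ₗ[ℂ] F) : MemRingMap V0 V1 F fun x => L x := fun φ =>
  memRing_linear (LinearMap.toContinuousLinearMap (φ ∘ₗ L))

theorem MemRingMap.fderiv_apply [FiniteDimensional ℂ V0] [FiniteDimensional ℂ V1]
    {E : Type*} [NormedAddCommGroup E] [NormedSpace ℂ E] [FiniteDimensional ℂ E]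
    {f : E → ℂ} {g h : V0 × V1 → E} (hh : MemRingMap V0 V1 E h)
    (hfg : ∀ v, MemRing V0 V1 fun x => fderiv ℂ f (g x) v) :
    MemRing V0 V1 fun x => fderiv ℂ f (g x) (h x) := by
  let b := Module.finBasis ℂ E
  refine (MemRing.sum Finset.univ fun i => (hh (b.coord i)).mul (hfg (b i))).congr
    fun x0 => Eventually.of_forall fun x => ?_
  show _ = fderiv ℂ f (g x) (h x)
  conv_rhs => rw [← b.sum_repr (h x), map_sum]
  simp only [map_smul, smul_eq_mul, Module.Basis.coord_apply]

theorem MemRing.comp [FiniteDimensional ℂ V0] [FiniteDimensional ℂ V1]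
    {f : V0 × V1 → ℂ} (hf : MemRing V0 V1 f)
    {g : W0 × W1 → V0 × V1} (hg : MemRingMap W0 W1 (V0 × V1) g) (h0 : ∀ x0, (g (x0, 0)).2 = 0) :
    MemRing W0 W1 fun x => f (g x) := by
  have hfa : ∀ {f : V0 × V1 → ℂ}, MemRing V0 V1 f → ∀ x0 : W0, AnalyticAt ℂ f (g (x0, 0)) := by
    intro f hf x0
    have := hf.analyticAt (g (x0, 0)).1
    rwa [← h0 x0] at this
  have hfg : ∀ {f : V0 × V1 → ℂ}, MemRing V0 V1 f → ∀ x0 : W0,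
      AnalyticAt ℂ (fun x => f (g x)) (x0, 0) := fun hf x0 =>
    (hfa hf x0).comp (hg.analyticAt x0)
  have hpoly : ∀ {f : V0 × V1 → ℂ}, MemRing V0 V1 f → IsPolyFun fun x0 : W0 => f (g (x0, 0)) := by
    intro f hf
    have := hf.isPolyFun.comp (g := fun x0 : W0 => (g (x0, 0)).1)
      fun φ => (hg (φ ∘ₗ LinearMap.fst ℂ V0 V1)).isPolyFun
    convert this using 3 with x0
    rw [← h0 x0]
  let b := Module.finBasis ℂ (V0 × V1)
  have hgd : ∀ v i, MemRing W0 W1 fun x => b.coord i (_root_.fderiv ℂ g x v) := by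
    intro v i
    refine ((hg (b.coord i)).fderiv v).congr fun x0 => ?_
    filter_upwards [(hg.analyticAt x0).eventually_analyticAt] with y hy
    have := ((LinearMap.toContinuousLinearMap (b.coord i)).hasFDerivAt.comp y
      hy.differentiableAt.hasFDerivAt).fderiv
    simp only [Function.comp_def] at this
    erw [this]; rfl
  have key : ∀ (vs : List (W0 × W1)) (f : V0 × V1 → ℂ) (h : W0 × W1 → ℂ), MemRing V0 V1 f →
      MemRing W0 W1 h → IsPolyFun fun x0 : W0 => iterDeriv vs (fun x => f (g x) * h x) (x0, 0) := by
    intro vs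
    induction vs with
    | nil => intro f h hf hh; exact (hpoly hf).mul hh.isPolyFun
    | cons v vs ih =>
      intro f h hf hh
      let T : Fin (Module.finrank ℂ (V0 × V1)) → W0 × W1 → ℂ := fun i x =>
        _root_.fderiv ℂ f (g x) (b i) * (b.coord i (_root_.fderiv ℂ g x v) * h x)
      have hT : ∀ i x0, AnalyticAt ℂ (T i) ((x0, 0) : W0 × W1) := fun i x0 =>
        (hfg (hf.fderiv (b i)) x0).fun_mul
          (((hgd v i).mul hh).analyticAt x0)
      have hsum : ∀ (s : Finset (Fin (Module.finrank ℂ (V0 × V1)))) (x0 : W0),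
          iterDeriv vs (fun x => ∑ i ∈ s, T i x) =ᶠ[𝓝 ((x0, 0) : W0 × W1)]
            fun x => ∑ i ∈ s, iterDeriv vs (T i) x := by
        intro s x0
        classical
        induction s using Finset.induction_on with
        | empty =>
          simp only [Finset.sum_empty]
          clear ih
          induction vs with
          | nil => exact EventuallyEq.rfl
          | cons w vs ih => simpa [iterDeriv] using ih
        | insert a s ha ih' =>
          simp only [Finset.sum_insert ha]
          refine (iterDeriv_add vs (hT a x0) (Finset.analyticAt_fun_sum s fun i _ => hT i x0)).trans ?_
          filter_upwards [ih'] with x hx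
          rw [hx]
      have e : ∀ x0 : W0, iterDeriv (v :: vs) (fun x => f (g x) * h x) (x0, 0) =
          (∑ i, iterDeriv vs (T i) (x0, 0)) +
          iterDeriv vs (fun x => f (g x) * _root_.fderiv ℂ h x v) (x0, 0) := by
        intro x0
        have : iterDeriv (v :: vs) (fun x => f (g x) * h x) =ᶠ[𝓝 ((x0, 0) : W0 × W1)]
            iterDeriv vs fun x => (∑ i, T i x) + f (g x) * _root_.fderiv ℂ h x v := by
          refine iterDeriv_congr vs ?_
          filter_upwards [(hg.analyticAt x0).eventually_analyticAt,
            (hg.analyticAt x0).continuousAt.eventually (hfa hf x0).eventually_analyticAt,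
            (hh.analyticAt x0).eventually_analyticAt] with y h1 h2 h3
          have hc := h2.differentiableAt.hasFDerivAt.comp y h1.differentiableAt.hasFDerivAt
          have := (hc.mul h3.differentiableAt.hasFDerivAt).fderiv
          simp only [Function.comp_def] at this
          erw [this]
          simp only [add_apply, smul_apply,
            ContinuousLinearMap.comp_apply, smul_eq_mul, T]
          rw [add_comm]
          congr 1
          conv_lhs => rw [← b.sum_repr (_root_.fderiv ℂ g y v)]
          simp only [map_sum, map_smul, smul_eq_mul, Finset.mul_sum, Module.Basis.coord_apply]
          exact Finset.sum_congr rfl fun i _ => by ring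
        have h2 := (iterDeriv_add vs (Finset.analyticAt_fun_sum Finset.univ fun i _ => hT i x0)
          ((hfg hf x0).fun_mul ((hh.fderiv v).analyticAt x0)))
        rw [this.eq_of_nhds, h2.eq_of_nhds, (hsum _ x0).eq_of_nhds]
      simp only [e]
      exact (IsPolyFun.sum _ fun i => ih _ _ (hf.fderiv (b i)) ((hgd v i).mul hh)).add
        (ih _ _ hf (hh.fderiv v))
  rw [memRing_iff]
  refine ⟨hfg hf, fun vs => ?_⟩
  simpa using key vs f (fun _ => 1) hf (memRing_const 1)

theorem MemRingMap.comp [FiniteDimensional ℂ V0] [FiniteDimensional ℂ V1]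
    {f : V0 × V1 → G} (hf : MemRingMap V0 V1 G f)
    {g : W0 × W1 → V0 × V1} (hg : MemRingMap W0 W1 (V0 × V1) g) (h0 : ∀ x0, (g (x0, 0)).2 = 0) :
    MemRingMap W0 W1 G fun x => f (g x) := fun φ => (hf φ).comp hg h0

theorem MemRing.comp_analyticAt
    {f : F → ℂ} (hf : AnalyticAt ℂ f 0)
    {g : W0 × W1 → F} (hg : MemRingMap W0 W1 F g) (h0 : ∀ x0, g (x0, 0) = 0) :
    MemRing W0 W1 fun x => f (g x) := by
  have h1 : MemRing ℂ F fun x => f x.2 := MemRing.of_analyticAt hf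
  exact h1.comp (g := fun x => (0, g x))
    ((memRing_const 0).toMap.prodMk hg) h0

theorem MemRing.div_one_add {θ e : V0 × V1 → ℂ} (hθ : MemRing V0 V1 θ) (he : MemRing V0 V1 e)
    (h0 : ∀ x0, e (x0, 0) = 0) : MemRing V0 V1 fun x => θ x / (1 + θ x * e x) := by
  have h1 : AnalyticAt ℂ (fun t : ℂ => (1 + t)⁻¹) 0 :=
    (analyticAt_const.fun_add analyticAt_id).fun_inv (by simp)
  refine hθ.mul (MemRing.comp_analyticAt h1 (hθ.mul he).toMap fun x0 => by simp [h0])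

end Maps

end Ring

section Order

variable {E F : Type*} [NormedAddCommGroup E] [NormedSpace ℂ E]
  [NormedAddCommGroup F] [NormedSpace ℂ F] [CompleteSpace F]

omit [NormedSpace ℂ E] [NormedSpace ℂ F] [CompleteSpace F] in
theorem isBigO_norm_pow_of_le {f : E → F} {k m : ℕ} {l : Filter E} (hl : l ≤ 𝓝 0)
    (h : f =O[l] fun x => ‖x‖ ^ k) (hm : m ≤ k) : f =O[l] fun x => ‖x‖ ^ m := by
  refine h.trans (IsBigO.of_bound 1 ?_)
  filter_upwards [hl (Metric.ball_mem_nhds (0 : E) one_pos)] with x hx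
  rw [mem_ball_zero_iff] at hx
  simpa using pow_le_pow_of_le_one (norm_nonneg x) hx.le hm

/-- Cauchy's estimate: differentiation lowers the order of vanishing by at most one. -/
theorem isBigO_fderiv_apply {f : E → F} (hf : AnalyticAt ℂ f 0) {k : ℕ}
    (h : f =O[𝓝 0] fun x => ‖x‖ ^ k) (v : E) :
    (fun x => fderiv ℂ f x v) =O[𝓝 0] fun x => ‖x‖ ^ (k - 1) := by
  rcases Nat.eq_zero_or_pos k with rfl | hk
  · simpa using (hf.fderiv_apply_const v).continuousAt.isBigO_one ℝ
  rw [← nhdsNE_sup_pure, isBigO_sup]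
  constructor
  · obtain ⟨C, hC⟩ := h.bound
    obtain ⟨r, hr, hr'⟩ := Metric.eventually_nhds_iff_ball.1 (hC.and hf.eventually_analyticAt)
    refine IsBigO.of_bound (C * (1 + ‖v‖) ^ k) ?_
    have hpos : (0 : ℝ) < 1 + ‖v‖ := by positivity
    have : ∀ᶠ x in 𝓝[≠] (0 : E), x ∈ Metric.ball (0 : E) (r / (1 + ‖v‖)) :=
      nhdsWithin_le_nhds (Metric.ball_mem_nhds _ (by positivity))
    filter_upwards [this, self_mem_nhdsWithin] with x hx hx0
    rw [mem_ball_zero_iff, lt_div_iff₀ hpos] at hx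
    have hxpos : 0 < ‖x‖ := norm_pos_iff.2 hx0
    have hin : ∀ t : ℂ, ‖t‖ ≤ ‖x‖ → ‖x + t • v‖ ≤ ‖x‖ * (1 + ‖v‖) := fun t ht =>
      calc ‖x + t • v‖ ≤ ‖x‖ + ‖t‖ * ‖v‖ := (norm_add_le _ _).trans (by rw [norm_smul])
        _ ≤ ‖x‖ * (1 + ‖v‖) := by nlinarith [norm_nonneg v]
    have hg : ∀ t : ℂ, ‖t‖ ≤ ‖x‖ →
        HasDerivAt (fun t : ℂ => f (x + t • v)) (fderiv ℂ f (x + t • v) v) t := by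
      intro t ht
      have h1 := (hr' (x + t • v) (by
        rw [mem_ball_zero_iff]; exact (hin t ht).trans_lt hx)).2.differentiableAt.hasFDerivAt
      have h2 : HasDerivAt (fun t : ℂ => x + t • v) v t := by
        simpa using ((hasDerivAt_id t).smul_const v).const_add x
      exact h1.comp_hasDerivAt t h2
    have hd : DiffContOnCl ℂ (fun t : ℂ => f (x + t • v)) (Metric.ball 0 ‖x‖) := by
      apply DifferentiableOn.diffContOnCl
      rw [closure_ball _ hxpos.ne']
      intro t ht
      exact (hg t (by simpa using ht)).differentiableAt.differentiableWithinAt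
    have := norm_deriv_le_of_forall_mem_sphere_norm_le hxpos hd
      (C := C * (‖x‖ * (1 + ‖v‖)) ^ k) (fun t ht => by
        have ht' : ‖t‖ = ‖x‖ := by simpa using ht
        have h1 := (hr' (x + t • v) (by
          rw [mem_ball_zero_iff]; exact (hin t ht'.le).trans_lt hx)).1
        rw [norm_pow, norm_norm] at h1
        have hC0 : 0 ≤ C := by
          have h2 := (hr' x (by rw [mem_ball_zero_iff]; nlinarith [norm_nonneg v])).1
          rw [norm_pow, norm_norm] at h2
          by_contra hneg
          have : C * ‖x‖ ^ k < 0 := mul_neg_of_neg_of_pos (not_le.1 hneg) (by positivity)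
          linarith [norm_nonneg (f x)]
        exact h1.trans (mul_le_mul_of_nonneg_left
          (pow_le_pow_left₀ (norm_nonneg _) (hin t ht'.le) k) hC0))
    rw [(hg 0 (by simp)).deriv] at this
    simp only [zero_smul, add_zero] at this
    rw [norm_pow, norm_norm]
    refine this.trans (le_of_eq ?_)
    rw [div_eq_iff hxpos.ne', mul_pow]
    have : ‖x‖ ^ k = ‖x‖ ^ (k - 1) * ‖x‖ := by rw [← pow_succ]; congr 1; omega
    rw [this]; ring
  · rw [isBigO_pure]
    intro h0
    simp only [norm_zero] at h0
    have hk2 : 1 < k := by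
      by_contra hlt
      have : k - 1 = 0 := by omega
      simp [this] at h0
    have : HasFDerivAt f (0 : E →L[ℂ] F) 0 := IsBigO.hasFDerivAt (by simpa using h) hk2
    simp [this.fderiv]

theorem isBigO_iterDeriv {f : E → F} (hf : AnalyticAt ℂ f 0) {k : ℕ}
    (h : f =O[𝓝 0] fun x => ‖x‖ ^ k) (vs : List E) :
    iterDeriv vs f =O[𝓝 0] fun x => ‖x‖ ^ (k - vs.length) := by
  induction vs generalizing f k with
  | nil => exact h
  | cons v vs ih =>
    have := ih (hf.fderiv_apply_const v) (isBigO_fderiv_apply hf h v)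
    rwa [Nat.sub_sub, add_comm 1] at this

omit [NormedSpace ℂ E] [NormedSpace ℂ F] [CompleteSpace F] in
theorem eq_zero_of_isBigO_norm_pow {l : Filter E} {f : E → F} {k : ℕ} (hk : 0 < k)
    (h : f =O[l] fun x => ‖x‖ ^ k) (hl : pure 0 ≤ l) : f 0 = 0 := by
  have := h.mono hl
  rw [isBigO_pure] at this
  exact this (by simp [hk.ne'])

variable {X : Type*} [NormedAddCommGroup X] [NormedSpace ℝ X]

theorem coeff_eq_zero_of_totally_real {f : E → ℂ}
    {p : FormalMultilinearSeries ℂ E ℂ} (hp : HasFPowerSeriesAt f p 0)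
    {φ : X → E} {L : X →L[ℝ] E} (hφ : HasFDerivAt φ L 0) (h0 : φ 0 = 0)
    (hL : ∀ y, ∃ a b, y = L a + I • L b) {k : ℕ}
    (h : (fun x => f (φ x)) =O[𝓝 0] fun x => ‖x‖ ^ k) :
    ∀ i < k, ∀ y : E, (p i fun _ => y) = 0 := by
  intro i
  induction i using Nat.strong_induction_on with
  | _ i ih =>
  intro hik
  have hps : ∀ y, p.partialSum (i + 1) y = p i fun _ => y := by
    intro y
    rw [FormalMultilinearSeries.partialSum, Finset.sum_range_succ,
      Finset.sum_eq_zero fun j hj => ih j (Finset.mem_range.1 hj)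
        ((Finset.mem_range.1 hj).trans hik) y, zero_add]
  have hφ0 : Tendsto φ (𝓝 0) (𝓝 0) := by simpa [h0] using hφ.continuousAt.tendsto
  have hφO : φ =O[𝓝 0] fun x => ‖x‖ := by
    simpa [h0] using hφ.isBigO_sub.norm_right
  have h1 := (hp.isBigO_sub_partialSum_pow (i + 1)).comp_tendsto hφ0
  simp only [Function.comp_def, zero_add, hps] at h1
  have h2 : (fun x => p i fun _ => φ x) =O[𝓝 0] fun x => ‖x‖ ^ (i + 1) := by
    have h3 := h1.trans (hφO.norm_left.pow (i + 1))
    have h4 : (fun x => f (φ x)) =O[𝓝 0] fun x => ‖x‖ ^ (i + 1) := by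
      refine h.trans (IsBigO.of_bound 1 ?_)
      filter_upwards [Metric.ball_mem_nhds (0 : X) one_pos] with x hx
      rw [mem_ball_zero_iff] at hx
      simpa using pow_le_pow_of_le_one (norm_nonneg x) hx.le (Nat.succ_le_of_lt hik)
    simpa using h4.sub h3
  have hcont : Continuous fun y : E => p i fun _ => y :=
    (p i).cont.comp (continuous_pi fun _ => continuous_id)
  have hreal : ∀ a, (p i fun _ => L a) = 0 := by
    intro a
    have hline : HasDerivAt (fun t : ℝ => φ (t • a)) (L a) 0 := by
      have hl : HasDerivAt (fun t : ℝ => t • a) a 0 := by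
        simpa using (hasDerivAt_id (0 : ℝ)).smul_const a
      have := (by simpa using hφ : HasFDerivAt φ L ((0 : ℝ) • a)).comp_hasDerivAt (0 : ℝ) hl
      exact this
    have t1 : Tendsto (fun t : ℝ => p i fun _ => ((t⁻¹ : ℝ) : ℂ) • φ (t • a)) (𝓝[≠] 0)
        (𝓝 (p i fun _ => L a)) := by
      refine (hcont.tendsto _).comp ?_
      have := hline.tendsto_slope_zero
      simp only [zero_add, zero_smul, h0, sub_zero] at this
      exact this.congr fun t => (Complex.coe_smul t⁻¹ _).symm
    have hsc : Tendsto (fun t : ℝ => t • a) (𝓝[≠] 0) (𝓝 0) := by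
      have : Tendsto (fun t : ℝ => t • a) (𝓝 0) (𝓝 ((0 : ℝ) • a)) :=
        (continuous_id.smul continuous_const).tendsto 0
      rw [zero_smul] at this
      exact this.mono_left nhdsWithin_le_nhds
    have t2 : Tendsto (fun t : ℝ => p i fun _ => ((t⁻¹ : ℝ) : ℂ) • φ (t • a)) (𝓝[≠] 0)
        (𝓝 0) := by
      obtain ⟨C, hC⟩ := h2.bound
      have hb : ∀ᶠ t : ℝ in 𝓝[≠] 0,
          ‖p i fun _ => ((t⁻¹ : ℝ) : ℂ) • φ (t • a)‖ ≤ C * ‖a‖ ^ (i + 1) * |t| := by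
        filter_upwards [hsc.eventually hC, self_mem_nhdsWithin] with t ht ht0
        have ht0' : 0 < |t| := abs_pos.2 ht0
        rw [(p i).map_smul_univ (fun _ => ((t⁻¹ : ℝ) : ℂ)) (fun _ => φ (t • a))]
        simp only [Finset.prod_const, Finset.card_univ, Fintype.card_fin, norm_smul, norm_pow,
          Complex.norm_real, norm_inv, Real.norm_eq_abs] at ht ⊢
        rw [abs_of_nonneg (by positivity : 0 ≤ |t| * ‖a‖)] at ht
        calc (|t|⁻¹) ^ i * ‖p i fun _ => φ (t • a)‖
            ≤ (|t|⁻¹) ^ i * (C * (|t| * ‖a‖) ^ (i + 1)) := by gcongr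
          _ = C * ‖a‖ ^ (i + 1) * |t| := by
              rw [mul_pow, pow_succ |t|, inv_pow]; field_simp
      refine squeeze_zero_norm' hb ?_
      have : Tendsto (fun t : ℝ => C * ‖a‖ ^ (i + 1) * |t|) (𝓝 0)
          (𝓝 (C * ‖a‖ ^ (i + 1) * |(0 : ℝ)|)) :=
        (continuous_const.mul continuous_abs).tendsto 0
      simp only [abs_zero, mul_zero] at this
      exact this.mono_left nhdsWithin_le_nhds
    exact tendsto_nhds_unique t1 t2
  intro y
  obtain ⟨a, b, rfl⟩ := hL y
  let g : ℂ → ℂ := fun t => p i fun _ => L a + t • L b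
  have hg : AnalyticOnNhd ℂ g Set.univ := by
    intro t _
    have h1 : Differentiable ℂ g := by
      intro t
      have hm : DifferentiableAt ℂ (fun m : Fin i → E => p i m) (fun _ => L a + t • L b) :=
        (p i).contDiff.differentiable one_ne_zero |>.differentiableAt
      refine hm.comp t (f := fun t : ℂ => fun _ : Fin i => L a + t • L b) ?_
      fun_prop
    exact h1.analyticAt t
  have hz : ∀ t : ℝ, g t = 0 := by
    intro t
    have : L a + ((t : ℝ) : ℂ) • L b = L (a + t • b) := by simp
    simp only [g, this, hreal]
  have hfreq : ∃ᶠ t in 𝓝[≠] (0 : ℂ), g t = 0 := by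
    have : Tendsto (fun t : ℝ => (t : ℂ)) (𝓝[≠] 0) (𝓝[≠] 0) := by
      refine tendsto_nhdsWithin_iff.2 ⟨?_, ?_⟩
      · exact (Complex.continuous_ofReal.tendsto' 0 0 (by simp)).mono_left nhdsWithin_le_nhds
      · filter_upwards [self_mem_nhdsWithin] with t ht
        simpa using ht
    exact this.frequently (Eventually.of_forall hz).frequently
  exact hg.eqOn_zero_of_preconnected_of_frequently_eq_zero isPreconnected_univ
    (Set.mem_univ 0) hfreq (Set.mem_univ I)

theorem isBigO_of_totally_real {f : E → ℂ} (hf : AnalyticAt ℂ f 0)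
    {φ : X → E} {L : X →L[ℝ] E} (hφ : HasFDerivAt φ L 0) (h0 : φ 0 = 0)
    (hL : ∀ y, ∃ a b, y = L a + I • L b) {k : ℕ}
    (h : (fun x => f (φ x)) =O[𝓝 0] fun x => ‖x‖ ^ k) : f =O[𝓝 0] fun y => ‖y‖ ^ k := by
  obtain ⟨p, hp⟩ := hf
  have hc := coeff_eq_zero_of_totally_real hp hφ h0 hL h
  have := hp.isBigO_sub_partialSum_pow k
  refine this.congr_left fun y => ?_
  rw [FormalMultilinearSeries.partialSum, Finset.sum_eq_zero fun i hi =>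
    hc i (Finset.mem_range.1 hi) y]
  simp

theorem eventually_eq_zero_of_totally_real {f : E → ℂ} (hf : AnalyticAt ℂ f 0)
    {φ : X → E} {L : X →L[ℝ] E} (hφ : HasFDerivAt φ L 0) (h0 : φ 0 = 0)
    (hL : ∀ y, ∃ a b, y = L a + I • L b)
    (h : ∀ᶠ x in 𝓝 0, f (φ x) = 0) : ∀ᶠ y in 𝓝 0, f y = 0 := by
  obtain ⟨p, hp⟩ := hf
  have hc : ∀ i (y : E), (p i fun _ => y) = 0 := fun i =>
    coeff_eq_zero_of_totally_real hp hφ h0 hL (k := i + 1)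
      ((EventuallyEq.isBigO h).trans (isBigO_zero _ _)) i (Nat.lt_succ_self i)
  filter_upwards [hp.eventually_hasSum] with y hy
  simp only [hc, zero_add] at hy
  exact hy.unique hasSum_zero

omit [NormedSpace ℝ X] [NormedAddCommGroup X] in
/-- Near a point where it is a submersion, the distance of a point to the zero set of a map is
controlled by the value of the map. -/
theorem exists_zero_near {E F : Type*} [NormedAddCommGroup E] [NormedSpace ℝ E] [CompleteSpace E]
    [NormedAddCommGroup F] [NormedSpace ℝ F] [CompleteSpace F] {ρ : E → F} {ρ' : E →L[ℝ] F} {x : E}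
    (h : HasStrictFDerivAt ρ ρ' x) (hs : Function.Surjective ρ') (hx : ρ x = 0) :
    ∃ C : ℝ, ∀ᶠ y in 𝓝 x, ∃ z, ρ z = 0 ∧ ‖y - z‖ ≤ C * ‖ρ y‖ := by
  obtain ⟨fs, hfs⟩ := ρ'.exists_nonlinearRightInverse_of_surjective
    (LinearMap.range_eq_top.2 hs)
  have hκ : 0 < (fs.nnnorm : ℝ)⁻¹ := by positivity
  obtain ⟨s, hsx, happ⟩ := h.approximates_deriv_on_nhds (c := fs.nnnorm⁻¹ / 2)
    (Or.inr (by positivity))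
  obtain ⟨r, hr, hrs⟩ := Metric.mem_nhds_iff.1 hsx
  set κ : ℝ := (fs.nnnorm : ℝ)⁻¹ / 2 with hκdef
  have hκ0 : 0 < κ := by positivity
  refine ⟨κ⁻¹, ?_⟩
  have hcont : Tendsto (fun y => κ⁻¹ * ‖ρ y‖) (𝓝 x) (𝓝 0) := by
    have := (h.continuousAt.norm.tendsto).const_mul κ⁻¹
    simpa [hx] using this
  filter_upwards [Metric.ball_mem_nhds x (half_pos hr), hcont.eventually (gt_mem_nhds (half_pos hr))]
    with y hy hy2
  have hsub : Metric.closedBall y (κ⁻¹ * ‖ρ y‖) ⊆ s := by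
    refine Set.Subset.trans (fun w hw => ?_) hrs
    rw [Metric.mem_closedBall] at hw
    rw [Metric.mem_ball] at hy ⊢
    linarith [dist_triangle w y x]
  have := happ.surjOn_closedBall_of_nonlinearRightInverse fs (by positivity) hsub
  obtain ⟨z, hz, hz0⟩ := this (show (0 : F) ∈ _ by
    rw [Metric.mem_closedBall, dist_zero_left]
    have : (fs.nnnorm : ℝ)⁻¹ - ((fs.nnnorm⁻¹ / 2 : NNReal) : ℝ) = κ := by
      push_cast; rw [hκdef]; ring
    rw [this, ← mul_assoc, mul_inv_cancel₀ hκ0.ne', one_mul])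
  refine ⟨z, hz0, ?_⟩
  rw [Metric.mem_closedBall, dist_comm, dist_eq_norm] at hz
  exact hz

end Order

section Jets

theorem coe_flatMap_replicate {V : Type*} {m : ℕ} (g : Fin m → V) (β : Fin m → ℕ) :
    (((List.finRange m).flatMap fun i => List.replicate (β i) (g i) : List V) : Multiset V) =
      ∑ i, β i • ({g i} : Multiset V) := by
  have h : ∀ l : List (Fin m),
      ((l.flatMap fun i => List.replicate (β i) (g i) : List V) : Multiset V) =
        (l.map fun i => β i • ({g i} : Multiset V)).sum := by
    intro l
    induction l with
    | nil => rfl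
    | cons a l ih =>
      rw [List.flatMap_cons, ← Multiset.coe_add, ih, List.map_cons, List.sum_cons,
        Multiset.nsmul_singleton, Multiset.coe_replicate]
  rw [h, Fin.sum_univ_def]

variable {N : ℕ} {F : Type*} [NormedAddCommGroup F] [NormedSpace ℂ F] [CompleteSpace F]

theorem mderivIdx_eventuallyEq_of_perm {m : ℕ} {idx : Fin m → Fin N} {β : Fin m → ℕ}
    {vs : List (Cn N)} (h : (vs : Multiset (Cn N)) =
      ∑ i, β i • ({Pi.single (idx i) (1 : ℂ)} : Multiset (Cn N))) {f : Cn N → F} {Z : Cn N}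
    (hf : AnalyticAt ℂ f Z) : mderivIdx m idx β f =ᶠ[𝓝 Z] iterDeriv vs f := by
  refine iterDeriv_perm ?_ hf
  rw [← Multiset.coe_eq_coe, h, coe_flatMap_replicate]

theorem mderivIdx_add_single {m : ℕ} (idx : Fin m → Fin N) (β : Fin m → ℕ) (a : Fin m)
    {f : Cn N → F} {Z : Cn N} (hf : AnalyticAt ℂ f Z) :
    mderivIdx m idx (fun i => β i + if i = a then 1 else 0) f =ᶠ[𝓝 Z]
      fun W => fderiv ℂ (mderivIdx m idx β f) W (Pi.single (idx a) 1) := by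
  refine (mderivIdx_eventuallyEq_of_perm (vs := ((List.finRange m).flatMap fun i =>
    List.replicate (β i) ((Pi.single (idx i) (1:ℂ) : Cn N))) ++ [Pi.single (idx a) 1]) ?_ hf).trans
    ?_
  · rw [← Multiset.coe_add, coe_flatMap_replicate]
    simp [add_smul, Finset.sum_add_distrib, ite_smul]
  · rw [iterDeriv_concat]; rfl

theorem AnalyticAt.mderivIdx {m : ℕ} (idx : Fin m → Fin N) (β : Fin m → ℕ)
    {f : Cn N → F} {Z : Cn N} (hf : AnalyticAt ℂ f Z) : AnalyticAt ℂ (mderivIdx m idx β f) Z :=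
  analyticAt_iterDeriv _ hf

/-- The multi-index `α + e_a`. -/
def MIdx.up {m r : ℕ} (a : Fin m) (α : MIdx m r) : MIdx m (r + 1) :=
  ⟨fun i => ⟨α.1 i + if i = a then 1 else 0, by have := (α.1 i).2; split_ifs <;> omega⟩, by
    simpa [Finset.sum_add_distrib] using α.2⟩

/-- A multi-index of degree at most `r` as one of degree at most `r + 1`. -/
def MIdx.incl {m r : ℕ} (α : MIdx m r) : MIdx m (r + 1) :=
  ⟨fun i => (α.1 i).castSucc, by simpa using Nat.le_succ_of_le α.2⟩

/-- The zero multi-index. -/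
def MIdx.zero (m r : ℕ) : MIdx m r := ⟨fun _ => 0, by simp⟩

variable {n d₁ d₂ : ℕ} {B : Cn (n + (d₁ + d₂)) → Cn (n + (d₁ + d₂))} {Z : Cn (n + (d₁ + d₂))}

omit [CompleteSpace F] in
theorem mderivIdx_zero {m : ℕ} (idx : Fin m → Fin N) (f : Cn N → F) :
    mderivIdx m idx (fun _ => 0) f = f := by
  have : ((List.finRange m).flatMap fun i : Fin m =>
      List.replicate 0 ((Pi.single (idx i) (1:ℂ) : Cn N))) = [] := by simp
  rw [mderivIdx, this]; rfl

@[simp] theorem jetFull_zero (r : ℕ) (B : Cn N → Cn N) (Z : Cn N) :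
    jetFull N r B Z (.zero N r) = B Z := by
  simp only [jetFull, MIdx.zero, Fin.val_zero, mderivIdx_zero]

@[simp] theorem jetZG_zero (r : ℕ) : jetZG n d₁ d₂ r B Z (.zero n r) = Gpart n d₁ d₂ B Z := by
  simp only [jetZG, MIdx.zero, Fin.val_zero, mderivIdx_zero]

@[simp] theorem jetFull_incl (r : ℕ) (B : Cn N → Cn N) (Z : Cn N) (α : MIdx N r) :
    jetFull N (r + 1) B Z α.incl = jetFull N r B Z α := rfl

@[simp] theorem jetZG_incl (r : ℕ) (α : MIdx n r) :
    jetZG n d₁ d₂ (r + 1) B Z α.incl = jetZG n d₁ d₂ r B Z α := rfl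

theorem analyticAt_jetFull_apply {r : ℕ} {B : Cn N → Cn N} {Z : Cn N} (hB : AnalyticAt ℂ B Z)
    (α : MIdx N r) : AnalyticAt ℂ (fun W => jetFull N r B W α) Z :=
  hB.mderivIdx _ _

theorem analyticAt_jetFull {r : ℕ} {B : Cn N → Cn N} {Z : Cn N} (hB : AnalyticAt ℂ B Z) :
    AnalyticAt ℂ (jetFull N r B) Z := by
  rw [analyticAt_pi_iff]; exact analyticAt_jetFull_apply hB

theorem AnalyticAt.Gpart (hB : AnalyticAt ℂ B Z) : AnalyticAt ℂ (Gpart n d₁ d₂ B) Z := by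
  rw [analyticAt_pi_iff]
  intro i
  exact analyticAt_pi_iff.1 hB _

theorem AnalyticAt.Fpart (hB : AnalyticAt ℂ B Z) : AnalyticAt ℂ (Fpart n d₁ d₂ B) Z := by
  rw [analyticAt_pi_iff]
  intro i
  exact analyticAt_pi_iff.1 hB _

theorem analyticAt_jetZG_apply {r : ℕ} (hB : AnalyticAt ℂ B Z)
    (α : MIdx n r) : AnalyticAt ℂ (fun W => jetZG n d₁ d₂ r B W α) Z :=
  AnalyticAt.mderivIdx (f := Gpart n d₁ d₂ B) _ _ hB.Gpart

theorem analyticAt_jetZG {r : ℕ} (hB : AnalyticAt ℂ B Z) :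
    AnalyticAt ℂ (jetZG n d₁ d₂ r B) Z := by
  rw [analyticAt_pi_iff]; exact analyticAt_jetZG_apply hB

theorem analyticAt_calJ {r : ℕ} (hB : AnalyticAt ℂ B Z) :
    AnalyticAt ℂ (calJ n d₁ d₂ r B) Z :=
  (analyticAt_jetFull hB).prod ((analyticAt_jetZG hB).prod hB.Fpart)

theorem jetFull_up {r : ℕ} {B : Cn N → Cn N} {Z : Cn N} (hB : AnalyticAt ℂ B Z) (α : MIdx N r)
    (a : Fin N) : jetFull N (r + 1) B Z (α.up a) =
      fderiv ℂ (fun W => jetFull N r B W α) Z (Pi.single a 1) :=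
  (mderivIdx_add_single id (fun i => (α.1 i : ℕ)) a hB).eq_of_nhds

theorem jetZG_up {r : ℕ} (hB : AnalyticAt ℂ B Z) (α : MIdx n r)
    (a : Fin n) : jetZG n d₁ d₂ (r + 1) B Z (α.up a) =
      fderiv ℂ (fun W => jetZG n d₁ d₂ r B W α) Z (Pi.single (zIdx n d₁ d₂ a) 1) :=
  (mderivIdx_add_single (zIdx n d₁ d₂) (fun i => (α.1 i : ℕ)) a hB.Gpart).eq_of_nhds

end Jets

section PointSpace

variable (n d₁ d₂ : ℕ)

/-- The coordinates `(Z, χ)` on the complexification of `M`. -/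
abbrev XSp : Type := Cn (n + (d₁ + d₂)) × Cn n

/-- The space of a reciprocal together with a full jet. -/
abbrev VZero (m : ℕ) : Type := ℂ × JetSp m (n + (d₁ + d₂)) (n + (d₁ + d₂))

/-- The space of the small parameters. -/
abbrev VOne (m : ℕ) : Type := (JetSp m n (d₁ + d₂) × Cn n) × XSp n d₁ d₂

/-- The space on which the universal functions of the jets live. -/
abbrev PSp (m : ℕ) : Type := VZero n d₁ d₂ m × VOne n d₁ d₂ m

variable {n d₁ d₂}

theorem memRingMap_of_isLinearMap {V0 V1 F : Type*} [NormedAddCommGroup V0] [NormedSpace ℂ V0]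
    [NormedAddCommGroup V1] [NormedSpace ℂ V1] [NormedAddCommGroup F] [NormedSpace ℂ F]
    [FiniteDimensional ℂ F] [FiniteDimensional ℂ V0] [FiniteDimensional ℂ V1] {f : V0 × V1 → F}
    (hf : IsLinearMap ℂ f) : MemRingMap V0 V1 F f :=
  memRingMap_linear hf.mk'

theorem memRing_of_isLinearMap {V0 V1 : Type*} [NormedAddCommGroup V0] [NormedSpace ℂ V0]
    [NormedAddCommGroup V1] [NormedSpace ℂ V1]
    [FiniteDimensional ℂ V0] [FiniteDimensional ℂ V1] {f : V0 × V1 → ℂ}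
    (hf : IsLinearMap ℂ f) : MemRing V0 V1 f :=
  memRing_linear (LinearMap.toContinuousLinearMap hf.mk')

/-- The polynomial `det F_z` on the space of jets of positive order. -/
def qdet : (m : ℕ) → JetSp m (n + (d₁ + d₂)) (n + (d₁ + d₂)) → ℂ
  | 0, _ => 1
  | m + 1, Λ => (Matrix.of fun i i' : Fin n =>
      Λ ((MIdx.zero _ m).up (zIdx n d₁ d₂ i')) (zIdx n d₁ d₂ i)).det

theorem isPolyFun_det {V : Type*} [AddCommGroup V] [Module ℂ V] {n : ℕ} {A : V → Matrix (Fin n) (Fin n) ℂ}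
    (hA : ∀ i j, IsPolyFun fun x => A x i j) : IsPolyFun fun x => (A x).det := by
  simp only [Matrix.det_apply, Units.smul_def, zsmul_eq_mul]
  exact IsPolyFun.sum _ fun σ => (IsPolyFun.const _).mul (IsPolyFun.prod _ fun i => hA _ _)

theorem isPolyFun_qdet (m : ℕ) : IsPolyFun (qdet (n := n) (d₁ := d₁) (d₂ := d₂) m) := by
  cases m with
  | zero => exact .const 1
  | succ m =>
    refine isPolyFun_det fun i i' => ?_
    exact .linear (IsLinearMap.mk' (fun Λ : JetSp (m + 1) (n + (d₁ + d₂)) (n + (d₁ + d₂)) =>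
      Λ ((MIdx.zero _ m).up (zIdx n d₁ d₂ i')) (zIdx n d₁ d₂ i)) ⟨fun _ _ => rfl, fun _ _ => rfl⟩)

variable {B : Cn (n + (d₁ + d₂)) → Cn (n + (d₁ + d₂))} {Z : Cn (n + (d₁ + d₂))}

theorem qdet_jetFull (m : ℕ) (hB : AnalyticAt ℂ B Z) :
    qdet (m + 1) (jetFull _ (m + 1) B Z) = detFz n d₁ d₂ B Z := by
  simp only [qdet, detFz, jetFull_up hB, jetFull_zero]
  congr 2
  ext i i'
  rw [fderiv_apply hB.differentiableAt]
  rfl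

/-- `B` has, at the origin, the properties of a map satisfying the basic identity to a high
order. -/
def Good (m : ℕ) (B : Cn (n + (d₁ + d₂)) → Cn (n + (d₁ + d₂))) : Prop :=
  AnalyticAt ℂ B 0 ∧ jetZG n d₁ d₂ m B 0 = 0 ∧ Fpart n d₁ d₂ B 0 = 0 ∧
    qdet m (jetFull _ m B 0) ≠ 0

theorem Good.of_succ {m : ℕ} (h : Good (m + 1) B) : Good m B := by
  refine ⟨h.1, ?_, h.2.2.1, ?_⟩
  · ext1 α
    exact congrFun h.2.1 α.incl
  · cases m with
    | zero => exact one_ne_zero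
    | succ m => exact h.2.2.2

theorem analyticAt_qdet (m : ℕ) (Λ : JetSp m (n + (d₁ + d₂)) (n + (d₁ + d₂))) :
    AnalyticAt ℂ (qdet (n := n) (d₁ := d₁) (d₂ := d₂) m) Λ :=
  ((MemRing.of_isPolyFun (V1 := ℂ) (isPolyFun_qdet m)).analyticAt Λ).comp
    (f := fun Λ => (Λ, (0 : ℂ))) (analyticAt_id.prod analyticAt_const)

variable (ζm : XSp n d₁ d₂ → Cn (n + (d₁ + d₂)))

/-- The point of `PSp` determined by a map. -/
def pt (m : ℕ) (B : Cn (n + (d₁ + d₂)) → Cn (n + (d₁ + d₂))) (x : XSp n d₁ d₂) :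
    PSp n d₁ d₂ m :=
  ((1 / qdet m (jetFull _ m B (ζm x)), jetFull _ m B (ζm x)),
    ((jetZG n d₁ d₂ m B (ζm x), Fpart n d₁ d₂ B (ζm x)), x))

/-- The projection forgetting the jets of highest order. -/
def projP : (m : ℕ) → PSp n d₁ d₂ (m + 1) → PSp n d₁ d₂ m
  | 0, p => ((1, fun α => p.1.2 α.incl), ((fun α => p.2.1.1 α.incl, p.2.1.2), p.2.2))
  | _ + 1, p => ((p.1.1, fun α => p.1.2 α.incl), ((fun α => p.2.1.1 α.incl, p.2.1.2), p.2.2))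

theorem projP_snd (m : ℕ) (p : PSp n d₁ d₂ (m + 1)) :
    (projP m p).2 = ((fun α => p.2.1.1 α.incl, p.2.1.2), p.2.2) := by cases m <;> rfl

theorem projP_pt (m : ℕ) (x : XSp n d₁ d₂) : projP m (pt ζm (m + 1) B x) = pt ζm m B x := by
  cases m with
  | zero => simp only [projP, pt, qdet, jetFull_incl, jetZG_incl, div_one]
  | succ m => rfl

theorem memRingMap_projP (m : ℕ) : MemRingMap _ _ _ (projP (n := n) (d₁ := d₁) (d₂ := d₂) m) := by
  cases m with
  | zero =>
    exact MemRingMap.prodMk (MemRingMap.prodMk (memRing_const 1).toMap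
      (memRingMap_of_isLinearMap ⟨fun _ _ => rfl, fun _ _ => rfl⟩))
      (memRingMap_of_isLinearMap ⟨fun _ _ => rfl, fun _ _ => rfl⟩)
  | succ m => exact memRingMap_of_isLinearMap ⟨fun _ _ => rfl, fun _ _ => rfl⟩

theorem projP_zero (m : ℕ) (x0 : VZero n d₁ d₂ (m + 1)) : (projP m (x0, 0)).2 = 0 := by
  rw [projP_snd]; rfl

variable {ζm} (hζ : AnalyticAt ℂ ζm 0) (hζ0 : ζm 0 = 0)

include hζ hζ0

theorem eventually_analyticAt_comp (hB : AnalyticAt ℂ B 0) :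
    ∀ᶠ x in 𝓝 0, AnalyticAt ℂ B (ζm x) := by
  have := hζ.continuousAt.tendsto
  rw [hζ0] at this
  exact this.eventually hB.eventually_analyticAt

theorem analyticAt_pt {m : ℕ} (hB : Good m B) : AnalyticAt ℂ (pt ζm m B) 0 := by
  have hB0 : AnalyticAt ℂ B (ζm 0) := by rw [hζ0]; exact hB.1
  have hj : AnalyticAt ℂ (fun x => jetFull _ m B (ζm x)) 0 := (analyticAt_jetFull hB0).comp hζ
  have hq : AnalyticAt ℂ (fun x => qdet m (jetFull _ m B (ζm x))) 0 :=
    (analyticAt_qdet m _).comp hj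
  exact ((analyticAt_const.div hq (by simpa [hζ0] using hB.2.2.2)).prod hj).prod
    ((((analyticAt_jetZG hB0).comp hζ).prod (hB0.Fpart.comp hζ)).prod analyticAt_id)

omit hζ in
theorem pt_zero {m : ℕ} (hB : Good m B) :
    pt ζm m B 0 = ((1 / qdet m (jetFull _ m B 0), jetFull _ m B 0), 0) := by
  simp only [pt, hζ0, hB.2.1, hB.2.2.1]; rfl

theorem tendsto_pt {m : ℕ} (hB : Good m B) :
    Tendsto (pt ζm m B) (𝓝 0) (𝓝 ((1 / qdet m (jetFull _ m B 0), jetFull _ m B 0), 0)) := by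
  rw [← pt_zero hζ0 hB]
  exact (analyticAt_pt hζ hζ0 hB).continuousAt

end PointSpace

section TotalDerivative

theorem ContinuousLinearMap.apply_eq_sum_single {N : ℕ} {F : Type*} [NormedAddCommGroup F]
    [NormedSpace ℂ F] (L : Cn N →L[ℂ] F) (v : Cn N) :
    L v = ∑ a, v a • L (Pi.single a 1) := by
  conv_lhs => rw [← Finset.univ_sum_single v]
  rw [map_sum]
  refine Finset.sum_congr rfl fun a _ => ?_
  rw [← map_smul, ← Pi.single_smul, smul_eq_mul, mul_one]

variable {n d₁ d₂ : ℕ}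

/-- Extension of a multi-index in the variables `z` by zero. -/
def MIdx.ext {r : ℕ} (ν : MIdx n r) : MIdx (n + (d₁ + d₂)) r :=
  ⟨Fin.append ν.1 (fun _ => 0), by
    rw [Fin.sum_univ_add]
    simpa only [Fin.append_left, Fin.append_right, Fin.val_zero, Finset.sum_const_zero,
      add_zero] using ν.2⟩

variable {B : Cn (n + (d₁ + d₂)) → Cn (n + (d₁ + d₂))} {Z : Cn (n + (d₁ + d₂))}

theorem jetZG_eventuallyEq {r : ℕ} (hB : AnalyticAt ℂ B Z) (ν : MIdx n r) :
    (fun W => jetZG n d₁ d₂ r B W ν) =ᶠ[𝓝 Z]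
      fun W j => jetFull _ r B W (ν.ext (d₁ := d₁) (d₂ := d₂)) (wfIdx n d₁ d₂ j) := by
  let L : Cn (n + (d₁ + d₂)) →L[ℂ] Cn (d₁ + d₂) :=
    ContinuousLinearMap.pi fun j => ContinuousLinearMap.proj (wfIdx n d₁ d₂ j)
  have h1 := iterDeriv_clm_comp L ((List.finRange n).flatMap fun i =>
    List.replicate (ν.1 i : ℕ) ((Pi.single (zIdx n d₁ d₂ i) (1:ℂ) : Cn (n + (d₁ + d₂))))) hB
  have h2 := mderivIdx_eventuallyEq_of_perm (idx := id)
    (β := fun i => (((ν.ext (d₁ := d₁) (d₂ := d₂)).1 i : ℕ)))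
    (vs := (List.finRange n).flatMap fun i =>
      List.replicate (ν.1 i : ℕ) ((Pi.single (zIdx n d₁ d₂ i) (1:ℂ) : Cn (n + (d₁ + d₂)))))
    (by
      rw [coe_flatMap_replicate, Fin.sum_univ_add]
      simp only [MIdx.ext, Fin.append_left, Fin.append_right, Fin.val_zero, zero_smul,
        Finset.sum_const_zero, add_zero, id, zIdx]) hB
  filter_upwards [h1, h2] with W h1 h2
  refine h1.trans ?_
  funext j
  exact congrFun h2.symm _

/-- The derivative of the jets along `c`, in terms of the jets of the next order. -/
def dJet (m : ℕ) (c : Cn (n + (d₁ + d₂))) (p : PSp n d₁ d₂ (m + 1)) :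
    JetSp m (n + (d₁ + d₂)) (n + (d₁ + d₂)) := fun α => ∑ a, c a • p.1.2 (α.up a)

/-- The derivative of the jets of `G` along `c`, in terms of the jets of the next order. -/
def dJetZG (m : ℕ) (c : Cn (n + (d₁ + d₂))) (p : PSp n d₁ d₂ (m + 1)) : JetSp m n (d₁ + d₂) :=
  fun ν => (∑ i, c (zIdx n d₁ d₂ i) • p.2.1.1 (ν.up i)) +
    ∑ j, c (wfIdx n d₁ d₂ j) • fun b => p.1.2 (ν.ext.up (wfIdx n d₁ d₂ j)) (wfIdx n d₁ d₂ b)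

/-- The derivative of `F` along `c`, in terms of the jet. -/
def dF (m : ℕ) (c : Cn (n + (d₁ + d₂))) (p : PSp n d₁ d₂ (m + 1)) : Cn n :=
  fun i => ∑ a, c a * p.1.2 ((MIdx.zero _ m).up a) (zIdx n d₁ d₂ i)

theorem fderiv_jetFull {m : ℕ} (hB : AnalyticAt ℂ B Z) (c : Cn (n + (d₁ + d₂)))
    {p : PSp n d₁ d₂ (m + 1)} (hp : p.1.2 = jetFull _ (m + 1) B Z) :
    fderiv ℂ (jetFull _ m B) Z c = dJet m c p := by
  funext α
  rw [ContinuousLinearMap.apply_eq_sum_single]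
  simp only [dJet, hp, jetFull_up hB, Finset.sum_apply, Pi.smul_apply]
  refine Finset.sum_congr rfl fun a _ => ?_
  rw [fderiv_apply (analyticAt_jetFull hB).differentiableAt]
  rfl

theorem fderiv_jetZG {m : ℕ} (hB : AnalyticAt ℂ B Z) (c : Cn (n + (d₁ + d₂)))
    {p : PSp n d₁ d₂ (m + 1)} (hp : p.1.2 = jetFull _ (m + 1) B Z)
    (hp' : p.2.1.1 = jetZG n d₁ d₂ (m + 1) B Z) :
    fderiv ℂ (jetZG n d₁ d₂ m B) Z c = dJetZG m c p := by
  have key : ∀ (ν : MIdx n m) (v : Cn (n + (d₁ + d₂))), fderiv ℂ (jetZG n d₁ d₂ m B) Z v ν =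
      fderiv ℂ (fun W => jetZG n d₁ d₂ m B W ν) Z v := by
    intro ν v
    rw [fderiv_apply (analyticAt_jetZG hB).differentiableAt]
    rfl
  funext ν
  rw [ContinuousLinearMap.apply_eq_sum_single, Fin.sum_univ_add, Pi.add_apply, Finset.sum_apply,
    Finset.sum_apply]
  simp only [dJetZG, hp', jetZG_up hB, Pi.smul_apply, key]
  congr 1
  refine Finset.sum_congr rfl fun j _ => ?_
  refine congrArg _ ?_
  rw [(jetZG_eventuallyEq hB ν).fderiv_eq]
  funext b
  rw [hp, jetFull_up hB]
  have hd := (analyticAt_jetFull_apply hB (ν.ext (d₁ := d₁) (d₂ := d₂))).differentiableAt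
  have hd2 : DifferentiableAt ℂ (fun W j => jetFull _ m B W (ν.ext (d₁ := d₁) (d₂ := d₂))
      (wfIdx n d₁ d₂ j)) Z := by
    rw [differentiableAt_pi]
    intro j
    exact differentiableAt_pi.1 hd _
  have e1 := fderiv_apply (𝕜 := ℂ) hd2 b
  have e2 := fderiv_apply (𝕜 := ℂ) hd (wfIdx n d₁ d₂ b)
  have := e1.symm.trans e2
  exact DFunLike.congr_fun this (Pi.single (Fin.natAdd n j) 1)

theorem fderiv_Fpart {m : ℕ} (hB : AnalyticAt ℂ B Z) (c : Cn (n + (d₁ + d₂)))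
    {p : PSp n d₁ d₂ (m + 1)} (hp : p.1.2 = jetFull _ (m + 1) B Z) :
    fderiv ℂ (Fpart n d₁ d₂ B) Z c = dF m c p := by
  funext i
  have h1 := fderiv_apply (𝕜 := ℂ) hB.Fpart.differentiableAt i
  have h2 := fderiv_apply (𝕜 := ℂ) hB.differentiableAt (zIdx n d₁ d₂ i)
  have h3 : fderiv ℂ (Fpart n d₁ d₂ B) Z c i = fderiv ℂ B Z c (zIdx n d₁ d₂ i) :=
    DFunLike.congr_fun (h1.symm.trans h2) c
  rw [h3, ContinuousLinearMap.apply_eq_sum_single, Finset.sum_apply]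
  refine Finset.sum_congr rfl fun a _ => ?_
  rw [hp, jetFull_up hB]
  simp only [jetFull_zero]
  rfl

variable (ζm : XSp n d₁ d₂ → Cn (n + (d₁ + d₂)))

/-- The derivative of the point `pt` in a direction `v`, without the component of the
reciprocal. -/
def totalDer' (m : ℕ) (v : XSp n d₁ d₂) (p : PSp n d₁ d₂ (m + 1)) : PSp n d₁ d₂ m :=
  ((0, dJet m (fderiv ℂ ζm p.2.2 v) p),
    ((dJetZG m (fderiv ℂ ζm p.2.2 v) p, dF m (fderiv ℂ ζm p.2.2 v) p), v))

/-- The derivative of the point `pt` in a direction `v`. -/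
def totalDer (m : ℕ) (v : XSp n d₁ d₂) (p : PSp n d₁ d₂ (m + 1)) : PSp n d₁ d₂ m :=
  ((-(projP m p).1.1 ^ 2 * fderiv ℂ (fun p' : PSp n d₁ d₂ m => qdet m p'.1.2) (projP m p)
      (totalDer' ζm m v p), dJet m (fderiv ℂ ζm p.2.2 v) p),
    ((dJetZG m (fderiv ℂ ζm p.2.2 v) p, dF m (fderiv ℂ ζm p.2.2 v) p), v))

theorem memRingMap_of_forall {V0 V1 : Type*} [NormedAddCommGroup V0] [NormedSpace ℂ V0]
    [NormedAddCommGroup V1] [NormedSpace ℂ V1] {ι : Type*} [Fintype ι] {f : V0 × V1 → ι → ℂ}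
    (h : ∀ i, MemRing V0 V1 fun x => f x i) : MemRingMap V0 V1 (ι → ℂ) f :=
  memRingMap_pi (F := fun _ => ℂ) fun i => (h i).toMap

variable {ζm} (hζ : AnalyticAt ℂ ζm 0)

include hζ

theorem memRing_coeff (m : ℕ) (v : XSp n d₁ d₂) (a : Fin (n + (d₁ + d₂))) :
    MemRing _ _ fun p : PSp n d₁ d₂ m => fderiv ℂ ζm p.2.2 v a := by
  have h : AnalyticAt ℂ (fun y : VOne n d₁ d₂ m => fderiv ℂ ζm y.2 v a) 0 := by
    have h1 : AnalyticAt ℂ (fun x => fderiv ℂ ζm x v a) 0 :=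
      analyticAt_pi_iff.1 (hζ.fderiv_apply_const v) a
    exact h1.comp (f := fun y : VOne n d₁ d₂ m => y.2) (x := 0) analyticAt_snd
  exact MemRing.of_analyticAt h

theorem memRingMap_dJet (m : ℕ) (v : XSp n d₁ d₂) : MemRingMap _ _ _
    fun p : PSp n d₁ d₂ (m + 1) => dJet m (fderiv ℂ ζm p.2.2 v) p := by
  refine memRingMap_pi fun α => memRingMap_of_forall fun i => ?_
  simp only [dJet, Finset.sum_apply, Pi.smul_apply, smul_eq_mul]
  exact MemRing.sum _ fun a => (memRing_coeff hζ _ v a).mul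
    (memRing_of_isLinearMap ⟨fun _ _ => rfl, fun _ _ => rfl⟩)

theorem memRingMap_dJetZG (m : ℕ) (v : XSp n d₁ d₂) : MemRingMap _ _ _
    fun p : PSp n d₁ d₂ (m + 1) => dJetZG m (fderiv ℂ ζm p.2.2 v) p := by
  refine memRingMap_pi fun α => memRingMap_of_forall fun i => ?_
  simp only [dJetZG, Finset.sum_apply, Pi.smul_apply, Pi.add_apply, smul_eq_mul]
  exact (MemRing.sum _ fun a => (memRing_coeff hζ _ v _).mul
    (memRing_of_isLinearMap ⟨fun _ _ => rfl, fun _ _ => rfl⟩)).add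
    (MemRing.sum _ fun a => (memRing_coeff hζ _ v _).mul
    (memRing_of_isLinearMap ⟨fun _ _ => rfl, fun _ _ => rfl⟩))

theorem memRing_dF (m : ℕ) (v : XSp n d₁ d₂) (i : Fin n) : MemRing _ _
    fun p : PSp n d₁ d₂ (m + 1) => dF m (fderiv ℂ ζm p.2.2 v) p i := by
  simp only [dF]
  exact MemRing.sum _ fun a => (memRing_coeff hζ _ v a).mul
    (memRing_of_isLinearMap ⟨fun _ _ => rfl, fun _ _ => rfl⟩)

theorem memRingMap_totalDer' (m : ℕ) (v : XSp n d₁ d₂) :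
    MemRingMap _ _ _ (totalDer' ζm m v) := by
  refine MemRingMap.prodMk (MemRingMap.prodMk (memRing_const 0).toMap (memRingMap_dJet hζ m v))
    (MemRingMap.prodMk (MemRingMap.prodMk (memRingMap_dJetZG hζ m v)
      (memRingMap_of_forall fun i => memRing_dF hζ m v i)) ?_)
  exact fun φ => memRing_const (φ v)

theorem memRingMap_totalDer (m : ℕ) (v : XSp n d₁ d₂) :
    MemRingMap _ _ _ (totalDer ζm m v) := by
  have hq : MemRing (VZero n d₁ d₂ m) (VOne n d₁ d₂ m) fun p' => qdet m p'.1.2 :=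
    MemRing.of_isPolyFun (p := fun x : VZero n d₁ d₂ m => qdet m x.2)
      ((isPolyFun_qdet m).comp_linear (LinearMap.snd ℂ ℂ _))
  have h1 := MemRingMap.fderiv_apply (memRingMap_totalDer' hζ m v)
    (fun w => (hq.fderiv w).comp (memRingMap_projP m) (projP_zero m))
  have h2 : MemRing _ _ fun p : PSp n d₁ d₂ (m + 1) => (projP m p).1.1 :=
    memRingMap_projP m (LinearMap.fst ℂ ℂ _ ∘ₗ LinearMap.fst ℂ _ _)
  refine MemRingMap.prodMk (MemRingMap.prodMk (MemRing.toMap ?_) (memRingMap_dJet hζ m v))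
    (MemRingMap.prodMk (MemRingMap.prodMk (memRingMap_dJetZG hζ m v)
      (memRingMap_of_forall fun i => memRing_dF hζ m v i)) ?_)
  · refine (((memRing_const (-1)).mul (h2.mul h2)).mul h1).congr
      fun x0 => Eventually.of_forall fun p => ?_
    show -1 * (_ * _) * _ = _
    ring
  · exact fun φ => memRing_const (φ v)

theorem fderiv_pt (hζ0 : ζm 0 = 0) {m : ℕ} (hB : Good (m + 1) B) (v : XSp n d₁ d₂) :
    ∀ᶠ x in 𝓝 0, fderiv ℂ (pt ζm m B) x v = totalDer ζm m v (pt ζm (m + 1) B x) := by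
  have hq : ∀ᶠ x in 𝓝 0, qdet m (jetFull _ m B (ζm x)) ≠ 0 := by
    have h1 : AnalyticAt ℂ (fun x => qdet m (jetFull _ m B (ζm x))) 0 :=
      (analyticAt_qdet m _).comp ((analyticAt_jetFull (by rw [hζ0]; exact hB.1)).comp hζ)
    refine h1.continuousAt.eventually_ne ?_
    rw [hζ0]
    exact hB.of_succ.2.2.2
  filter_upwards [hq, hζ.eventually_analyticAt, eventually_analyticAt_comp hζ hζ0 hB.1]
    with x hq hζ hBx
  have hj : HasFDerivAt (fun x => jetFull _ m B (ζm x)) _ x :=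
    (analyticAt_jetFull hBx).differentiableAt.hasFDerivAt.comp x
      hζ.differentiableAt.hasFDerivAt
  have hZ : HasFDerivAt (fun x => jetZG n d₁ d₂ m B (ζm x)) _ x :=
    (analyticAt_jetZG hBx).differentiableAt.hasFDerivAt.comp x
      hζ.differentiableAt.hasFDerivAt
  have hF : HasFDerivAt (fun x => Fpart n d₁ d₂ B (ζm x)) _ x :=
    hBx.Fpart.differentiableAt.hasFDerivAt.comp x hζ.differentiableAt.hasFDerivAt
  have hθ : HasFDerivAt (fun x => (qdet m (jetFull _ m B (ζm x)))⁻¹) _ x :=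
    (hasFDerivAt_inv hq).comp x ((analyticAt_qdet m _).differentiableAt.hasFDerivAt.comp x hj)
  have hpt := (hθ.prodMk hj).prodMk ((hZ.prodMk hF).prodMk (hasFDerivAt_id x))
  have : pt ζm m B = fun x => (((qdet m (jetFull _ m B (ζm x)))⁻¹, jetFull _ m B (ζm x)),
    ((jetZG n d₁ d₂ m B (ζm x), Fpart n d₁ d₂ B (ζm x)), x)) := by
    funext x; simp only [pt, one_div]
  rw [this]
  refine (congrArg (fun L => L v) hpt.fderiv).trans ?_
  have e1 := fderiv_jetFull hBx (fderiv ℂ ζm x v) (p := pt ζm (m + 1) B x) rfl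
  have e2 := fderiv_jetZG hBx (fderiv ℂ ζm x v) (p := pt ζm (m + 1) B x) rfl rfl
  have e3 := fderiv_Fpart hBx (fderiv ℂ ζm x v) (p := pt ζm (m + 1) B x) rfl
  refine Prod.ext (Prod.ext ?_ e1) (Prod.ext (Prod.ext e2 e3) rfl)
  have e4 : HasFDerivAt (fun p' : PSp n d₁ d₂ m => qdet m p'.1.2)
      ((fderiv ℂ (qdet m) (jetFull _ m B (ζm x))).comp
        ((ContinuousLinearMap.snd ℂ _ _).comp (ContinuousLinearMap.fst ℂ _ _))) (pt ζm m B x) :=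
    (analyticAt_qdet m _).differentiableAt.hasFDerivAt.comp (pt ζm m B x)
      (ContinuousLinearMap.hasFDerivAt (E := PSp n d₁ d₂ m) (x := pt ζm m B x)
        ((ContinuousLinearMap.snd ℂ ℂ _).comp
          (ContinuousLinearMap.fst ℂ (VZero n d₁ d₂ m) (VOne n d₁ d₂ m))))
  simp only [totalDer, projP_pt, e4.fderiv]
  show _ = -(1 / qdet m (jetFull _ m B (ζm x))) ^ 2 *
    fderiv ℂ (qdet m) (jetFull _ m B (ζm x)) (dJet m (fderiv ℂ ζm x v) (pt ζm (m + 1) B x))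
  rw [← e1]
  simp [mul_comm]

end TotalDerivative

section Universal

variable {n d₁ d₂ : ℕ} {ζm : XSp n d₁ d₂ → Cn (n + (d₁ + d₂))}
  {F : Type*} [NormedAddCommGroup F] [NormedSpace ℂ F] [FiniteDimensional ℂ F]
  {G : Type*} [NormedAddCommGroup G] [NormedSpace ℂ G] [FiniteDimensional ℂ G]

variable (n d₁ d₂) in
/-- The points over the origin. -/
def KO (m : ℕ) : Set (PSp n d₁ d₂ m) := {p | p.2 = 0}

variable (n d₁ d₂) in
/-- The locus containing the points of a map over `Z = 0`. -/
def KX (m : ℕ) : Set (PSp n d₁ d₂ m) := {p | p.2.1.1 = 0 ∧ p.2.2.1 = 0}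

variable (n d₁ d₂) in
/-- The locus containing the points of a map over `χ = 0`, `w = 0`, `u = 0`. -/
def KZ (m : ℕ) : Set (PSp n d₁ d₂ m) :=
  {p | p.2.1 = 0 ∧ p.2.2.2 = 0 ∧ wfPart n d₁ d₂ p.2.2.1 = 0}

theorem KO_subset_KX (m : ℕ) : KO n d₁ d₂ m ⊆ KX n d₁ d₂ m := fun p (hp : p.2 = 0) => by
  simp [KX, hp]

theorem KO_subset_KZ (m : ℕ) : KO n d₁ d₂ m ⊆ KZ n d₁ d₂ m := fun p (hp : p.2 = 0) => by
  simp only [KZ, hp, Set.mem_ofPred_eq]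
  exact ⟨rfl, rfl, rfl⟩

theorem projP_mem_KO {m : ℕ} {p : PSp n d₁ d₂ (m + 1)} (hp : p ∈ KO n d₁ d₂ (m + 1)) :
    projP m p ∈ KO n d₁ d₂ m := by
  have hp : p.2 = 0 := hp
  show (projP m p).2 = 0
  rw [projP_snd, hp]; rfl

theorem projP_mem_KX {m : ℕ} {p : PSp n d₁ d₂ (m + 1)} (hp : p ∈ KX n d₁ d₂ (m + 1)) :
    projP m p ∈ KX n d₁ d₂ m := by
  obtain ⟨h1, h2⟩ : p.2.1.1 = 0 ∧ p.2.2.1 = 0 := hp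
  show (projP m p).2.1.1 = 0 ∧ (projP m p).2.2.1 = 0
  rw [projP_snd]
  simp only [h1, h2]
  exact ⟨rfl, trivial⟩

theorem projP_mem_KZ {m : ℕ} {p : PSp n d₁ d₂ (m + 1)} (hp : p ∈ KZ n d₁ d₂ (m + 1)) :
    projP m p ∈ KZ n d₁ d₂ m := by
  obtain ⟨h1, h2, h3⟩ : p.2.1 = 0 ∧ p.2.2.2 = 0 ∧ wfPart n d₁ d₂ p.2.2.1 = 0 := hp
  show (projP m p).2.1 = 0 ∧ (projP m p).2.2.2 = 0 ∧ wfPart n d₁ d₂ (projP m p).2.2.1 = 0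
  rw [projP_snd]
  simp only [h1, h2, h3]
  exact ⟨rfl, trivial, trivial⟩

/-- The map `u B` is, for all `B` that are `Good` to order `m`, given by one and the same function
of the `m`-jets of `B`, whose components are in the ring, and which vanishes on `K`. -/
def Ex (ζm : XSp n d₁ d₂ → Cn (n + (d₁ + d₂))) (m : ℕ) (K : Set (PSp n d₁ d₂ m))
    (u : (Cn (n + (d₁ + d₂)) → Cn (n + (d₁ + d₂))) → XSp n d₁ d₂ → F) : Prop :=
  ∃ Ψ : PSp n d₁ d₂ m → F, MemRingMap _ _ _ Ψ ∧
    (∀ x0 : VZero n d₁ d₂ m, ∀ᶠ p in 𝓝 (x0, 0), p ∈ K → Ψ p = 0) ∧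
    ∀ B, Good m B → ∀ᶠ x in 𝓝 0, u B x = Ψ (pt ζm m B x)

variable {m : ℕ} {K K' : Set (PSp n d₁ d₂ m)}
  {u : (Cn (n + (d₁ + d₂)) → Cn (n + (d₁ + d₂))) → XSp n d₁ d₂ → F}
  {u' : (Cn (n + (d₁ + d₂)) → Cn (n + (d₁ + d₂))) → XSp n d₁ d₂ → G}

omit [FiniteDimensional ℂ F] in
theorem Ex.mono (h : Ex ζm m K u) (hK : K' ⊆ K) : Ex ζm m K' u := by
  obtain ⟨Ψ, h1, h2, h3⟩ := h
  exact ⟨Ψ, h1, fun x0 => (h2 x0).mono fun p hp hpK => hp (hK hpK), h3⟩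

omit [FiniteDimensional ℂ F] in
theorem Ex.congr {v : (Cn (n + (d₁ + d₂)) → Cn (n + (d₁ + d₂))) → XSp n d₁ d₂ → F}
    (h : Ex ζm m K u) (huv : ∀ B, Good m B → ∀ᶠ x in 𝓝 0, v B x = u B x) : Ex ζm m K v := by
  obtain ⟨Ψ, h1, h2, h3⟩ := h
  refine ⟨Ψ, h1, h2, fun B hB => ?_⟩
  filter_upwards [h3 B hB, huv B hB] with x h1 h2
  rw [h2, h1]

omit [FiniteDimensional ℂ F] [FiniteDimensional ℂ G] in
theorem Ex.linear (h : Ex ζm m K u) (L : F →ₗ[ℂ] G) : Ex ζm m K fun B x => L (u B x) := by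
  obtain ⟨Ψ, h1, h2, h3⟩ := h
  exact ⟨fun p => L (Ψ p), h1.linear_comp L,
    fun x0 => (h2 x0).mono fun p hp hpK => (congrArg L (hp hpK)).trans (map_zero L),
    fun B hB => (h3 B hB).mono fun x hx => congrArg L hx⟩

omit [FiniteDimensional ℂ F] [FiniteDimensional ℂ G] in
theorem Ex.prodMk (h : Ex ζm m K u) (h' : Ex ζm m K u') :
    Ex ζm m K fun B x => (u B x, u' B x) := by
  obtain ⟨Ψ, h1, h2, h3⟩ := h
  obtain ⟨Ψ', h1', h2', h3'⟩ := h'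
  refine ⟨fun p => (Ψ p, Ψ' p), h1.prodMk h1', fun x0 => ?_, fun B hB => ?_⟩
  · filter_upwards [h2 x0, h2' x0] with p hp hp' hpK
    rw [hp hpK, hp' hpK]; rfl
  · filter_upwards [h3 B hB, h3' B hB] with p hp hp'
    rw [hp, hp']

theorem ex_pi {ι : Type*} [Fintype ι] {F : ι → Type*} [∀ i, NormedAddCommGroup (F i)]
    [∀ i, NormedSpace ℂ (F i)]
    {u : (Cn (n + (d₁ + d₂)) → Cn (n + (d₁ + d₂))) → XSp n d₁ d₂ → ∀ i, F i}
    (h : ∀ i, Ex ζm m K fun B x => u B x i) : Ex ζm m K u := by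
  choose Ψ h1 h2 h3 using h
  refine ⟨fun p i => Ψ i p, memRingMap_pi h1, fun x0 => ?_, fun B hB => ?_⟩
  · filter_upwards [eventually_all.2 fun i => h2 i x0] with p hp hpK
    funext i
    exact hp i hpK
  · filter_upwards [eventually_all.2 fun i => h3 i B hB] with x hx
    funext i
    exact hx i

theorem Ex.mul {u v : (Cn (n + (d₁ + d₂)) → Cn (n + (d₁ + d₂))) → XSp n d₁ d₂ → ℂ}
    (hu : Ex ζm m K u) (hv : Ex ζm m K' v) : Ex ζm m (K ∪ K') fun B x => u B x * v B x := by
  obtain ⟨Ψ, h1, h2, h3⟩ := hu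
  obtain ⟨Ψ', h1', h2', h3'⟩ := hv
  refine ⟨fun p => Ψ p * Ψ' p, ((h1 LinearMap.id).mul (h1' LinearMap.id)).toMap,
    fun x0 => ?_, fun B hB => ?_⟩
  · filter_upwards [h2 x0, h2' x0] with p hp hp' hpK
    rcases hpK with hpK | hpK
    · rw [hp hpK, zero_mul]
    · rw [hp' hpK, mul_zero]
  · filter_upwards [h3 B hB, h3' B hB] with p hp hp'
    rw [hp, hp']

theorem ex_sum {ι : Type*} (s : Finset ι)
    {u : ι → (Cn (n + (d₁ + d₂)) → Cn (n + (d₁ + d₂))) → XSp n d₁ d₂ → ℂ}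
    (h : ∀ i, Ex ζm m K (u i)) : Ex ζm m K fun B x => ∑ i ∈ s, u i B x := by
  choose Ψ h1 h2 h3 using h
  refine ⟨fun p => ∑ i ∈ s, Ψ i p, (MemRing.sum s fun i => h1 i LinearMap.id).toMap,
    fun x0 => ?_, fun B hB => ?_⟩
  · have : ∀ᶠ p in 𝓝 (x0, 0), ∀ i ∈ s, p ∈ K → Ψ i p = 0 :=
      (eventually_all_finset s).2 fun i _ => h2 i x0
    filter_upwards [this] with p hp hpK
    exact Finset.sum_eq_zero fun i hi => hp i hi hpK
  · have : ∀ᶠ x in 𝓝 0, ∀ i ∈ s, u i B x = Ψ i (pt ζm m B x) :=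
      (eventually_all_finset s).2 fun i _ => h3 i B hB
    filter_upwards [this] with x hx
    exact Finset.sum_congr rfl hx

omit [FiniteDimensional ℂ F] in
theorem ex_of_memRingMap {Ψ : PSp n d₁ d₂ m → F} (h : MemRingMap _ _ _ Ψ)
    (hK : ∀ p ∈ K, Ψ p = 0) : Ex ζm m K fun B x => Ψ (pt ζm m B x) :=
  ⟨Ψ, h, fun _ => Eventually.of_forall hK, fun _ _ => Eventually.of_forall fun _ => rfl⟩

theorem tendsto_projP (m : ℕ) (x0 : VZero n d₁ d₂ (m + 1)) :
    Tendsto (projP m) (𝓝 (x0, 0)) (𝓝 ((projP m (x0, 0)).1, 0)) := by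
  have := ((memRingMap_projP m).analyticAt x0).continuousAt
  rw [ContinuousAt, ← Prod.mk.eta (p := projP m (x0, 0)), projP_zero] at this
  exact this

omit [FiniteDimensional ℂ F] in
theorem Ex.lift (h : Ex ζm m K u) {K' : Set (PSp n d₁ d₂ (m + 1))}
    (hK : ∀ p ∈ K', projP m p ∈ K) : Ex ζm (m + 1) K' u := by
  obtain ⟨Ψ, h1, h2, h3⟩ := h
  refine ⟨fun p => Ψ (projP m p), h1.comp (memRingMap_projP m) (projP_zero m), fun x0 => ?_,
    fun B hB => ?_⟩
  · filter_upwards [(tendsto_projP m x0).eventually (h2 _)] with p hp hpK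
    exact hp (hK p hpK)
  · simpa only [projP_pt] using h3 B hB.of_succ

theorem MemRingMap.fderiv_comp {V0 V1 W0 W1 F : Type*} [NormedAddCommGroup V0] [NormedSpace ℂ V0]
    [NormedAddCommGroup V1] [NormedSpace ℂ V1] [NormedAddCommGroup W0] [NormedSpace ℂ W0]
    [NormedAddCommGroup W1] [NormedSpace ℂ W1]
    [NormedAddCommGroup F] [NormedSpace ℂ F] [FiniteDimensional ℂ F]
    [FiniteDimensional ℂ V0] [FiniteDimensional ℂ V1]
    [FiniteDimensional ℂ W0] [FiniteDimensional ℂ W1] {Ψ : V0 × V1 → F}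
    (hΨ : MemRingMap V0 V1 F Ψ) {g h : W0 × W1 → V0 × V1}
    (hg : MemRingMap W0 W1 _ g) (hg0 : ∀ x0, (g (x0, 0)).2 = 0) (hh : MemRingMap W0 W1 _ h) :
    MemRingMap W0 W1 F fun x => fderiv ℂ Ψ (g x) (h x) := by
  intro φ
  refine (MemRingMap.fderiv_apply hh fun v => ((hΨ φ).fderiv v).comp hg hg0).congr fun x0 => ?_
  have h1 : AnalyticAt ℂ Ψ (g (x0, 0)) := by
    rw [← Prod.mk.eta (p := g (x0, 0)), hg0]
    exact hΨ.analyticAt _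
  filter_upwards [(hg.analyticAt x0).continuousAt.eventually h1.eventually_analyticAt] with x hx
  have := ((LinearMap.toContinuousLinearMap φ).hasFDerivAt.comp (g x)
    hx.differentiableAt.hasFDerivAt).fderiv
  exact congrArg (fun L => L (h x)) this

theorem Ex.deriv (hζ : AnalyticAt ℂ ζm 0) (hζ0 : ζm 0 = 0) (h : Ex ζm m K u)
    (hK : ∀ p ∈ K, ∀ w ∈ K, ∀ t : ℂ, p + t • w ∈ K)
    {K' : Set (PSp n d₁ d₂ (m + 1))} (hKp : ∀ p ∈ K', projP m p ∈ K) (v : XSp n d₁ d₂)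
    (hv : ∀ x0 : VZero n d₁ d₂ (m + 1), ∀ᶠ p in 𝓝 (x0, 0), p ∈ K' → totalDer ζm m v p ∈ K) :
    Ex ζm (m + 1) K' fun B x => fderiv ℂ (u B) x v := by
  obtain ⟨Ψ, h1, h2, h3⟩ := h
  refine ⟨fun p => fderiv ℂ Ψ (projP m p) (totalDer ζm m v p),
    h1.fderiv_comp (memRingMap_projP m) (projP_zero m) (memRingMap_totalDer hζ m v), fun x0 => ?_,
    fun B hB => ?_⟩
  · filter_upwards [hv x0, (tendsto_projP m x0).eventually (h2 _).eventually_nhds,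
      (tendsto_projP m x0).eventually (h1.analyticAt _).eventually_analyticAt] with p hp hp2 hpa hpK
    set w := totalDer ζm m v p
    have hl : HasDerivAt (fun t : ℂ => projP m p + t • w) w 0 := by
      simpa using ((hasDerivAt_id (0 : ℂ)).smul_const w).const_add (projP m p)
    have hd : HasDerivAt (fun t : ℂ => Ψ (projP m p + t • w)) (fderiv ℂ Ψ (projP m p) w) 0 := by
      have : HasFDerivAt Ψ (fderiv ℂ Ψ (projP m p)) (projP m p + (0 : ℂ) • w) := by
        simpa using hpa.differentiableAt.hasFDerivAt
      exact this.comp_hasDerivAt (0 : ℂ) hl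
    have hz : (fun t : ℂ => Ψ (projP m p + t • w)) =ᶠ[𝓝 0] fun _ => 0 := by
      have ht : Tendsto (fun t : ℂ => projP m p + t • w) (𝓝 0) (𝓝 (projP m p)) := by
        simpa using hl.continuousAt.tendsto
      filter_upwards [ht.eventually hp2] with t ht
      exact ht (hK _ (hKp p hpK) _ (hp hpK) t)
    exact hd.unique ((hasDerivAt_const (0 : ℂ) (0 : F)).congr_of_eventuallyEq hz)
  · have hB' := hB.of_succ
    filter_upwards [(h3 B hB').eventually_nhds, fderiv_pt hζ hζ0 hB v,
      (analyticAt_pt hζ hζ0 hB').eventually_analyticAt,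
      (tendsto_pt hζ hζ0 hB').eventually (h1.analyticAt _).eventually_analyticAt]
      with x hx hpt hpa hΨa
    rw [EventuallyEq.fderiv_eq hx, projP_pt, ← hpt]
    exact congrArg (fun L => L v)
      (hΨa.differentiableAt.hasFDerivAt.comp x hpa.differentiableAt.hasFDerivAt).fderiv

/-- Composition of `u` and `u'` with an analytic germ vanishing with its second argument. -/
theorem Ex.comp_analyticAt {E : Type*} [NormedAddCommGroup E] [NormedSpace ℂ E]
    [FiniteDimensional ℂ E] (hK : KO n d₁ d₂ m ⊆ K) (hu : Ex ζm m (KO n d₁ d₂ m) u)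
    (hu' : Ex ζm m K u') {Φ : F × G → E} (hΦ : AnalyticAt ℂ Φ 0)
    (hΦ0 : ∀ᶠ y in 𝓝 (0 : F), Φ (y, 0) = 0) : Ex ζm m K fun B x => Φ (u B x, u' B x) := by
  obtain ⟨Ψ, h1, h2, h3⟩ := hu
  obtain ⟨Ψ', h1', h2', h3'⟩ := hu'
  have hz : ∀ x0 : VZero n d₁ d₂ m, Ψ (x0, 0) = 0 := fun x0 => (h2 x0).self_of_nhds rfl
  refine ⟨fun p => Φ (Ψ p, Ψ' p), fun φ => ?_, fun x0 => ?_, fun B hB => ?_⟩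
  · have hφ : AnalyticAt ℂ (fun y => φ (Φ y)) 0 :=
      ((LinearMap.toContinuousLinearMap φ).analyticAt _).comp hΦ
    exact MemRing.comp_analyticAt hφ (h1.prodMk h1') fun x0 =>
      Prod.ext (hz x0) ((h2' x0).self_of_nhds (hK rfl))
  · have ht : Tendsto Ψ (𝓝 (x0, 0)) (𝓝 0) := by
      have := (h1.analyticAt x0).continuousAt.tendsto
      rwa [hz] at this
    filter_upwards [ht.eventually hΦ0, h2' x0] with p hp hp' hpK
    rw [hp' hpK, hp]
  · filter_upwards [h3 B hB, h3' B hB] with x hx hx'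
    rw [hx, hx']

theorem Ex.comp_analyticAt' {E : Type*} [NormedAddCommGroup E] [NormedSpace ℂ E]
    [FiniteDimensional ℂ E] (hK : KO n d₁ d₂ m ⊆ K)
    (hu : Ex ζm m K u) {Φ : F → E} (hΦ : AnalyticAt ℂ Φ 0)
    (hΦ0 : Φ 0 = 0) : Ex ζm m K fun B x => Φ (u B x) := by
  have h0 : Ex ζm m (KO n d₁ d₂ m) fun _ _ => (0 : ℂ) :=
    ex_of_memRingMap (Ψ := fun _ => (0 : ℂ)) (memRing_const 0).toMap fun _ _ => rfl
  exact Ex.comp_analyticAt (Φ := fun y : ℂ × F => Φ y.2) hK h0 hu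
    (AnalyticAt.comp (g := Φ) (f := Prod.snd) (x := (0 : ℂ × F)) hΦ analyticAt_snd)
    (Eventually.of_forall fun _ => hΦ0)

end Universal

section Tangency

variable {n d₁ d₂ : ℕ}

/-- The map `ζm` parametrizes the second factor of the complexification, in coordinates that
are normal. -/
structure ZetaGood (ζm : XSp n d₁ d₂ → Cn (n + (d₁ + d₂))) : Prop where
  analyticAt : AnalyticAt ℂ ζm 0
  left : ∀ᶠ χ in 𝓝 (0 : Cn n), ζm (0, χ) = Fin.append χ 0
  right : ∀ᶠ Z in 𝓝 (0 : Cn (n + (d₁ + d₂))), ζm (Z, 0) = Fin.append 0 (wfPart n d₁ d₂ Z)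

variable {ζm : XSp n d₁ d₂ → Cn (n + (d₁ + d₂))}

theorem ZetaGood.zero (h : ZetaGood ζm) : ζm 0 = 0 := by
  have := h.left.self_of_nhds
  rw [show (0 : XSp n d₁ d₂) = (0, 0) from rfl, this]
  funext i
  refine Fin.addCases (fun i => ?_) (fun i => ?_) i <;> simp

theorem fderiv_apply_eq_of_line {E F : Type*} [NormedAddCommGroup E] [NormedSpace ℂ E]
    [NormedAddCommGroup F] [NormedSpace ℂ F] {f : E → F} {x v : E} {c : F}
    (hf : DifferentiableAt ℂ f x) (h : ∀ᶠ t in 𝓝 (0 : ℂ), f (x + t • v) = f x + t • c) :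
    fderiv ℂ f x v = c := by
  have hl : HasDerivAt (fun t : ℂ => x + t • v) v 0 := by
    simpa using ((hasDerivAt_id (0 : ℂ)).smul_const v).const_add x
  have hd : HasDerivAt (fun t : ℂ => f (x + t • v)) (fderiv ℂ f x v) 0 := by
    have : HasFDerivAt f (fderiv ℂ f x) (x + (0 : ℂ) • v) := by
      simpa using hf.hasFDerivAt
    exact this.comp_hasDerivAt (0 : ℂ) hl
  have hc : HasDerivAt (fun t : ℂ => f x + t • c) c 0 := by
    simpa using ((hasDerivAt_id (0 : ℂ)).smul_const c).const_add (f x)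
  exact hd.unique (hc.congr_of_eventuallyEq h)

theorem ZetaGood.fderiv_left (h : ZetaGood ζm) (j : Fin n) :
    ∀ᶠ χ in 𝓝 (0 : Cn n), fderiv ℂ ζm (0, χ) (0, Pi.single j 1) = Pi.single (zIdx n d₁ d₂ j) 1 := by
  have ht : Tendsto (fun χ : Cn n => ((0, χ) : XSp n d₁ d₂)) (𝓝 0) (𝓝 0) :=
    (continuous_const.prodMk continuous_id).tendsto' _ _ rfl
  filter_upwards [h.left.eventually_nhds, ht.eventually h.analyticAt.eventually_analyticAt]
    with χ hχ hχa
  refine fderiv_apply_eq_of_line hχa.differentiableAt ?_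
  have ht' : Tendsto (fun t : ℂ => χ + t • Pi.single j 1) (𝓝 0) (𝓝 χ) :=
    (by fun_prop : Continuous fun t : ℂ => χ + t • (Pi.single j 1 : Cn n)).tendsto' _ _ (by simp)
  filter_upwards [ht'.eventually hχ] with t ht
  simp only [Prod.mk_add_mk, Prod.smul_mk, smul_zero, add_zero]
  rw [ht, hχ.self_of_nhds]
  funext i
  refine Fin.addCases (fun i => ?_) (fun i => ?_) i
  · simp [zIdx, Pi.single_apply, Fin.ext_iff]
  · have : Fin.natAdd n i ≠ Fin.castAdd (d₁ + d₂) j := by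
      simp only [ne_eq, Fin.ext_iff, Fin.val_natAdd, Fin.val_castAdd]; omega
    simp [zIdx, this]

theorem ZetaGood.fderiv_right (h : ZetaGood ζm) (i : Fin n) :
    ∀ᶠ Z in 𝓝 (0 : Cn (n + (d₁ + d₂))),
      fderiv ℂ ζm (Z, 0) (Pi.single (zIdx n d₁ d₂ i) 1, 0) = 0 := by
  have ht : Tendsto (fun Z : Cn (n + (d₁ + d₂)) => ((Z, 0) : XSp n d₁ d₂)) (𝓝 0) (𝓝 0) :=
    (continuous_id.prodMk continuous_const).tendsto' _ _ rfl
  filter_upwards [h.right.eventually_nhds, ht.eventually h.analyticAt.eventually_analyticAt]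
    with Z hZ hZa
  refine fderiv_apply_eq_of_line hZa.differentiableAt ?_
  have ht' : Tendsto (fun t : ℂ => Z + t • Pi.single (zIdx n d₁ d₂ i) 1) (𝓝 0) (𝓝 Z) :=
    (by fun_prop : Continuous fun t : ℂ =>
      Z + t • (Pi.single (zIdx n d₁ d₂ i) 1 : Cn (n + (d₁ + d₂)))).tendsto' _ _ (by simp)
  filter_upwards [ht'.eventually hZ] with t ht
  simp only [Prod.mk_add_mk, Prod.smul_mk, smul_zero, add_zero]
  rw [ht, hZ.self_of_nhds]
  congr 1
  funext j
  have : wfIdx n d₁ d₂ j ≠ zIdx n d₁ d₂ i := by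
    simp only [ne_eq, wfIdx, zIdx, Fin.ext_iff, Fin.val_natAdd, Fin.val_castAdd]; omega
  simp [wfPart, this]

variable {F : Type*} [NormedAddCommGroup F] [NormedSpace ℂ F] [FiniteDimensional ℂ F] {m : ℕ}
  {u : (Cn (n + (d₁ + d₂)) → Cn (n + (d₁ + d₂))) → XSp n d₁ d₂ → F}

theorem wfIdx_ne_zIdx (j : Fin (d₁ + d₂)) (i : Fin n) : wfIdx n d₁ d₂ j ≠ zIdx n d₁ d₂ i := by
  simp only [ne_eq, wfIdx, zIdx, Fin.ext_iff, Fin.val_natAdd, Fin.val_castAdd]; omega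

theorem zIdx_injective : Function.Injective (zIdx n d₁ d₂) := Fin.castAdd_injective _ _

theorem Ex.deriv_left (hζ : ZetaGood ζm) (h : Ex ζm m (KX n d₁ d₂ m) u) (j : Fin n) :
    Ex ζm (m + 1) (KX n d₁ d₂ (m + 1)) fun B x => fderiv ℂ (u B) x (0, Pi.single j 1) := by
  refine h.deriv hζ.analyticAt hζ.zero ?_ (fun p => projP_mem_KX) _ fun x0 => ?_
  · rintro p ⟨hp1, hp2⟩ w ⟨hw1, hw2⟩ t
    exact ⟨by simp [hp1, hw1], by simp [hp2, hw2]⟩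
  · have ht : Tendsto (fun p : PSp n d₁ d₂ (m + 1) => p.2.2.2) (𝓝 (x0, 0)) (𝓝 0) :=
      (by fun_prop : Continuous fun p : PSp n d₁ d₂ (m + 1) => p.2.2.2).tendsto' _ _ rfl
    filter_upwards [ht.eventually (hζ.fderiv_left j)] with p hp
    rintro ⟨h1, h2⟩
    refine ⟨?_, rfl⟩
    show dJetZG m (fderiv ℂ ζm p.2.2 (0, Pi.single j 1)) p = 0
    rw [← Prod.mk.eta (p := p.2.2), h2, hp]
    funext ν
    simp only [dJetZG, h1, Pi.zero_apply, smul_zero, Finset.sum_const_zero, zero_add]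
    exact Finset.sum_eq_zero fun b _ => by
      rw [Pi.single_apply, if_neg (wfIdx_ne_zIdx _ _), zero_smul]

theorem Ex.deriv_right (hζ : ZetaGood ζm) (h : Ex ζm m (KZ n d₁ d₂ m) u) (i : Fin n) :
    Ex ζm (m + 1) (KZ n d₁ d₂ (m + 1)) fun B x =>
      fderiv ℂ (u B) x (Pi.single (zIdx n d₁ d₂ i) 1, 0) := by
  have hs : wfPart n d₁ d₂ (Pi.single (zIdx n d₁ d₂ i) 1) = 0 := by
    funext j
    simp [wfPart, wfIdx_ne_zIdx]
  refine h.deriv hζ.analyticAt hζ.zero ?_ (fun p => projP_mem_KZ) _ fun x0 => ?_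
  · rintro p ⟨hp1, hp2, hp3⟩ w ⟨hw1, hw2, hw3⟩ t
    refine ⟨by simp [hp1, hw1], by simp [hp2, hw2], ?_⟩
    have : wfPart n d₁ d₂ (p + t • w).2.2.1 =
      wfPart n d₁ d₂ p.2.2.1 + t • wfPart n d₁ d₂ w.2.2.1 := rfl
    rw [this, hp3, hw3, smul_zero, add_zero]
  · have ht : Tendsto (fun p : PSp n d₁ d₂ (m + 1) => p.2.2.1) (𝓝 (x0, 0)) (𝓝 0) :=
      (by fun_prop : Continuous fun p : PSp n d₁ d₂ (m + 1) => p.2.2.1).tendsto' _ _ rfl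
    filter_upwards [ht.eventually (hζ.fderiv_right i)] with p hp
    rintro ⟨-, h2, -⟩
    refine ⟨?_, rfl, hs⟩
    show (dJetZG m (fderiv ℂ ζm p.2.2 (Pi.single (zIdx n d₁ d₂ i) 1, 0)) p,
      dF m (fderiv ℂ ζm p.2.2 (Pi.single (zIdx n d₁ d₂ i) 1, 0)) p) = 0
    rw [← Prod.mk.eta (p := p.2.2), h2, hp]
    refine Prod.ext ?_ ?_
    · funext ν
      simp [dJetZG]
    · funext i
      simp [dF]

theorem Ex.deriv_any (hζ : ZetaGood ζm) (h : Ex ζm m ∅ u) (v : XSp n d₁ d₂) :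
    Ex ζm (m + 1) ∅ fun B x => fderiv ℂ (u B) x v :=
  h.deriv hζ.analyticAt hζ.zero (fun _ hp => hp.elim) (fun _ hp => hp.elim) v
    fun _ => Eventually.of_forall fun _ hp => hp.elim

end Tangency

section LeftInverse

variable {E F : Type*} [NormedAddCommGroup E] [NormedSpace ℂ E] [NormedAddCommGroup F]
  [NormedSpace ℂ F]

/-- An analytic immersion between finite-dimensional spaces has an analytic left inverse. -/
theorem exists_analytic_leftInverse [FiniteDimensional ℂ E] [FiniteDimensional ℂ F] {f : E → F}
    (hf : AnalyticAt ℂ f 0) (h0 : f 0 = 0) (hi : ∀ v, fderiv ℂ f 0 v = 0 → v = 0) :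
    ∃ Φ : F → E, AnalyticAt ℂ Φ 0 ∧ ∀ᶠ x in 𝓝 0, Φ (f x) = x := by
  have : CompleteSpace E := FiniteDimensional.complete ℂ E
  obtain ⟨g, hg⟩ := (fderiv ℂ f 0).toLinearMap.exists_leftInverse_of_injective
    (LinearMap.ker_eq_bot'.2 hi)
  let g' : F →L[ℂ] E := LinearMap.toContinuousLinearMap g
  have hgf : AnalyticAt ℂ (fun x => g' (f x)) 0 := (g'.analyticAt _).comp hf
  have hd : fderiv ℂ (fun x => g' (f x)) 0 = (ContinuousLinearEquiv.refl ℂ E : E →L[ℂ] E) := by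
    have h1 := (g'.hasFDerivAt.comp (0 : E) hf.differentiableAt.hasFDerivAt).fderiv
    refine h1.trans ?_
    ext x
    exact LinearMap.congr_fun hg x
  have hs : HasStrictFDerivAt (fun x => g' (f x))
      (ContinuousLinearEquiv.refl ℂ E : E →L[ℂ] E) 0 := by
    rw [← hd]; exact hgf.hasStrictFDerivAt
  let e := hs.toOpenPartialHomeomorph (fun x => g' (f x))
  have he : (0 : E) ∈ e.source := hs.mem_toOpenPartialHomeomorph_source
  have h2 : AnalyticAt ℂ e.symm (e 0) := e.analyticAt_symm' he hgf hd
  have he0 : e 0 = 0 := by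
    show g' (f 0) = 0
    rw [h0, map_zero]
  rw [he0] at h2
  refine ⟨fun y => e.symm (g' y), ?_, ?_⟩
  · refine AnalyticAt.comp (g := e.symm) ?_ (g'.analyticAt 0)
    rwa [map_zero]
  · filter_upwards [e.open_source.mem_nhds he] with x hx
    exact e.left_inv hx

theorem AnalyticAt.isBigO_comp_sub {f : E → F} {x0 : E} (hf : AnalyticAt ℂ f x0) {α : Type*}
    {l : Filter α} {a b : α → E} (ha : Tendsto a l (𝓝 x0)) (hb : Tendsto b l (𝓝 x0)) :
    (fun t => f (a t) - f (b t)) =O[l] fun t => a t - b t :=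
  hf.hasStrictFDerivAt.isBigO_sub.comp_tendsto (ha.prodMk_nhds hb)

end LeftInverse

section Fiberwise

variable {n d₁ d₂ : ℕ} {ζm : XSp n d₁ d₂ → Cn (n + (d₁ + d₂))}
  {F : Type*} [NormedAddCommGroup F] [NormedSpace ℂ F] [FiniteDimensional ℂ F] {m m' : ℕ}
  {u : (Cn (n + (d₁ + d₂)) → Cn (n + (d₁ + d₂))) → XSp n d₁ d₂ → F}

theorem Ex.analyticAt (hζ : ZetaGood ζm) {K : Set (PSp n d₁ d₂ m)} (h : Ex ζm m K u)
    {B : Cn (n + (d₁ + d₂)) → Cn (n + (d₁ + d₂))} (hB : Good m B) : AnalyticAt ℂ (u B) 0 := by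
  obtain ⟨Ψ, h1, -, h3⟩ := h
  refine AnalyticAt.congr ?_ ((h3 B hB).mono fun _ => Eq.symm)
  refine AnalyticAt.comp ?_ (analyticAt_pt hζ.analyticAt hζ.zero hB)
  rw [pt_zero hζ.zero hB]
  exact h1.analyticAt _

omit [FiniteDimensional ℂ F] in
theorem Ex.lift_le {K : ∀ m, Set (PSp n d₁ d₂ m)}
    (hK : ∀ m, ∀ p ∈ K (m + 1), projP m p ∈ K m) (h : Ex ζm m (K m) u) (hm : m ≤ m') :
    Ex ζm m' (K m') u := by
  induction hm with
  | refl => exact h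
  | step _ ih => exact ih.lift (hK _)

omit [FiniteDimensional ℂ F] in
theorem Ex.lift_empty (h : Ex ζm m ∅ u) (hm : m ≤ m') : Ex ζm m' ∅ u :=
  h.lift_le (K := fun _ => ∅) (fun _ _ hp => hp.elim) hm

theorem Good.of_le {B : Cn (n + (d₁ + d₂)) → Cn (n + (d₁ + d₂))} (h : Good m' B) (hm : m ≤ m') :
    Good m B := by
  induction hm with
  | refl => exact h
  | step _ ih => exact ih h.of_succ

/-- The matrix of the derivatives of `F ∘ ζm` along the fibres. -/
def Mmat (ζm : XSp n d₁ d₂ → Cn (n + (d₁ + d₂)))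
    (B : Cn (n + (d₁ + d₂)) → Cn (n + (d₁ + d₂))) (x : XSp n d₁ d₂) : Matrix (Fin n) (Fin n) ℂ :=
  Matrix.of fun j i => fderiv ℂ (fun y => Fpart n d₁ d₂ B (ζm y)) x (0, Pi.single j 1) i

/-- The matrix `Mmat` as a function of the jets. -/
def Mjet (ζm : XSp n d₁ d₂ → Cn (n + (d₁ + d₂))) (p : PSp n d₁ d₂ 1) :
    Matrix (Fin n) (Fin n) ℂ :=
  Matrix.of fun j i => dF 0 (fderiv ℂ ζm p.2.2 (0, Pi.single j 1)) p i

theorem Mjet_det_zero (hζ : ZetaGood ζm) (x0 : VZero n d₁ d₂ 1) :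
    (Mjet ζm (x0, 0)).det = qdet 1 x0.2 := by
  rw [qdet, ← Matrix.det_transpose]
  congr 1
  ext i j
  have := (hζ.fderiv_left j).self_of_nhds
  rw [show (((0 : Cn (n + (d₁ + d₂))), (0 : Cn n)) : XSp n d₁ d₂) = 0 from rfl] at this
  simp only [Matrix.transpose_apply, Mjet, Matrix.of_apply, dF]
  show ∑ a, fderiv ℂ ζm 0 (0, Pi.single j 1) a * _ = _
  rw [this, Finset.sum_eq_single (zIdx n d₁ d₂ j)]
  · simp
  · intro b _ hb
    simp [hb]
  · simp

theorem Mmat_eq (hζ : ZetaGood ζm) {B : Cn (n + (d₁ + d₂)) → Cn (n + (d₁ + d₂))}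
    (hB : AnalyticAt ℂ B 0) : ∀ᶠ x in 𝓝 0, Mmat ζm B x = Mjet ζm (pt ζm 1 B x) := by
  filter_upwards [eventually_analyticAt_comp hζ.analyticAt hζ.zero hB,
    hζ.analyticAt.eventually_analyticAt] with x hx hζx
  ext j i
  have h1 : HasFDerivAt (fun y => Fpart n d₁ d₂ B (ζm y))
      ((fderiv ℂ (Fpart n d₁ d₂ B) (ζm x)).comp (fderiv ℂ ζm x)) x :=
    hx.Fpart.differentiableAt.hasFDerivAt.comp x hζx.differentiableAt.hasFDerivAt
  simp only [Mmat, Mjet, Matrix.of_apply, h1.fderiv]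
  rw [ContinuousLinearMap.comp_apply, fderiv_Fpart (m := 0) hx _ (p := pt ζm 1 B x) rfl]
  rfl

theorem Mmat_det_ne_zero (hζ : ZetaGood ζm) {B : Cn (n + (d₁ + d₂)) → Cn (n + (d₁ + d₂))}
    (hB : Good 1 B) : ∀ᶠ x in 𝓝 0, (Mmat ζm B x).det ≠ 0 := by
  have hM : ∀ j i, AnalyticAt ℂ (fun x => Mmat ζm B x j i) 0 := by
    intro j i
    have h1 : AnalyticAt ℂ (fun y => Fpart n d₁ d₂ B (ζm y)) 0 := by
      refine AnalyticAt.comp (g := Fpart n d₁ d₂ B) (f := ζm) ?_ hζ.analyticAt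
      rw [hζ.zero]
      exact hB.1.Fpart
    have h2 := h1.fderiv_apply_const (0, Pi.single j 1)
    exact analyticAt_pi_iff.1 h2 i
  have hc : ContinuousAt (fun x => (Mmat ζm B x).det) 0 := by
    refine ContinuousAt.comp (g := Matrix.det) (f := Mmat ζm B)
      (Continuous.matrix_det continuous_id).continuousAt ?_
    exact continuousAt_pi.2 fun j => continuousAt_pi.2 fun i => (hM j i).continuousAt
  refine hc.eventually_ne ?_
  rw [(Mmat_eq hζ hB.1).self_of_nhds, pt_zero hζ.zero hB, Mjet_det_zero hζ]
  exact hB.2.2.2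

theorem memRing_Mjet (hζ : ZetaGood ζm) (j i : Fin n) :
    MemRing _ _ fun p : PSp n d₁ d₂ 1 => Mjet ζm p j i :=
  memRing_dF hζ.analyticAt 0 _ i

theorem memRing_det {V0 V1 : Type*} [NormedAddCommGroup V0] [NormedSpace ℂ V0]
    [NormedAddCommGroup V1] [NormedSpace ℂ V1] {A : V0 × V1 → Matrix (Fin n) (Fin n) ℂ}
    (hA : ∀ i j, MemRing V0 V1 fun x => A x i j) : MemRing V0 V1 fun x => (A x).det := by
  simp only [Matrix.det_apply, Units.smul_def, zsmul_eq_mul]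
  exact MemRing.sum _ fun σ => (memRing_const _).mul (MemRing.prod _ fun i => hA _ _)

theorem ex_Minv (hζ : ZetaGood ζm) (i j : Fin n) :
    Ex ζm 1 ∅ fun B x => (Mmat ζm B x)⁻¹ i j := by
  let θ : PSp n d₁ d₂ 1 → ℂ := fun p => p.1.1
  let e : PSp n d₁ d₂ 1 → ℂ := fun p => (Mjet ζm p).det - qdet 1 p.1.2
  have hq : MemRing (VZero n d₁ d₂ 1) (VOne n d₁ d₂ 1) fun p => qdet 1 p.1.2 :=
    MemRing.of_isPolyFun (p := fun x : VZero n d₁ d₂ 1 => qdet 1 x.2)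
      ((isPolyFun_qdet 1).comp_linear (LinearMap.snd ℂ ℂ _))
  have he : MemRing _ _ e := by
    have := (memRing_det (memRing_Mjet hζ)).add ((memRing_const (-1)).mul hq)
    refine this.congr fun x0 => Eventually.of_forall fun p => ?_
    show _ = (Mjet ζm p).det - qdet 1 p.1.2
    ring
  have hθ : MemRing _ _ θ := memRing_of_isLinearMap ⟨fun _ _ => rfl, fun _ _ => rfl⟩
  have hadj : MemRing _ _ fun p : PSp n d₁ d₂ 1 => (Mjet ζm p).adjugate i j := by
    simp only [Matrix.adjugate_apply]
    refine memRing_det fun a b => ?_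
    by_cases hab : a = j
    · subst hab
      simp only [Matrix.updateRow_self]
      exact memRing_const _
    · simp only [Matrix.updateRow_ne hab]
      exact memRing_Mjet hζ _ _
  refine ⟨fun p => θ p / (1 + θ p * e p) * (Mjet ζm p).adjugate i j,
    ((MemRing.div_one_add hθ he fun x0 => ?_).mul hadj).toMap,
    fun _ => Eventually.of_forall fun _ hp => hp.elim, fun B hB => ?_⟩
  · simp [e, Mjet_det_zero hζ]
  · have hq : ∀ᶠ x in 𝓝 0, qdet 1 (jetFull _ 1 B (ζm x)) ≠ 0 := by
      have hc : ContinuousAt (fun x => qdet (n := n) (d₁ := d₁) (d₂ := d₂) 1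
          (jetFull _ 1 B (ζm x))) 0 :=
        ((analyticAt_qdet 1 _).comp ((analyticAt_jetFull (by rw [hζ.zero]; exact hB.1)).comp
          hζ.analyticAt)).continuousAt
      refine hc.eventually_ne ?_
      rw [hζ.zero]
      exact hB.2.2.2
    filter_upwards [Mmat_eq hζ hB.1, hq, Mmat_det_ne_zero hζ hB] with x hx hqx hd
    rw [Matrix.inv_def, Ring.inverse_eq_inv', Matrix.smul_apply, smul_eq_mul]
    rw [hx] at hd ⊢
    have h1 : θ (pt ζm 1 B x) = 1 / qdet 1 (jetFull _ 1 B (ζm x)) := rfl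
    have h2 : e (pt ζm 1 B x) = (Mjet ζm (pt ζm 1 B x)).det - qdet 1 (jetFull _ 1 B (ζm x)) := rfl
    have h3 : 1 + θ (pt ζm 1 B x) * e (pt ζm 1 B x) =
        (Mjet ζm (pt ζm 1 B x)).det / qdet 1 (jetFull _ 1 B (ζm x)) := by
      rw [h1, h2]; field_simp; ring
    show _ = θ (pt ζm 1 B x) / (1 + θ (pt ζm 1 B x) * e (pt ζm 1 B x)) * _
    rw [h3, h1]
    congr 1
    field_simp

/-- The derivatives of the defining functions of the target, computed from a map `B`. -/
def yv (ζm : XSp n d₁ d₂ → Cn (n + (d₁ + d₂))) : List (Fin n) →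
    (Cn (n + (d₁ + d₂)) → Cn (n + (d₁ + d₂))) → XSp n d₁ d₂ → Cn (d₁ + d₂)
  | [], B, x => Gpart n d₁ d₂ B (ζm x)
  | i :: β, B, x => ∑ j, (Mmat ζm B x)⁻¹ i j • fderiv ℂ (yv ζm β B) x (0, Pi.single j 1)

theorem ex_yv (hζ : ZetaGood ζm) (β : List (Fin n)) :
    Ex ζm β.length (KX n d₁ d₂ β.length) (yv ζm β) := by
  induction β with
  | nil =>
    have h : MemRingMap _ _ _ fun p : PSp n d₁ d₂ 0 => p.2.1.1 (.zero n 0) :=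
      memRingMap_of_isLinearMap ⟨fun _ _ => rfl, fun _ _ => rfl⟩
    refine (ex_of_memRingMap h (K := KX n d₁ d₂ 0) ?_).congr fun B _ => Eventually.of_forall
      fun x => ?_
    · rintro p ⟨h1, -⟩
      rw [h1]; rfl
    · simp only [yv, pt, jetZG_zero]
  | cons i β ih =>
    refine ex_pi (F := fun _ => ℂ) fun b => ?_
    have key : ∀ j, Ex ζm (β.length + 1) (KX n d₁ d₂ (β.length + 1)) fun B x =>
        (Mmat ζm B x)⁻¹ i j * fderiv ℂ (yv ζm β B) x (0, Pi.single j 1) b := fun j =>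
      (((ex_Minv hζ i j).lift_empty (by omega)).mul
        ((ih.deriv_left hζ j).linear (LinearMap.proj b))).mono Set.subset_union_right
    refine (ex_sum Finset.univ key).congr fun B _ => Eventually.of_forall fun x => ?_
    simp [yv, Finset.sum_apply]

end Fiberwise

section HalfStep

variable {n d₁ d₂ : ℕ}

/-- The iterated derivatives of `T` with respect to its first argument. -/
def TD (T : Cn n × Cn (n + (d₁ + d₂)) → Cn (d₁ + d₂)) :
    List (Fin n) → Cn n × Cn (n + (d₁ + d₂)) → Cn (d₁ + d₂)
  | [] => T
  | i :: β => fun p => fderiv ℂ (TD T β) p (Pi.single i 1, 0)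

/-- Defining functions `T` and `T2` of the complexification of the target, one nondegenerate. -/
structure HalfData (T T2 : Cn n × Cn (n + (d₁ + d₂)) → Cn (d₁ + d₂)) (l : ℕ) : Prop where
  analyticAt : AnalyticAt ℂ T 0
  left : ∀ᶠ Z in 𝓝 (0 : Cn (n + (d₁ + d₂))), T (0, Z) = wfPart n d₁ d₂ Z
  right : ∀ᶠ p in 𝓝 (0 : Cn n × Cn (d₁ + d₂)), T (p.1, Fin.append 0 p.2) = p.2
  analyticAt₂ : AnalyticAt ℂ T2 0
  right₂ : ∀ᶠ z in 𝓝 (0 : Cn n), T2 (z, 0) = 0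
  nondeg : Submodule.span ℂ {v : Cn n | ∃ (j : Fin (d₁ + d₂)) (β : List (Fin n)),
    β ≠ [] ∧ β.length ≤ l ∧
      v = fun i => fderiv ℂ (TD T β) 0 (0, Pi.single (zIdx n d₁ d₂ i) 1) j} = ⊤

/-- The pair of maps `A`, `B` satisfies the basic equations up to order `k`. -/
structure Adm (ζm : XSp n d₁ d₂ → Cn (n + (d₁ + d₂)))
    (T T2 : Cn n × Cn (n + (d₁ + d₂)) → Cn (d₁ + d₂))
    (A B : Cn (n + (d₁ + d₂)) → Cn (n + (d₁ + d₂))) (k : ℕ) : Prop where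
  anA : AnalyticAt ℂ A 0
  A0 : A 0 = 0
  anB : AnalyticAt ℂ B 0
  B0 : B 0 = 0
  inj : ∀ v, fderiv ℂ B 0 v = 0 → v = 0
  eq₁ : (fun x : XSp n d₁ d₂ => Gpart n d₁ d₂ B (ζm x) - T (Fpart n d₁ d₂ B (ζm x), A x.1))
    =O[𝓝 0] fun x => ‖x‖ ^ k
  eq₂ : (fun x : XSp n d₁ d₂ => Gpart n d₁ d₂ A x.1 - T2 (Fpart n d₁ d₂ A x.1, B (ζm x)))
    =O[𝓝 0] fun x => ‖x‖ ^ k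

variable {ζm : XSp n d₁ d₂ → Cn (n + (d₁ + d₂))}
  {T T2 : Cn n × Cn (n + (d₁ + d₂)) → Cn (d₁ + d₂)} {l k : ℕ}
  {A B : Cn (n + (d₁ + d₂)) → Cn (n + (d₁ + d₂))}

theorem HalfData.analyticAt_TD (h : HalfData T T2 l) (β : List (Fin n)) :
    AnalyticAt ℂ (TD T β) 0 := by
  induction β with
  | nil => exact h.analyticAt
  | cons i β ih => exact ih.fderiv_apply_const _

@[simp] theorem append_zero_zero {a b : ℕ} : Fin.append (0 : Cn a) (0 : Cn b) = 0 := by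
  funext i
  refine Fin.addCases (fun i => ?_) (fun i => ?_) i <;> simp

theorem continuous_append {a b : ℕ} :
    Continuous fun p : Cn a × Cn b => Fin.append p.1 p.2 := by
  refine continuous_pi fun i => ?_
  refine Fin.addCases (fun i => ?_) (fun i => ?_) i
  · simp only [Fin.append_left]; fun_prop
  · simp only [Fin.append_right]; fun_prop

theorem HalfData.eventually_TD (h : HalfData T T2 l) (β : List (Fin n)) :
    ∃ g : Cn (d₁ + d₂) → Cn (d₁ + d₂), g 0 = 0 ∧ ∀ᶠ p in 𝓝 (0 : Cn n × Cn (d₁ + d₂)),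
      TD T β (p.1, Fin.append 0 p.2) = g p.2 := by
  induction β with
  | nil => exact ⟨id, rfl, h.right⟩
  | cons i β ih =>
    obtain ⟨g, -, hg⟩ := ih
    refine ⟨0, rfl, ?_⟩
    have ht : Tendsto (fun p : Cn n × Cn (d₁ + d₂) =>
        (p.1, (Fin.append (0 : Cn n) p.2 : Cn (n + (d₁ + d₂))))) (𝓝 0) (𝓝 0) := by
      refine Continuous.tendsto' ?_ _ _ (by simp)
      exact continuous_fst.prodMk (continuous_append.comp (continuous_const.prodMk continuous_snd))
    filter_upwards [hg.eventually_nhds,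
      ht.eventually (h.analyticAt_TD β).eventually_analyticAt] with p hp hpa
    refine fderiv_apply_eq_of_line hpa.differentiableAt ?_
    have ht' : Tendsto (fun t : ℂ => (p.1 + t • (Pi.single i 1 : Cn n), p.2)) (𝓝 0) (𝓝 p) :=
      (by fun_prop : Continuous fun t : ℂ =>
        (p.1 + t • (Pi.single i 1 : Cn n), p.2)).tendsto' _ _ (by simp)
    filter_upwards [ht'.eventually hp] with t ht
    simp only [Prod.mk_add_mk, Prod.smul_mk, smul_zero, add_zero]
    rw [hp.self_of_nhds]
    simpa using ht

theorem HalfData.TD_zero (h : HalfData T T2 l) (β : List (Fin n)) : TD T β 0 = 0 := by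
  obtain ⟨g, hg0, hg⟩ := h.eventually_TD β
  have := hg.self_of_nhds
  simp only [Prod.fst_zero, Prod.snd_zero, append_zero_zero, hg0] at this
  exact this

theorem Adm.analyticAt_F (hζ : ZetaGood ζm) (h : Adm ζm T T2 A B k) :
    AnalyticAt ℂ (fun x => Fpart n d₁ d₂ B (ζm x)) 0 := by
  refine AnalyticAt.comp (g := Fpart n d₁ d₂ B) (f := ζm) ?_ hζ.analyticAt
  rw [hζ.zero]
  exact h.anB.Fpart

theorem Fpart_eq_zero {Z : Cn (n + (d₁ + d₂))} (h : B Z = 0) : Fpart n d₁ d₂ B Z = 0 := by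
  funext i; simp [Fpart, h]

/-- The argument of `T` in the basic equations. -/
theorem Adm.analyticAt_arg (hζ : ZetaGood ζm) (h : Adm ζm T T2 A B k) :
    AnalyticAt ℂ (fun x : XSp n d₁ d₂ => (Fpart n d₁ d₂ B (ζm x), A x.1)) 0 :=
  (h.analyticAt_F hζ).prod
    (AnalyticAt.comp (g := A) (f := Prod.fst) (x := (0 : XSp n d₁ d₂)) h.anA analyticAt_fst)

theorem Adm.arg_zero (hζ : ZetaGood ζm) (h : Adm ζm T T2 A B k) :
    (Fpart n d₁ d₂ B (ζm 0), A (0 : XSp n d₁ d₂).1) = 0 := by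
  refine Prod.ext ?_ h.A0
  exact Fpart_eq_zero (by rw [hζ.zero, h.B0])

theorem Adm.analyticAt_TD (hζ : ZetaGood ζm) (hT : HalfData T T2 l) (h : Adm ζm T T2 A B k)
    (β : List (Fin n)) :
    AnalyticAt ℂ (fun x => TD T β (Fpart n d₁ d₂ B (ζm x), A x.1)) 0 := by
  refine AnalyticAt.comp (g := TD T β) ?_ (h.analyticAt_arg hζ)
  rw [h.arg_zero hζ]
  exact hT.analyticAt_TD β

theorem Adm.fderiv_TD (hζ : ZetaGood ζm) (hT : HalfData T T2 l) (h : Adm ζm T T2 A B k)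
    (β : List (Fin n)) (j : Fin n) :
    ∀ᶠ x in 𝓝 0, fderiv ℂ (fun x => TD T β (Fpart n d₁ d₂ B (ζm x), A x.1)) x
      (0, Pi.single j 1) =
      ∑ i, Mmat ζm B x j i • TD T (i :: β) (Fpart n d₁ d₂ B (ζm x), A x.1) := by
  have h1 := (hT.analyticAt_TD β).eventually_analyticAt
  rw [← h.arg_zero hζ] at h1
  have hA : ∀ᶠ x : XSp n d₁ d₂ in 𝓝 0, AnalyticAt ℂ A x.1 :=
    (continuous_fst.tendsto' (0 : XSp n d₁ d₂) 0 rfl).eventually h.anA.eventually_analyticAt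
  filter_upwards [(h.analyticAt_arg hζ).continuousAt.tendsto.eventually h1, hA,
    (h.analyticAt_F hζ).eventually_analyticAt] with x hx hAx hFx
  have hd := hFx.differentiableAt.hasFDerivAt.prodMk
    (hAx.differentiableAt.hasFDerivAt.comp x hasFDerivAt_fst)
  have := (hx.differentiableAt.hasFDerivAt.comp x hd).fderiv
  have h2 := congrArg (fun L => L (0, Pi.single j 1)) this
  refine h2.trans ?_
  simp only [ContinuousLinearMap.comp_apply, ContinuousLinearMap.prod_apply,
    ContinuousLinearMap.coe_fst', map_zero]
  have h3 : ∀ v : Cn n, fderiv ℂ (TD T β) (Fpart n d₁ d₂ B (ζm x), A x.1) (v, 0) =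
      ∑ i, v i • fderiv ℂ (TD T β) (Fpart n d₁ d₂ B (ζm x), A x.1) (Pi.single i 1, 0) := fun v =>
    ContinuousLinearMap.apply_eq_sum_single
      ((fderiv ℂ (TD T β) (Fpart n d₁ d₂ B (ζm x), A x.1)).comp
        (ContinuousLinearMap.inl ℂ (Cn n) (Cn (n + (d₁ + d₂))))) v
  exact h3 _

theorem Adm.isBigO_TD (hζ : ZetaGood ζm) (hT : HalfData T T2 l) (h : Adm ζm T T2 A B k)
    (β : List (Fin n)) (hB : Good β.length B) :
    (fun x => TD T β (Fpart n d₁ d₂ B (ζm x), A x.1) - yv ζm β B x)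
      =O[𝓝 0] fun x => ‖x‖ ^ (k - β.length) := by
  induction β with
  | nil => simpa [TD, yv] using h.eq₁.neg_left
  | cons i β ih =>
    have hB' : Good β.length B := hB.of_succ
    have hy : AnalyticAt ℂ (yv ζm β B) 0 := (ex_yv hζ β).analyticAt hζ hB'
    have ht := h.analyticAt_TD hζ hT β
    have h1 : ∀ j : Fin n, (fun x => fderiv ℂ (fun x => TD T β (Fpart n d₁ d₂ B (ζm x), A x.1) -
        yv ζm β B x) x (0, Pi.single j 1)) =O[𝓝 0] fun x => ‖x‖ ^ (k - β.length - 1) :=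
      fun j => isBigO_fderiv_apply (f := fun x => TD T β (Fpart n d₁ d₂ B (ζm x), A x.1) -
        yv ζm β B x) (ht.sub hy) (ih hB') ((0, Pi.single j 1) : XSp n d₁ d₂)
    have hg1 : Good 1 B := hB.of_le (by simp)
    have hM : ∀ j : Fin n, (fun x => (Mmat ζm B x)⁻¹ i j) =O[𝓝 0] fun _ => (1 : ℝ) := fun j =>
      ((ex_Minv hζ i j).analyticAt hζ hg1).continuousAt.isBigO_one ℝ
    have h2 : (fun x => ∑ j, (Mmat ζm B x)⁻¹ i j •
        fderiv ℂ (fun x => TD T β (Fpart n d₁ d₂ B (ζm x), A x.1) -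
        yv ζm β B x) x (0, Pi.single j 1)) =O[𝓝 0] fun x => ‖x‖ ^ (k - (i :: β).length) := by
      refine IsBigO.fun_sum fun j _ => ?_
      simpa [Nat.sub_sub] using (hM j).smul (h1 j)
    refine h2.congr' ?_ EventuallyEq.rfl
    filter_upwards [Mmat_det_ne_zero hζ hg1, eventually_all.2 fun j => h.fderiv_TD hζ hT β j,
      ht.eventually_analyticAt, hy.eventually_analyticAt] with x hd hx hta hya
    have h3 : ∀ j, fderiv ℂ (fun x => TD T β (Fpart n d₁ d₂ B (ζm x), A x.1) -
        yv ζm β B x) x (0, Pi.single j 1) =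
        (∑ i, Mmat ζm B x j i • TD T (i :: β) (Fpart n d₁ d₂ B (ζm x), A x.1)) -
          fderiv ℂ (yv ζm β B) x (0, Pi.single j 1) := by
      intro j
      rw [← hx j]
      have := fderiv_sub (𝕜 := ℂ) hta.differentiableAt hya.differentiableAt
      exact congrArg (fun L => L (0, Pi.single j 1)) this
    simp only [h3, smul_sub, Finset.sum_sub_distrib, yv, Finset.smul_sum, smul_smul]
    congr 1
    rw [Finset.sum_comm]
    simp only [← Finset.sum_smul]
    have h4 : ∀ i', ∑ j, (Mmat ζm B x)⁻¹ i j * Mmat ζm B x j i' = if i = i' then 1 else 0 := by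
      intro i'
      rw [← Matrix.mul_apply, Matrix.nonsing_inv_mul _ (isUnit_iff_ne_zero.2 hd),
        Matrix.one_apply]
    simp [h4]

theorem eq_append {a b : ℕ} (Z : Cn (a + b)) :
    Z = Fin.append (fun i => Z (Fin.castAdd b i)) (fun j => Z (Fin.natAdd a j)) := by
  funext i
  refine Fin.addCases (fun i => ?_) (fun i => ?_) i <;> simp

theorem append_zero_eq_sum (v : Cn n) :
    (Fin.append v 0 : Cn (n + (d₁ + d₂))) = ∑ i, v i • Pi.single (zIdx n d₁ d₂ i) 1 := by
  funext b
  refine Fin.addCases (fun i => ?_) (fun i => ?_) b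
  · simp [zIdx, Pi.single_apply, Finset.sum_apply]
  · have : ∀ j, Pi.single (M := fun _ => ℂ) (zIdx n d₁ d₂ j) 1 (Fin.natAdd n i) = 0 := fun j =>
      Pi.single_eq_of_ne (wfIdx_ne_zIdx i j) _
    simp [Finset.sum_apply, this]

/-- The inclusion of the `z`-coordinates. -/
def zIncl (n d₁ d₂ : ℕ) : Cn n →L[ℂ] Cn (n + (d₁ + d₂)) :=
  LinearMap.toContinuousLinearMap
    { toFun := fun v => Fin.append v 0
      map_add' := fun v w => by
        rw [append_zero_eq_sum, append_zero_eq_sum, append_zero_eq_sum, ← Finset.sum_add_distrib]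
        simp [add_smul]
      map_smul' := fun c v => by
        rw [append_zero_eq_sum, append_zero_eq_sum, Finset.smul_sum]
        simp [smul_smul] }

theorem zIncl_apply (v : Cn n) : zIncl n d₁ d₂ v = Fin.append v 0 := rfl

theorem zIncl_single (i : Fin n) :
    zIncl n d₁ d₂ (Pi.single i 1) = Pi.single (zIdx n d₁ d₂ i) 1 := by
  rw [zIncl_apply, append_zero_eq_sum, Finset.sum_eq_single i] <;> simp +contextual

theorem Adm.jetZG_eq_zero (hζ : ZetaGood ζm) (hT : HalfData T T2 l) (h : Adm ζm T T2 A B k)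
    {m : ℕ} (hm : m < k) : jetZG n d₁ d₂ m B 0 = 0 := by
  have ht : Tendsto (fun χ : Cn n => ((0, χ) : XSp n d₁ d₂)) (𝓝 0) (𝓝 0) :=
    (continuous_const.prodMk continuous_id).tendsto' _ _ rfl
  have hF : Tendsto (fun χ : Cn n => Fpart n d₁ d₂ B (ζm (0, χ))) (𝓝 0) (𝓝 0) := by
    have := (h.analyticAt_F hζ).continuousAt.tendsto
    rw [Fpart_eq_zero (by rw [hζ.zero, h.B0])] at this
    exact this.comp ht
  have hR : ∀ᶠ χ in 𝓝 (0 : Cn n), T (χ, 0) = 0 := by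
    have : Tendsto (fun χ : Cn n => ((χ, 0) : Cn n × Cn (d₁ + d₂))) (𝓝 0) (𝓝 0) :=
      (continuous_id.prodMk continuous_const).tendsto' _ _ rfl
    filter_upwards [this.eventually hT.right] with χ hχ
    simpa using hχ
  have h1 : (fun χ => Gpart n d₁ d₂ B (zIncl n d₁ d₂ χ)) =O[𝓝 0] fun χ => ‖χ‖ ^ k := by
    refine (h.eq₁.comp_tendsto ht).congr' ?_ (Eventually.of_forall fun χ => by simp)
    filter_upwards [hF.eventually hR, hζ.left] with χ h2 h3
    simp only [Function.comp_apply, h.A0, h2, sub_zero]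
    rw [h3]
    rfl
  funext ν
  have hBa : AnalyticAt ℂ (Gpart n d₁ d₂ B) (zIncl n d₁ d₂ 0) := by
    rw [map_zero]; exact h.anB.Gpart
  have h2 := isBigO_iterDeriv (f := fun χ => Gpart n d₁ d₂ B (zIncl n d₁ d₂ χ))
    (AnalyticAt.comp (g := Gpart n d₁ d₂ B) (f := zIncl n d₁ d₂) hBa
      ((zIncl n d₁ d₂).analyticAt 0)) h1
    ((List.finRange n).flatMap fun i => List.replicate (ν.1 i : ℕ) (Pi.single i (1:ℂ) : Cn n))
  have h3 := (iterDeriv_comp_clm (zIncl n d₁ d₂) ((List.finRange n).flatMap fun i =>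
    List.replicate (ν.1 i : ℕ) (Pi.single i (1:ℂ) : Cn n)) hBa).self_of_nhds
  have h4 := eq_zero_of_isBigO_norm_pow ?_ h2 (pure_le_nhds 0)
  · rw [h3] at h4
    simp only [List.map_flatMap, List.map_replicate, zIncl_single, map_zero] at h4
    exact h4
  · have : (List.flatMap (fun i => List.replicate (ν.1 i : ℕ) (Pi.single i (1:ℂ) : Cn n))
        (List.finRange n)).length = ∑ i, (ν.1 i : ℕ) := by
      simp [List.length_flatMap, Fin.sum_univ_def]
    have := ν.2
    omega

theorem Adm.detFz_ne_zero (hζ : ZetaGood ζm) (hT : HalfData T T2 l) (h : Adm ζm T T2 A B k)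
    (hk : 1 < k) : detFz n d₁ d₂ B 0 ≠ 0 := by
  intro h0
  obtain ⟨v, hv, hv0⟩ := Matrix.exists_mulVec_eq_zero_iff.2 h0
  refine hv (?_ : v = 0)
  have hG := h.jetZG_eq_zero hζ hT hk
  have h1 : fderiv ℂ B 0 (zIncl n d₁ d₂ v) = 0 := by
    funext b
    refine Fin.addCases (fun i => ?_) (fun j => ?_) b
    · have := congrFun hv0 i
      simp only [Matrix.mulVec, dotProduct, Matrix.of_apply] at this
      rw [zIncl_apply, append_zero_eq_sum]
      simp only [map_sum, map_smul, Finset.sum_apply, Pi.smul_apply, smul_eq_mul, Pi.zero_apply]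
      refine Eq.trans ?_ this
      refine Finset.sum_congr rfl fun a _ => ?_
      rw [mul_comm, fderiv_apply (𝕜 := ℂ) h.anB.differentiableAt (zIdx n d₁ d₂ i)]
      rfl
    · rw [zIncl_apply, append_zero_eq_sum]
      simp only [map_sum, map_smul, Finset.sum_apply, Pi.smul_apply, smul_eq_mul, Pi.zero_apply]
      refine Finset.sum_eq_zero fun a _ => ?_
      have h2 := congrFun (congrFun hG ((MIdx.zero n 0).up a)) j
      rw [jetZG_up h.anB] at h2
      simp only [jetZG_zero] at h2
      have h3 := congrArg (fun L => L (Pi.single (zIdx n d₁ d₂ a) 1))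
        (fderiv_apply (𝕜 := ℂ) h.anB.Gpart.differentiableAt j)
      have h4 := congrArg (fun L => L (Pi.single (zIdx n d₁ d₂ a) 1))
        (fderiv_apply (𝕜 := ℂ) h.anB.differentiableAt (wfIdx n d₁ d₂ j))
      have h5 : fderiv ℂ B 0 (Pi.single (zIdx n d₁ d₂ a) 1) (wfIdx n d₁ d₂ j) = 0 :=
        h4.symm.trans (h3.trans h2)
      exact mul_eq_zero_of_right _ h5
  have h2 := h.inj _ h1
  funext i
  have := congrFun h2 (Fin.castAdd _ i)
  rwa [zIncl_apply, Fin.append_left] at this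

end HalfStep

section HalfConclusion

variable {n d₁ d₂ : ℕ} {ζm : XSp n d₁ d₂ → Cn (n + (d₁ + d₂))}
  {T T2 : Cn n × Cn (n + (d₁ + d₂)) → Cn (d₁ + d₂)} {l k : ℕ}
  {A B : Cn (n + (d₁ + d₂)) → Cn (n + (d₁ + d₂))}

/-- The words of length at most `l` in `n` letters. -/
abbrev Words (n l : ℕ) : Type := Σ m : Fin (l + 1), (Fin m → Fin n)

/-- The map collecting the derivatives of `T` of order at most `l`. -/
def collectTD (T : Cn n × Cn (n + (d₁ + d₂)) → Cn (d₁ + d₂)) (l : ℕ)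
    (p : Cn n × Cn (n + (d₁ + d₂))) : Cn n × (Words n l → Cn (d₁ + d₂)) :=
  (p.1, fun ι => TD T (List.ofFn ι.2) p)

theorem HalfData.hasFDerivAt_collectTD (h : HalfData T T2 l) :
    HasFDerivAt (collectTD T l) ((ContinuousLinearMap.fst ℂ _ _).prod
      (ContinuousLinearMap.pi fun ι => fderiv ℂ (TD T (List.ofFn ι.2)) 0)) 0 :=
  hasFDerivAt_fst.prodMk (hasFDerivAt_pi.2 fun _ =>
    (h.analyticAt_TD _).differentiableAt.hasFDerivAt)

theorem HalfData.analyticAt_collectTD (h : HalfData T T2 l) :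
    AnalyticAt ℂ (collectTD T l) 0 :=
  analyticAt_fst.prod (analyticAt_pi_iff.2 fun _ => h.analyticAt_TD _)

theorem HalfData.collectTD_zero (h : HalfData T T2 l) : collectTD T l 0 = 0 :=
  Prod.ext rfl (funext fun _ => h.TD_zero _)

theorem HalfData.exists_leftInverse (h : HalfData T T2 l) :
    ∃ Φ : Cn n × (Words n l → Cn (d₁ + d₂)) → Cn n × Cn (n + (d₁ + d₂)),
      AnalyticAt ℂ Φ 0 ∧ ∀ᶠ p in 𝓝 0, Φ (collectTD T l p) = p := by
  refine exists_analytic_leftInverse h.analyticAt_collectTD h.collectTD_zero ?_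
  rintro ⟨a, b⟩ hv
  rw [h.hasFDerivAt_collectTD.fderiv] at hv
  obtain rfl : a = 0 := congrArg Prod.fst hv
  have h1 : ∀ β : List (Fin n), β.length ≤ l → fderiv ℂ (TD T β) 0 (0, b) = 0 := by
    intro β hβ
    have := congrFun (congrArg Prod.snd hv) ⟨⟨β.length, by omega⟩, β.get⟩
    simpa using this
  have h2 : wfPart n d₁ d₂ b = 0 := by
    rw [← h1 [] (by simp)]
    refine (fderiv_apply_eq_of_line h.analyticAt.differentiableAt ?_).symm
    have ht : Tendsto (fun t : ℂ => t • b) (𝓝 0) (𝓝 0) :=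
      (by fun_prop : Continuous fun t : ℂ => t • b).tendsto' _ _ (by simp)
    filter_upwards [ht.eventually h.left] with t ht
    have h0 : T 0 = 0 := h.TD_zero []
    simp only [Prod.smul_mk, smul_zero, zero_add, h0]
    exact ht
  have h3 : b = zIncl n d₁ d₂ (zPart n d₁ d₂ b) := by
    rw [zIncl_apply]
    refine (eq_append b).trans ?_
    congr 1
  have h4 : zPart n d₁ d₂ b = 0 := by
    let φ : Cn n →ₗ[ℂ] ℂ := ∑ i, zPart n d₁ d₂ b i • LinearMap.proj i
    have hφ : (⊤ : Submodule ℂ (Cn n)) ≤ LinearMap.ker φ := by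
      rw [← h.nondeg, Submodule.span_le]
      rintro v ⟨j, β, -, hβ, rfl⟩
      have h5 := h1 β hβ
      rw [h3, zIncl_apply, append_zero_eq_sum] at h5
      have h6 : ((0 : Cn n), ∑ i, zPart n d₁ d₂ b i • (Pi.single (zIdx n d₁ d₂ i) 1 :
          Cn (n + (d₁ + d₂)))) =
          ∑ i, zPart n d₁ d₂ b i • ((0 : Cn n), (Pi.single (zIdx n d₁ d₂ i) 1 :
          Cn (n + (d₁ + d₂)))) := by
        refine Prod.ext ?_ ?_ <;> simp [Prod.fst_sum, Prod.snd_sum]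
      rw [h6] at h5
      have h7 := congrFun h5 j
      simp only [map_sum, map_smul, Finset.sum_apply, Pi.smul_apply, Pi.zero_apply] at h7
      simpa only [φ, SetLike.mem_coe, LinearMap.mem_ker, LinearMap.sum_apply, LinearMap.smul_apply,
        LinearMap.proj_apply] using h7
    funext i
    have := hφ (Submodule.mem_top (x := (Pi.single i 1 : Cn n)))
    simpa [φ, LinearMap.sum_apply, Pi.single_apply] using this
  rw [h3, h4, map_zero]
  rfl

theorem HalfData.eq_zero_of_l (h : HalfData T T2 0) : n = 0 := by
  have h1 := h.nondeg
  rw [Submodule.span_eq_bot.2] at h1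
  · by_contra hn
    have : (Pi.single (⟨0, by omega⟩ : Fin n) (1 : ℂ) : Cn n) ∈ (⊥ : Submodule ℂ (Cn n)) := by
      rw [h1]; trivial
    rw [Submodule.mem_bot] at this
    simpa using congrFun this ⟨0, by omega⟩
  · rintro v ⟨j, β, h2, h3, -⟩
    exact absurd (List.length_eq_zero_iff.1 (by omega)) h2

theorem HalfData.qdet_eq (h : HalfData T T2 l) (hB : AnalyticAt ℂ B 0) (r : ℕ) :
    qdet (l + r) (jetFull _ (l + r) B 0) = detFz n d₁ d₂ B 0 := by
  rcases Nat.eq_zero_or_eq_succ_pred (l + r) with h0 | h0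
  · obtain ⟨rfl, rfl⟩ : l = 0 ∧ r = 0 := by omega
    obtain rfl := h.eq_zero_of_l
    simp [qdet, detFz]
  · rw [h0]
    exact qdet_jetFull _ hB

theorem Adm.good (hζ : ZetaGood ζm) (hT : HalfData T T2 l) (h : Adm ζm T T2 A B k) {r : ℕ}
    (hk : l + r < k) : Good (l + r) B := by
  refine ⟨h.anB, h.jetZG_eq_zero hζ hT hk, Fpart_eq_zero h.B0, ?_⟩
  rcases Nat.eq_zero_or_pos (l + r) with h0 | h0
  · rw [h0]; exact one_ne_zero
  · rw [hT.qdet_eq h.anB]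
    exact h.detFz_ne_zero hζ hT (by omega)

section

variable {F : Type*} [NormedAddCommGroup F] [NormedSpace ℂ F] [FiniteDimensional ℂ F]

omit [FiniteDimensional ℂ F] in
theorem Ex.apply_zero (hζ : ZetaGood ζm) {m : ℕ}
    {u : (Cn (n + (d₁ + d₂)) → Cn (n + (d₁ + d₂))) → XSp n d₁ d₂ → F}
    (h : Ex ζm m (KO n d₁ d₂ m) u) (hB : Good m B) : u B 0 = 0 := by
  obtain ⟨Ψ, -, h2, h3⟩ := h
  rw [(h3 B hB).self_of_nhds, pt_zero hζ.zero hB]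
  exact (h2 _).self_of_nhds rfl

omit [FiniteDimensional ℂ F] in
theorem Ex.iterDeriv {K : ∀ m, Set (PSp n d₁ d₂ m)} (vs : List (XSp n d₁ d₂))
    (hv : ∀ v ∈ vs, ∀ (m : ℕ) (u : (Cn (n + (d₁ + d₂)) → Cn (n + (d₁ + d₂))) →
      XSp n d₁ d₂ → F), Ex ζm m (K m) u → Ex ζm (m + 1) (K (m + 1)) fun B x => fderiv ℂ (u B) x v)
    {m m' : ℕ} (hm : m + vs.length = m')
    {u : (Cn (n + (d₁ + d₂)) → Cn (n + (d₁ + d₂))) → XSp n d₁ d₂ → F}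
    (h : Ex ζm m (K m) u) : Ex ζm m' (K m') fun B => _root_.iterDeriv vs (u B) := by
  induction vs generalizing m u with
  | nil => subst hm; exact h
  | cons v vs ih =>
    exact ih (fun w hw => hv w (List.mem_cons_of_mem _ hw))
      (by rw [← hm, List.length_cons]; ring) (hv v List.mem_cons_self m u h)

end

theorem ex_F (m : ℕ) : Ex ζm m (KO n d₁ d₂ m) fun B x => Fpart n d₁ d₂ B (ζm x) :=
  ex_of_memRingMap (Ψ := fun p : PSp n d₁ d₂ m => p.2.1.2)
    (memRingMap_of_isLinearMap ⟨fun _ _ => rfl, fun _ _ => rfl⟩)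
    fun p (hp : p.2 = 0) => by rw [hp]; rfl

theorem ex_B (m : ℕ) : Ex ζm m (KZ n d₁ d₂ m) fun B x => B (ζm x) := by
  refine ex_pi fun b => ?_
  refine Fin.addCases (fun i => ?_) (fun j => ?_) b
  · exact ex_of_memRingMap (Ψ := fun p : PSp n d₁ d₂ m => p.2.1.2 i)
      (memRingMap_of_isLinearMap ⟨fun _ _ => rfl, fun _ _ => rfl⟩)
      fun p (hp : p.2.1 = 0 ∧ _) => by rw [hp.1]; rfl
  · refine (ex_of_memRingMap (Ψ := fun p : PSp n d₁ d₂ m => p.2.1.1 (.zero n m) j)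
      (memRingMap_of_isLinearMap ⟨fun _ _ => rfl, fun _ _ => rfl⟩)
      fun p (hp : p.2.1 = 0 ∧ _) => by rw [hp.1]; rfl).congr fun B _ =>
        Eventually.of_forall fun x => ?_
    simp only [pt, jetZG_zero]
    rfl

theorem HalfData.ex_z (hζ : ZetaGood ζm) (hT : HalfData T T2 l) :
    ∃ u : (Cn (n + (d₁ + d₂)) → Cn (n + (d₁ + d₂))) → XSp n d₁ d₂ → Cn n,
      Ex ζm l (KO n d₁ d₂ l) u ∧ ∀ A B k, Good l B → Adm ζm T T2 A B k →
        (fun x => Fpart n d₁ d₂ A x.1 - u B x) =O[𝓝 0] fun x => ‖x‖ ^ (k - l) := by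
  obtain ⟨Φ, hΦ, hΦT⟩ := hT.exists_leftInverse
  let w : (Cn (n + (d₁ + d₂)) → Cn (n + (d₁ + d₂))) → XSp n d₁ d₂ →
      Cn n × (Words n l → Cn (d₁ + d₂)) := fun B x =>
    (Fpart n d₁ d₂ B (ζm x), fun ι => yv ζm (List.ofFn ι.2) B x)
  have hle : ∀ ι : Words n l, (List.ofFn ι.2).length ≤ l := fun ι => by
    rw [List.length_ofFn]; omega
  have hw : Ex ζm l (KO n d₁ d₂ l) w := by
    refine (ex_F l).prodMk (ex_pi fun ι => ?_)
    exact ((ex_yv hζ (List.ofFn ι.2)).lift_le (K := KX n d₁ d₂) (fun m p => projP_mem_KX)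
      (hle ι)).mono (KO_subset_KX l)
  have hΦ0 : Φ 0 = 0 := by
    have := hΦT.self_of_nhds
    rwa [hT.collectTD_zero] at this
  let L : Cn n × Cn (n + (d₁ + d₂)) →ₗ[ℂ] Cn n :=
    IsLinearMap.mk' (fun p => zPart n d₁ d₂ p.2) ⟨fun _ _ => rfl, fun _ _ => rfl⟩
  refine ⟨fun B x => L (Φ (w B x)), (hw.comp_analyticAt' le_rfl hΦ hΦ0).linear L,
    fun A B k hB h => ?_⟩
  have ha : Tendsto (fun x : XSp n d₁ d₂ => collectTD T l (Fpart n d₁ d₂ B (ζm x), A x.1)) (𝓝 0)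
      (𝓝 0) := by
    have h1 := (h.analyticAt_arg hζ).continuousAt.tendsto
    rw [h.arg_zero hζ] at h1
    have h2 := hT.analyticAt_collectTD.continuousAt.tendsto
    rw [hT.collectTD_zero] at h2
    exact h2.comp h1
  have hb : Tendsto (w B) (𝓝 0) (𝓝 0) := by
    have := (hw.analyticAt hζ hB).continuousAt.tendsto
    rwa [hw.apply_zero hζ hB] at this
  have h1 : (fun x => collectTD T l (Fpart n d₁ d₂ B (ζm x), A x.1) - w B x) =O[𝓝 0]
      fun x => ‖x‖ ^ (k - l) := by
    have h2 : (fun x (ι : Words n l) => TD T (List.ofFn ι.2) (Fpart n d₁ d₂ B (ζm x), A x.1) -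
        yv ζm (List.ofFn ι.2) B x) =O[𝓝 0] fun x => ‖x‖ ^ (k - l) :=
      isBigO_pi.2 fun ι => isBigO_norm_pow_of_le le_rfl
        (h.isBigO_TD hζ hT (List.ofFn ι.2) (hB.of_le (hle ι))) (by have := hle ι; omega)
    refine ((isBigO_zero _ _).prod_left h2).congr_left fun x => ?_
    exact Prod.ext (sub_self _).symm rfl
  have h2 := ((LinearMap.toContinuousLinearMap L).isBigO_comp (fun x : XSp n d₁ d₂ =>
    Φ (collectTD T l (Fpart n d₁ d₂ B (ζm x), A x.1)) - Φ (w B x)) _).trans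
    ((hΦ.isBigO_comp_sub ha hb).trans h1)
  refine h2.congr' ?_ EventuallyEq.rfl
  have h3 := (h.analyticAt_arg hζ).continuousAt.tendsto
  rw [h.arg_zero hζ] at h3
  filter_upwards [h3.eventually hΦT] with x hx
  show L (_ - _) = _
  rw [hx, map_sub]
  rfl

end HalfConclusion

theorem iterDeriv_sub {E F : Type*} [NormedAddCommGroup E] [NormedSpace ℂ E]
    [NormedAddCommGroup F] [NormedSpace ℂ F] [CompleteSpace F] (vs : List E) {f g : E → F} {x : E}
    (hf : AnalyticAt ℂ f x) (hg : AnalyticAt ℂ g x) :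
    iterDeriv vs (fun y => f y - g y) =ᶠ[𝓝 x] fun y => iterDeriv vs f y - iterDeriv vs g y := by
  have := iterDeriv_add vs (hf.fun_sub hg) hg
  simp only [sub_add_cancel] at this
  filter_upwards [this] with y hy
  rw [hy, add_sub_cancel_right]

section HalfStepExists

variable {n d₁ d₂ : ℕ} {ζm : XSp n d₁ d₂ → Cn (n + (d₁ + d₂))}
  {T T2 : Cn n × Cn (n + (d₁ + d₂)) → Cn (d₁ + d₂)} {l : ℕ}

theorem HalfData.ex_A (hζ : ZetaGood ζm) (hT : HalfData T T2 l) :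
    ∃ u : (Cn (n + (d₁ + d₂)) → Cn (n + (d₁ + d₂))) → XSp n d₁ d₂ → Cn (n + (d₁ + d₂)),
      (Ex ζm l (KO n d₁ d₂ l) u ∧ Ex ζm l (KZ n d₁ d₂ l) fun B x => wfPart n d₁ d₂ (u B x)) ∧
      ∀ A B k, Good l B → Adm ζm T T2 A B k →
        (fun x => A x.1 - u B x) =O[𝓝 0] fun x => ‖x‖ ^ (k - l) := by
  obtain ⟨uF, hF, hFA⟩ := hT.ex_z hζ
  let uG : (Cn (n + (d₁ + d₂)) → Cn (n + (d₁ + d₂))) → XSp n d₁ d₂ → Cn (d₁ + d₂) :=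
    fun B x => T2 (uF B x, B (ζm x))
  have hG : Ex ζm l (KZ n d₁ d₂ l) uG :=
    Ex.comp_analyticAt (KO_subset_KZ l) hF (ex_B l) hT.analyticAt₂ hT.right₂
  let u : (Cn (n + (d₁ + d₂)) → Cn (n + (d₁ + d₂))) → XSp n d₁ d₂ → Cn (n + (d₁ + d₂)) :=
    fun B x => Fin.append (uF B x) (uG B x)
  refine ⟨u, ⟨ex_pi fun b => ?_, hG.congr fun B _ => Eventually.of_forall fun x => ?_⟩,
    fun A B k hB h => ?_⟩
  · refine Fin.addCases (fun i => ?_) (fun j => ?_) b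
    · simp only [u, Fin.append_left]
      exact hF.linear (LinearMap.proj i)
    · simp only [u, Fin.append_right]
      exact (hG.mono (KO_subset_KZ l)).linear (LinearMap.proj j)
  · funext j
    simp [wfPart, wfIdx, u]
  · have h1 := hFA A B k hB h
    have h2 : (fun x => Gpart n d₁ d₂ A x.1 - uG B x) =O[𝓝 0] fun x => ‖x‖ ^ (k - l) := by
      have h3 : (fun x : XSp n d₁ d₂ => T2 (Fpart n d₁ d₂ A x.1, B (ζm x)) -
          T2 (uF B x, B (ζm x))) =O[𝓝 0] fun x => ‖x‖ ^ (k - l) := by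
        have hBc : Tendsto (fun x => B (ζm x)) (𝓝 0) (𝓝 0) := by
          have := (h.anB.continuousAt.tendsto).comp (x := 𝓝 0) (f := ζm)
            (by simpa only [hζ.zero] using hζ.analyticAt.continuousAt.tendsto)
          rwa [h.B0] at this
        have hAc : Tendsto (fun x : XSp n d₁ d₂ => Fpart n d₁ d₂ A x.1) (𝓝 0) (𝓝 0) := by
          have := h.anA.Fpart.continuousAt.tendsto
          rw [Fpart_eq_zero h.A0] at this
          exact this.comp (continuous_fst.tendsto' (0 : XSp n d₁ d₂) 0 rfl)
        have huc : Tendsto (uF B) (𝓝 0) (𝓝 0) := by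
          have := (hF.analyticAt hζ hB).continuousAt.tendsto
          rwa [hF.apply_zero hζ hB] at this
        refine (hT.analyticAt₂.isBigO_comp_sub (hAc.prodMk_nhds hBc)
          (huc.prodMk_nhds hBc)).trans ?_
        refine (h1.prod_left (isBigO_zero (fun x : XSp n d₁ d₂ => ‖x‖ ^ (k - l)) _)).congr_left
          fun x => ?_
        exact Prod.ext rfl (sub_self _).symm
      refine ((isBigO_norm_pow_of_le le_rfl h.eq₂ (Nat.sub_le k l)).add h3).congr_left fun x => ?_
      exact sub_add_sub_cancel _ _ _
    refine isBigO_pi.2 fun b => ?_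
    refine Fin.addCases (fun i => ?_) (fun j => ?_) b
    · simpa [u, Fpart, zIdx] using isBigO_pi.1 h1 i
    · simpa [u, Gpart, wfIdx] using isBigO_pi.1 h2 j

theorem isBigO_iterDeriv_sub {F : Type*} [NormedAddCommGroup F] [NormedSpace ℂ F]
    [CompleteSpace F] {f : Cn (n + (d₁ + d₂)) → F} {g : XSp n d₁ d₂ → F} {k : ℕ}
    (hf : AnalyticAt ℂ f 0) (hg : AnalyticAt ℂ g 0)
    (h : (fun x => f x.1 - g x) =O[𝓝 0] fun x => ‖x‖ ^ k) (vs : List (Cn (n + (d₁ + d₂)))) :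
    (fun x : XSp n d₁ d₂ => iterDeriv vs f x.1 -
      iterDeriv (vs.map fun v => ((v, 0) : XSp n d₁ d₂)) g x)
      =O[𝓝 0] fun x => ‖x‖ ^ (k - vs.length) := by
  have hf' : AnalyticAt ℂ (fun x : XSp n d₁ d₂ => f x.1) 0 :=
    AnalyticAt.comp (g := f) (f := Prod.fst) (x := (0 : XSp n d₁ d₂)) hf analyticAt_fst
  have h1 := isBigO_iterDeriv (hf'.fun_sub hg) h (vs.map fun v => ((v, 0) : XSp n d₁ d₂))
  rw [List.length_map] at h1
  refine h1.congr' ?_ EventuallyEq.rfl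
  have h2 := iterDeriv_comp_clm (ContinuousLinearMap.fst ℂ (Cn (n + (d₁ + d₂))) (Cn n))
    (vs.map fun v => ((v, 0) : XSp n d₁ d₂)) (x := 0) (f := f) hf
  filter_upwards [iterDeriv_sub (vs.map fun v => ((v, 0) : XSp n d₁ d₂)) hf' hg, h2] with x hx hx2
  rw [hx]
  congr 1
  refine hx2.trans ?_
  simp [List.map_map, Function.comp_def]

theorem length_flatMap_replicate {m : ℕ} {E : Type*} (a : Fin m → ℕ) (w : Fin m → E) :
    ((List.finRange m).flatMap fun i => List.replicate (a i) (w i)).length = ∑ i, a i := by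
  simp [List.length_flatMap, Fin.sum_univ_def]

/-- The half step of the iteration: the jets of `A` along the complexification are expressed
by the jets of `B`. -/
theorem HalfData.exists_half (hζ : ZetaGood ζm) (hT : HalfData T T2 l) (r : ℕ) :
    ∃ Ψ : PSp n d₁ d₂ (l + r) → ESp n d₁ d₂ r, MemRingMap _ _ _ Ψ ∧
      (∀ x0, (Ψ (x0, 0)).2 = 0) ∧ (r = 0 → ∀ x0, Ψ (x0, 0) = 0) ∧
      ∀ A B k, l + r < k → Adm ζm T T2 A B k → Good (l + r) B ∧
        (fun x => calJ n d₁ d₂ r A x.1 - Ψ (pt ζm (l + r) B x)) =O[𝓝 0]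
          fun x => ‖x‖ ^ (k - l - r) := by
  obtain ⟨u, ⟨hu, huG⟩, huA⟩ := hT.ex_A hζ
  let vsJ : MIdx (n + (d₁ + d₂)) r → List (Cn (n + (d₁ + d₂))) := fun α =>
    (List.finRange (n + (d₁ + d₂))).flatMap fun i =>
      List.replicate (α.1 i : ℕ) (Pi.single (id i) (1 : ℂ) : Cn (n + (d₁ + d₂)))
  let vsG : MIdx n r → List (Cn (n + (d₁ + d₂))) := fun ν =>
    (List.finRange n).flatMap fun i =>
      List.replicate (ν.1 i : ℕ) (Pi.single (zIdx n d₁ d₂ i) (1 : ℂ) : Cn (n + (d₁ + d₂)))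
  have lenJ : ∀ α, (vsJ α).length ≤ r := fun α => by
    simp only [vsJ, length_flatMap_replicate]; exact α.2
  have lenG : ∀ ν, (vsG ν).length ≤ r := fun ν => by
    simp only [vsG, length_flatMap_replicate]; exact ν.2
  let uJ : (Cn (n + (d₁ + d₂)) → Cn (n + (d₁ + d₂))) → XSp n d₁ d₂ →
      JetSp r (n + (d₁ + d₂)) (n + (d₁ + d₂)) := fun B x α =>
    iterDeriv ((vsJ α).map fun v => ((v, 0) : XSp n d₁ d₂)) (u B) x
  let uJG : (Cn (n + (d₁ + d₂)) → Cn (n + (d₁ + d₂))) → XSp n d₁ d₂ →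
      JetSp r n (d₁ + d₂) := fun B x ν =>
    iterDeriv ((vsG ν).map fun v => ((v, 0) : XSp n d₁ d₂)) (fun x => wfPart n d₁ d₂ (u B x)) x
  have hJ : Ex ζm (l + r) {p | r = 0 ∧ p.2 = 0} uJ := by
    refine ex_pi fun α => ?_
    rcases Nat.eq_zero_or_pos r with h0 | h0
    · have : vsJ α = [] := List.length_eq_zero_iff.1 (by have := lenJ α; omega)
      simp only [uJ, this, List.map_nil, iterDeriv]
      exact (hu.lift_le (K := KO n d₁ d₂) (fun m p => projP_mem_KO) (Nat.le_add_right l r)).mono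
        fun p hp => hp.2
    · have h1 := Ex.iterDeriv (K := fun _ => ∅) (m := l) (ζm := ζm)
        ((vsJ α).map fun v => ((v, 0) : XSp n d₁ d₂))
        (fun v _ m u hu => hu.deriv_any hζ v) rfl (hu.mono (Set.empty_subset _))
      exact (h1.lift_empty (by rw [List.length_map]; have := lenJ α; omega)).mono
        fun p hp => absurd hp.1 h0.ne'
  have hJG : Ex ζm (l + r) (KO n d₁ d₂ (l + r)) uJG := by
    refine ex_pi fun ν => ?_
    have h1 := Ex.iterDeriv (K := KZ n d₁ d₂) (m := l) (ζm := ζm)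
        ((vsG ν).map fun v => ((v, 0) : XSp n d₁ d₂)) ?_ rfl huG
    · exact (h1.lift_le (K := KZ n d₁ d₂) (fun m p => projP_mem_KZ)
        (by rw [List.length_map]; have := lenG ν; omega)).mono (KO_subset_KZ _)
    · intro v hv m u hu
      simp only [vsG, List.mem_map, List.mem_flatMap, List.mem_replicate] at hv
      obtain ⟨_, ⟨i, -, -, rfl⟩, rfl⟩ := hv
      exact hu.deriv_right hζ i
  have hF : Ex ζm (l + r) (KO n d₁ d₂ (l + r)) fun B x => zPart n d₁ d₂ (u B x) :=
    (hu.lift_le (K := KO n d₁ d₂) (fun m p => projP_mem_KO) (Nat.le_add_right l r)).linear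
      (IsLinearMap.mk' (fun Z => zPart n d₁ d₂ Z) ⟨fun _ _ => rfl, fun _ _ => rfl⟩)
  obtain ⟨Ψ₁, h1, h1z, h1p⟩ := hJ
  obtain ⟨Ψ₂, h2, h2z, h2p⟩ := hJG
  obtain ⟨Ψ₃, h3, h3z, h3p⟩ := hF
  refine ⟨fun p => (Ψ₁ p, (Ψ₂ p, Ψ₃ p)), h1.prodMk (h2.prodMk h3),
    fun x0 => Prod.ext ((h2z x0).self_of_nhds rfl) ((h3z x0).self_of_nhds rfl),
    fun hr x0 => Prod.ext ((h1z x0).self_of_nhds ⟨hr, rfl⟩)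
      (Prod.ext ((h2z x0).self_of_nhds rfl) ((h3z x0).self_of_nhds rfl)), fun A B k hk h => ?_⟩
  have hB := h.good hζ hT hk
  have hBl : Good l B := hB.of_le (Nat.le_add_right _ _)
  refine ⟨hB, ?_⟩
  have hA := huA A B k hBl h
  have hua := hu.analyticAt hζ hBl
  have hga := huG.analyticAt hζ hBl
  have hAG : (fun x => Gpart n d₁ d₂ A x.1 - wfPart n d₁ d₂ (u B x)) =O[𝓝 0]
      fun x => ‖x‖ ^ (k - l) :=
    isBigO_pi.2 fun j => isBigO_pi.1 hA (wfIdx n d₁ d₂ j)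
  have e1 : (fun x => jetFull _ r A x.1 - uJ B x) =O[𝓝 0] fun x => ‖x‖ ^ (k - l - r) :=
    isBigO_pi.2 fun α => isBigO_norm_pow_of_le le_rfl
      (isBigO_iterDeriv_sub h.anA hua hA (vsJ α)) (by have := lenJ α; omega)
  have e2 : (fun x => jetZG n d₁ d₂ r A x.1 - uJG B x) =O[𝓝 0] fun x => ‖x‖ ^ (k - l - r) :=
    isBigO_pi.2 fun ν => isBigO_norm_pow_of_le le_rfl
      (isBigO_iterDeriv_sub h.anA.Gpart hga hAG (vsG ν)) (by have := lenG ν; omega)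
  have e3 : (fun x => Fpart n d₁ d₂ A x.1 - zPart n d₁ d₂ (u B x)) =O[𝓝 0]
      fun x => ‖x‖ ^ (k - l - r) :=
    isBigO_pi.2 fun i => isBigO_norm_pow_of_le le_rfl (isBigO_pi.1 hA (zIdx n d₁ d₂ i))
      (by omega)
  refine (e1.prod_left (e2.prod_left e3)).congr' ?_ EventuallyEq.rfl
  filter_upwards [h1p B hB, h2p B hB, h3p B hB] with x hx1 hx2 hx3
  rw [← hx1, ← hx2, ← hx3]
  rfl

end HalfStepExists

section Steps

variable {n d₁ d₂ : ℕ}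

theorem IsPolyFun.analyticAt {V : Type*} [NormedAddCommGroup V] [NormedSpace ℂ V]
    [FiniteDimensional ℂ V] {p : V → ℂ} (hp : IsPolyFun p) (x : V) : AnalyticAt ℂ p x :=
  ((MemRing.of_isPolyFun (V1 := ℂ) hp).analyticAt x).comp
    (f := fun x => (x, (0 : ℂ))) (analyticAt_id.prod analyticAt_const)

theorem IsPolyFun.comp_fst {V W : Type*} [AddCommGroup V] [Module ℂ V] [AddCommGroup W] [Module ℂ W]
    {p : V → ℂ} (hp : IsPolyFun p) : IsPolyFun fun x : V × W => p x.1 :=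
  hp.comp_linear (LinearMap.fst ℂ V W)

theorem IsPolyFun.comp_snd {V W : Type*} [AddCommGroup V] [Module ℂ V] [AddCommGroup W] [Module ℂ W]
    {p : W → ℂ} (hp : IsPolyFun p) : IsPolyFun fun x : V × W => p x.2 :=
  hp.comp_linear (LinearMap.snd ℂ V W)

/-- The germ `Z ↦ ((1/q(j^r B(Z)), j^r B(Z)), ((∂_z^ν G(Z))_ν, F(Z)))`, extended by a further
variable. -/
def jetPt {Y : Type*} {m : ℕ} (q : JetSp m (n + (d₁ + d₂)) (n + (d₁ + d₂)) → ℂ)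
    (B : Cn (n + (d₁ + d₂)) → Cn (n + (d₁ + d₂))) (Z : Cn (n + (d₁ + d₂))) (y : Y) :
    VZero n d₁ d₂ m × ((JetSp m n (d₁ + d₂) × Cn n) × Y) :=
  ((1 / q (jetFull _ m B Z), jetFull _ m B Z), ((jetZG n d₁ d₂ m B Z, Fpart n d₁ d₂ B Z), y))

/-- A family of germs at the origin such that the `z`-derivatives of the last components vanish
at the origin to the order prescribed by `k`. -/
structure FlatFamily {I : Type*} (k : I → ℕ)
    (A : I → Cn (n + (d₁ + d₂)) → Cn (n + (d₁ + d₂))) : Prop where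
  analyticAt : ∀ i, AnalyticAt ℂ (A i) 0
  zero : ∀ i, A i 0 = 0
  flat : ∀ i m, m < k i → jetZG n d₁ d₂ m (A i) 0 = 0

/-- The jets of order `r` of `A i` are determined, up to an error of order `k i - r'` along the set
`S`, by the jets of order `r'` of `B i` through a function which does not depend on `i`. -/
def JetStep {I : Type*} {Y : Type*} [NormedAddCommGroup Y] [NormedSpace ℂ Y]
    (k : I → ℕ) (δ δ' : I → ℂ) (A B : I → Cn (n + (d₁ + d₂)) → Cn (n + (d₁ + d₂)))
    (S : Set Y) (pA pB : Y →L[ℂ] Cn (n + (d₁ + d₂))) (r r' : ℕ) : Prop :=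
  ∃ (q : JetSp r' (n + (d₁ + d₂)) (n + (d₁ + d₂)) → ℂ) (a b : ℕ)
    (Ψ : VZero n d₁ d₂ r' × ((JetSp r' n (d₁ + d₂) × Cn n) × Y) → ESp n d₁ d₂ r),
    IsPolyFun q ∧ MemRingMap _ _ _ Ψ ∧ (∀ x0, (Ψ (x0, 0)).2 = 0) ∧
    (r = 0 → ∀ x0, Ψ (x0, 0) = 0) ∧
    ∀ i, r' < k i → q (jetFull _ r' (B i) 0) = δ i ^ a * δ' i ^ b ∧
      (fun y => calJ n d₁ d₂ r (A i) (pA y) - Ψ (jetPt q (B i) (pB y) y)) =O[𝓝[S] 0]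
        fun y => ‖y‖ ^ (k i - r')

variable {I : Type*} {k : I → ℕ} {δ δ' : I → ℂ}
  {A B C : I → Cn (n + (d₁ + d₂)) → Cn (n + (d₁ + d₂))} {r r' r'' : ℕ}
  {Y Y₁ Y₂ : Type*} [NormedAddCommGroup Y] [NormedSpace ℂ Y]
  [NormedAddCommGroup Y₁] [NormedSpace ℂ Y₁] [NormedAddCommGroup Y₂] [NormedSpace ℂ Y₂]
  {S : Set Y} {S₁ : Set Y₁} {S₂ : Set Y₂}

omit [NormedSpace ℂ Y] in
theorem FlatFamily.jetPt_zero (hB : FlatFamily k B) {i : I} (hi : r < k i)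
    (q : JetSp r (n + (d₁ + d₂)) (n + (d₁ + d₂)) → ℂ) :
    jetPt q (B i) 0 (0 : Y) = ((1 / q (jetFull _ r (B i) 0), jetFull _ r (B i) 0), 0) := by
  simp only [jetPt, hB.flat i r hi, Fpart_eq_zero (hB.zero i)]
  rfl

theorem FlatFamily.analyticAt_jetPt (hB : FlatFamily k B) {i : I}
    {q : JetSp r (n + (d₁ + d₂)) (n + (d₁ + d₂)) → ℂ} (hq : IsPolyFun q)
    (hq0 : q (jetFull _ r (B i) 0) ≠ 0) (pB : Y →L[ℂ] Cn (n + (d₁ + d₂))) :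
    AnalyticAt ℂ (fun y => jetPt q (B i) (pB y) y) 0 := by
  have hp : AnalyticAt ℂ pB 0 := pB.analyticAt 0
  have hB0 : AnalyticAt ℂ (B i) (pB 0) := by rw [map_zero]; exact hB.analyticAt i
  have hj : AnalyticAt ℂ (fun y => jetFull _ r (B i) (pB y)) 0 := (analyticAt_jetFull hB0).comp hp
  have hqa : AnalyticAt ℂ (fun y => q (jetFull _ r (B i) (pB y))) 0 := (hq.analyticAt _).comp hj
  exact ((analyticAt_const.div hqa (by simpa using hq0)).prod hj).prod
    ((((analyticAt_jetZG hB0).comp hp).prod (hB0.Fpart.comp hp)).prod analyticAt_id)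

theorem isBigO_clm_pow (L : Y →L[ℂ] Y₁) (m : ℕ) (l : Filter Y) :
    (fun y => ‖L y‖ ^ m) =O[l] fun y => ‖y‖ ^ m :=
  ((L.isBigO_id l).norm_norm).pow m

theorem tendsto_clm_nhdsWithin (L : Y →L[ℂ] Y₁) (h : ∀ y ∈ S, L y ∈ S₁) :
    Tendsto L (𝓝[S] 0) (𝓝[S₁] 0) := by
  have := L.continuous.continuousWithinAt.tendsto_nhdsWithin (s := S) (x := 0) (t := S₁) h
  rwa [map_zero] at this

variable [FiniteDimensional ℂ Y] [FiniteDimensional ℂ Y₁] [FiniteDimensional ℂ Y₂]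

theorem JetStep.comp (hB : FlatFamily k B) (hC : FlatFamily k C) (hδ : ∀ i, δ i ≠ 0)
    (hδ' : ∀ i, δ' i ≠ 0)
    {pA₁ pB₁ : Y₁ →L[ℂ] Cn (n + (d₁ + d₂))} {pB₂ pC₂ : Y₂ →L[ℂ] Cn (n + (d₁ + d₂))}
    (h₁ : JetStep k δ δ' A B S₁ pA₁ pB₁ r r') (h₂ : JetStep k δ δ' B C S₂ pB₂ pC₂ r' r'')
    (hr : r' ≤ r'') (π₁ : Y →L[ℂ] Y₁) (π₂ : Y →L[ℂ] Y₂) (hS₁ : ∀ y ∈ S, π₁ y ∈ S₁)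
    (hS₂ : ∀ y ∈ S, π₂ y ∈ S₂) (hπ : ∀ y, pB₁ (π₁ y) = pB₂ (π₂ y)) (h0 : 0 ∈ S) :
    JetStep k δ δ' A C S (pA₁ ∘L π₁) (pC₂ ∘L π₂) r r'' := by
  obtain ⟨q₁, a₁, b₁, Ψ₁, hq₁, hΨ₁, hz₁, hzz₁, he₁⟩ := h₁
  obtain ⟨q₂, a₂, b₂, Ψ₂, hq₂, hΨ₂, hz₂, hzz₂, he₂⟩ := h₂
  let p : ℂ × JetSp r'' (n + (d₁ + d₂)) (n + (d₁ + d₂)) → ℂ := fun x => q₁ (Ψ₂ (x, 0)).1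
  have hp : IsPolyFun p :=
    hΨ₂.isPolyFun (p := fun e => q₁ e.1) hq₁.comp_fst
  obtain ⟨c, P, hP, hPp⟩ := hq₂.clear_denominator hp
  let W := VZero n d₁ d₂ r'' × ((JetSp r'' n (d₁ + d₂) × Cn n) × Y)
  let h : W → VZero n d₁ d₂ r'' × ((JetSp r'' n (d₁ + d₂) × Cn n) × Y₂) := fun w =>
    ((w.1.1 * P w.1.2, w.1.2), (w.2.1, π₂ w.2.2))
  let θ : W → ℂ := fun w => w.1.1 * q₂ w.1.2 ^ (c + 1)
  let e : W → ℂ := fun w => q₁ (Ψ₂ (h w)).1 - p (w.1.1 * P w.1.2, w.1.2)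
  let f : W → ℂ := fun w => θ w / (1 + θ w * e w)
  let g : W → VZero n d₁ d₂ r' × ((JetSp r' n (d₁ + d₂) × Cn n) × Y₁) := fun w =>
    ((f w, (Ψ₂ (h w)).1), ((Ψ₂ (h w)).2, π₁ w.2.2))
  have m1 : MemRing (VZero n d₁ d₂ r'') ((JetSp r'' n (d₁ + d₂) × Cn n) × Y)
      fun w => w.1.1 * P w.1.2 :=
    MemRing.of_isPolyFun (p := fun x : VZero n d₁ d₂ r'' => x.1 * P x.2)
      ((IsPolyFun.linear (LinearMap.fst ℂ _ _)).mul hP.comp_snd)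
  have mθ : MemRing (VZero n d₁ d₂ r'') ((JetSp r'' n (d₁ + d₂) × Cn n) × Y) θ :=
    MemRing.of_isPolyFun (p := fun x : VZero n d₁ d₂ r'' => x.1 * q₂ x.2 ^ (c + 1))
      ((IsPolyFun.linear (LinearMap.fst ℂ _ _)).mul (hq₂.pow _).comp_snd)
  have mh : MemRingMap (VZero n d₁ d₂ r'') ((JetSp r'' n (d₁ + d₂) × Cn n) × Y) _ h := by
    refine MemRingMap.prodMk (MemRingMap.prodMk m1.toMap
      (memRingMap_of_isLinearMap ⟨fun _ _ => rfl, fun _ _ => rfl⟩))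
      (MemRingMap.prodMk (memRingMap_of_isLinearMap ⟨fun _ _ => rfl, fun _ _ => rfl⟩)
        (memRingMap_of_isLinearMap ⟨fun x y => ?_, fun c x => ?_⟩))
    · exact map_add π₂ x.2.2 y.2.2
    · exact map_smul π₂ c x.2.2
  have hh0 : ∀ x0, h (x0, 0) = ((x0.1 * P x0.2, x0.2), 0) := fun x0 =>
    Prod.ext rfl (Prod.ext rfl (map_zero π₂))
  have mΨ := hΨ₂.comp mh fun x0 => by rw [hh0]
  have me : MemRing (VZero n d₁ d₂ r'') ((JetSp r'' n (d₁ + d₂) × Cn n) × Y) e := by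
    have h1 : MemRing (VZero n d₁ d₂ r'') ((JetSp r'' n (d₁ + d₂) × Cn n) × Y)
        fun w => q₁ (Ψ₂ (h w)).1 :=
      MemRing.comp (V1 := ℂ) (f := fun x => q₁ x.1) (MemRing.of_isPolyFun hq₁)
        (g := fun w => ((Ψ₂ (h w)).1, 0))
        (MemRingMap.prodMk (mΨ.linear_comp (LinearMap.fst ℂ _ _)) (memRing_const 0).toMap)
        fun _ => rfl
    have h2 : MemRing (VZero n d₁ d₂ r'') ((JetSp r'' n (d₁ + d₂) × Cn n) × Y)
        fun w => -1 * p (w.1.1 * P w.1.2, w.1.2) := by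
      refine (memRing_const _).mul (MemRing.comp (V1 := ℂ) (f := fun x => p x.1)
        (MemRing.of_isPolyFun hp) (g := fun w : W => ((w.1.1 * P w.1.2, w.1.2), 0))
        (MemRingMap.prodMk (MemRingMap.prodMk m1.toMap
          (memRingMap_of_isLinearMap ⟨fun _ _ => rfl, fun _ _ => rfl⟩)) (memRing_const 0).toMap)
        fun _ => rfl)
    convert h1.add h2 using 2
    simp only [e]; ring
  have he0 : ∀ x0, e (x0, 0) = 0 := fun x0 => by
    simp only [e, hh0, p, sub_self]
  have mf : MemRing (VZero n d₁ d₂ r'') ((JetSp r'' n (d₁ + d₂) × Cn n) × Y) f :=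
    MemRing.div_one_add mθ me he0
  have mg : MemRingMap (VZero n d₁ d₂ r'') ((JetSp r'' n (d₁ + d₂) × Cn n) × Y) _ g := by
    refine MemRingMap.prodMk (MemRingMap.prodMk mf.toMap
      (mΨ.linear_comp (LinearMap.fst ℂ _ _)))
      (MemRingMap.prodMk (mΨ.linear_comp (LinearMap.snd ℂ _ _))
        (memRingMap_of_isLinearMap ⟨fun x y => ?_, fun c x => ?_⟩))
    · exact map_add π₁ x.2.2 y.2.2
    · exact map_smul π₁ c x.2.2
  have hg0 : ∀ x0, (g (x0, 0)).2 = 0 := fun x0 => by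
    refine Prod.ext ?_ (map_zero π₁)
    show (Ψ₂ (h (x0, 0))).2 = 0
    rw [hh0, hz₂]
  have hg0' : ∀ x0, g (x0, 0) = ((g (x0, 0)).1, 0) := fun x0 => by rw [← hg0 x0]
  refine ⟨fun Λ => q₂ Λ * P Λ, a₂ + (c * a₂ + a₁), b₂ + (c * b₂ + b₁), fun w => Ψ₁ (g w),
    hq₂.mul hP, hΨ₁.comp mg hg0, fun x0 => ?_,
    fun hr0 x0 => ?_, fun i hi => ?_⟩
  · show (Ψ₁ (g (x0, 0))).2 = 0
    rw [hg0', hz₁]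
  · show Ψ₁ (g (x0, 0)) = 0
    rw [hg0', hzz₁ hr0]
  have hi' : r' < k i := hr.trans_lt hi
  obtain ⟨hqi₁, hei₁⟩ := he₁ i hi'
  obtain ⟨hqi₂, hei₂⟩ := he₂ i hi
  have hq₁0 : q₁ (jetFull _ r' (B i) 0) ≠ 0 := by
    rw [hqi₁]; exact mul_ne_zero (pow_ne_zero _ (hδ i)) (pow_ne_zero _ (hδ' i))
  have hq₂0 : q₂ (jetFull _ r'' (C i) 0) ≠ 0 := by
    rw [hqi₂]; exact mul_ne_zero (pow_ne_zero _ (hδ i)) (pow_ne_zero _ (hδ' i))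
  let a : Y → ESp n d₁ d₂ r' := fun y => Ψ₂ (jetPt q₂ (C i) (pC₂ (π₂ y)) (π₂ y))
  let J : Y → ESp n d₁ d₂ r' := fun y => calJ n d₁ d₂ r' (B i) (pB₂ (π₂ y))
  have t₁ := tendsto_clm_nhdsWithin π₁ hS₁
  have t₂ := tendsto_clm_nhdsWithin π₂ hS₂
  have E₂ : (fun y => J y - a y) =O[𝓝[S] 0] fun y => ‖y‖ ^ (k i - r'') :=
    (hei₂.comp_tendsto t₂).trans (isBigO_clm_pow π₂ _ _)
  have Jan : AnalyticAt ℂ J 0 := by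
    have hB0 : AnalyticAt ℂ (B i) ((pB₂ ∘L π₂) 0) := by rw [map_zero]; exact hB.analyticAt i
    exact (analyticAt_calJ hB0).comp ((pB₂ ∘L π₂).analyticAt 0)
  have J0 : J 0 = (jetFull _ r' (B i) 0, 0) := by
    simp only [J, calJ, map_zero, hB.flat i r' hi', Fpart_eq_zero (hB.zero i)]
    rfl
  have a0 : a 0 = J 0 := by
    have := eq_zero_of_isBigO_norm_pow (Nat.sub_pos_of_lt hi) E₂
      (pure_le_nhdsWithin h0)
    exact (sub_eq_zero.1 this).symm
  have hP0 : P (jetFull _ r'' (C i) 0) =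
      q₂ (jetFull _ r'' (C i) 0) ^ c * q₁ (jetFull _ r' (B i) 0) := by
    rw [hPp _ hq₂0]
    congr 1
    have : a 0 = Ψ₂ ((1 / q₂ (jetFull _ r'' (C i) 0), jetFull _ r'' (C i) 0), 0) := by
      simp only [a, map_zero, hC.jetPt_zero hi]
    show q₁ (Ψ₂ _).1 = _
    rw [← this, a0, J0]
  refine ⟨?_, ?_⟩
  · show q₂ _ * P _ = _
    rw [hP0, hqi₁, hqi₂]; ring
  have hPne : P (jetFull _ r'' (C i) 0) ≠ 0 := by
    rw [hP0]; exact mul_ne_zero (pow_ne_zero _ hq₂0) hq₁0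
  have jC : AnalyticAt ℂ (fun y => jetFull _ r'' (C i) (pC₂ (π₂ y))) 0 := by
    have hC0 : AnalyticAt ℂ (C i) ((pC₂ ∘L π₂) 0) := by rw [map_zero]; exact hC.analyticAt i
    exact (analyticAt_jetFull hC0).comp ((pC₂ ∘L π₂).analyticAt 0)
  have ne₂ : ∀ᶠ y in 𝓝 0, q₂ (jetFull _ r'' (C i) (pC₂ (π₂ y))) ≠ 0 :=
    ((hq₂.analyticAt _).comp jC).continuousAt.eventually_ne (by simpa using hq₂0)
  have neP : ∀ᶠ y in 𝓝 0, P (jetFull _ r'' (C i) (pC₂ (π₂ y))) ≠ 0 :=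
    ((hP.analyticAt _).comp jC).continuousAt.eventually_ne (by simpa using hPne)
  let Θ : ESp n d₁ d₂ r' × Y → ESp n d₁ d₂ r := fun x =>
    Ψ₁ ((1 / q₁ x.1.1, x.1.1), (x.1.2, π₁ x.2))
  have Θan : AnalyticAt ℂ Θ (J 0, 0) := by
    refine AnalyticAt.comp (g := Ψ₁) (f := fun x : ESp n d₁ d₂ r' × Y =>
      ((1 / q₁ x.1.1, x.1.1), (x.1.2, π₁ x.2))) ?_ ?_
    · have : ((1 / q₁ (J 0).1, (J 0).1), ((J 0).2, π₁ (0 : Y))) =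
        ((1 / q₁ (J 0).1, (J 0).1), (0 : (JetSp r' n (d₁ + d₂) × Cn n) × Y₁)) := by
        rw [J0, map_zero]; rfl
      show AnalyticAt ℂ Ψ₁ ((1 / q₁ (J 0).1, (J 0).1), ((J 0).2, π₁ (0 : Y)))
      rw [this]
      exact hΨ₁.analyticAt _
    · have f1 : AnalyticAt ℂ (fun x : ESp n d₁ d₂ r' × Y => x.1.1) (J 0, 0) :=
        analyticAt_fst.comp analyticAt_fst
      have f2 : AnalyticAt ℂ (fun x : ESp n d₁ d₂ r' × Y => x.1.2) (J 0, 0) :=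
        analyticAt_snd.comp analyticAt_fst
      refine ((analyticAt_const.div ((hq₁.analyticAt _).comp f1) ?_).prod f1).prod
        (f2.prod ((π₁.analyticAt _).comp analyticAt_snd))
      show q₁ (J 0).1 ≠ 0
      rw [J0]; exact hq₁0
  have tJ : Tendsto J (𝓝[S] 0) (𝓝 (J 0)) := Jan.continuousAt.tendsto.mono_left nhdsWithin_le_nhds
  have tid : Tendsto (fun y : Y => y) (𝓝[S] 0) (𝓝 0) := nhdsWithin_le_nhds
  have ta : Tendsto a (𝓝[S] 0) (𝓝 (J 0)) := by
    have : Tendsto (fun y : Y => ‖y‖ ^ (k i - r'')) (𝓝[S] 0) (𝓝 0) := by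
      have := (tid.norm.pow (k i - r''))
      rwa [norm_zero, zero_pow (Nat.sub_pos_of_lt hi).ne'] at this
    have := tJ.sub (E₂.trans_tendsto this)
    simpa using this
  have E₃ : (fun y => Θ (J y, y) - Θ (a y, y)) =O[𝓝[S] 0] fun y => ‖y‖ ^ (k i - r'') := by
    refine (Θan.isBigO_comp_sub (tJ.prodMk_nhds tid) (ta.prodMk_nhds tid)).trans ?_
    have hz : (fun y : Y => y - y) =O[𝓝[S] 0] fun y => ‖y‖ ^ (k i - r'') := by
      simp only [sub_self]; exact isBigO_zero _ _
    exact (IsBigO.prod_left E₂ hz).congr_left fun y => rfl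
  have E₁ : (fun y => calJ n d₁ d₂ r (A i) (pA₁ (π₁ y)) - Θ (J y, y)) =O[𝓝[S] 0]
      fun y => ‖y‖ ^ (k i - r'') := by
    refine ((hei₁.comp_tendsto t₁).congr_left fun y => ?_).trans
      ((isBigO_clm_pow π₁ _ _).trans (isBigO_norm_pow_of_le nhdsWithin_le_nhds
        (isBigO_refl _ _) (Nat.sub_le_sub_left hr _)))
    simp only [Function.comp, Θ, J, ← hπ]
    rfl
  refine (E₁.add E₃).congr' ?_ EventuallyEq.rfl
  filter_upwards [nhdsWithin_le_nhds ne₂, nhdsWithin_le_nhds neP] with y y₂ yP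
  have key : g (jetPt (fun Λ => q₂ Λ * P Λ) (C i) (pC₂ (π₂ y)) y) =
      ((1 / q₁ (a y).1, (a y).1), ((a y).2, π₁ y)) := by
    set Λ := jetFull _ r'' (C i) (pC₂ (π₂ y)) with hΛ
    have e1 : 1 / (q₂ Λ * P Λ) * P Λ = 1 / q₂ Λ := by field_simp
    have hh : h (jetPt (fun Λ => q₂ Λ * P Λ) (C i) (pC₂ (π₂ y)) y) =
        jetPt q₂ (C i) (pC₂ (π₂ y)) (π₂ y) := by
      simp only [h, jetPt, ← hΛ, e1]
    have hp' : p (1 / q₂ Λ, Λ) ≠ 0 := by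
      intro h0
      rw [hPp _ y₂, h0, mul_zero] at yP
      exact yP rfl
    have hθ : θ (jetPt (fun Λ => q₂ Λ * P Λ) (C i) (pC₂ (π₂ y)) y) = 1 / p (1 / q₂ Λ, Λ) := by
      simp only [θ, jetPt, ← hΛ, hPp _ y₂]
      generalize p (1 / q₂ Λ, Λ) = x at hp'
      rw [pow_succ]
      field_simp
    have hee : e (jetPt (fun Λ => q₂ Λ * P Λ) (C i) (pC₂ (π₂ y)) y) =
        q₁ (a y).1 - p (1 / q₂ Λ, Λ) := by
      simp only [e, hh]
      simp only [jetPt, ← hΛ, e1]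
      rfl
    have hf : f (jetPt (fun Λ => q₂ Λ * P Λ) (C i) (pC₂ (π₂ y)) y) = 1 / q₁ (a y).1 := by
      simp only [f, hθ, hee]
      generalize p (1 / q₂ Λ, Λ) = x at hp'
      have : 1 + 1 / x * (q₁ (a y).1 - x) = q₁ (a y).1 / x := by field_simp; ring
      rw [this, div_div_div_cancel_right₀ hp']
    simp only [g, hf, hh]
    rfl
  simp only [ContinuousLinearMap.comp_apply, key, Θ]
  abel

end Steps

section Chains

variable {n d₁ d₂ l : ℕ} {I : Type*} {k : I → ℕ} {δ δ' : I → ℂ}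

theorem HalfData.jetStep {T T2 : Cn n × Cn (n + (d₁ + d₂)) → Cn (d₁ + d₂)}
    {ζm : XSp n d₁ d₂ → Cn (n + (d₁ + d₂))} (hζ : ZetaGood ζm) (hT : HalfData T T2 l)
    {A B : I → Cn (n + (d₁ + d₂)) → Cn (n + (d₁ + d₂))}
    (hadm : ∀ i, Adm ζm T T2 (A i) (B i) (k i)) {a b : ℕ}
    (hdet : ∀ i, detFz n d₁ d₂ (B i) 0 = δ i ^ a * δ' i ^ b)
    {Y : Type*} [NormedAddCommGroup Y] [NormedSpace ℂ Y] [FiniteDimensional ℂ Y] {S : Set Y}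
    {pA pB : Y →L[ℂ] Cn (n + (d₁ + d₂))} (pz : Y →L[ℂ] Cn n)
    (hS : ∀ᶠ y in 𝓝[S] 0, pB y = ζm (pA y, pz y)) (r : ℕ) :
    JetStep k δ δ' A B S pA pB r (l + r) := by
  obtain ⟨Ψ, hΨ, hz, hzz, he⟩ := hT.exists_half hζ r
  let g : VZero n d₁ d₂ (l + r) × ((JetSp (l + r) n (d₁ + d₂) × Cn n) × Y) →
      PSp n d₁ d₂ (l + r) := fun w => (w.1, (w.2.1, (pA w.2.2, pz w.2.2)))
  have mg : MemRingMap (VZero n d₁ d₂ (l + r)) ((JetSp (l + r) n (d₁ + d₂) × Cn n) × Y) _ g := by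
    refine memRingMap_of_isLinearMap ⟨fun x y => ?_, fun c x => ?_⟩
    · simp only [g, Prod.fst_add, Prod.snd_add, map_add]; rfl
    · simp only [g, Prod.smul_fst, Prod.smul_snd, map_smul]; rfl
  have hg0 : ∀ x0, g (x0, 0) = (x0, 0) := fun x0 => by
    simp only [g, Prod.fst_zero, Prod.snd_zero, map_zero]; rfl
  refine ⟨qdet (l + r), a, b, fun w => Ψ (g w), isPolyFun_qdet _,
    hΨ.comp mg fun x0 => by rw [hg0], fun x0 => ?_, fun h0 x0 => ?_, fun i hi => ⟨?_, ?_⟩⟩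
  · show (Ψ (g (x0, 0))).2 = 0
    rw [hg0, hz]
  · show Ψ (g (x0, 0)) = 0
    rw [hg0, hzz h0]
  · rw [hT.qdet_eq (hadm i).anB, hdet]
  · have h1 := ((he _ _ _ hi (hadm i)).2.comp_tendsto
      ((pA.prod pz).continuous.tendsto' 0 0 (map_zero _))).mono
        (nhdsWithin_le_nhds (s := S))
    have h2 := h1.trans (isBigO_clm_pow (pA.prod pz) _ _)
    rw [Nat.sub_sub] at h2
    refine h2.congr' ?_ EventuallyEq.rfl
    filter_upwards [hS] with y hy
    simp only [Function.comp, g, jetPt, pt, ContinuousLinearMap.prod_apply, ← hy]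

/-- The data entering the iterated identity: the two half steps and the maps to which they
apply. -/
structure ChainData (Q : Cn n → Cn n → Cn d₁ → Cn d₂ → Cn d₁)
    (l : ℕ) (k : I → ℕ) (A B : I → Cn (n + (d₁ + d₂)) → Cn (n + (d₁ + d₂))) : Prop where
  rel_zero : cxRel n d₁ d₂ Q 0 0
  exists_data : ∃ (ζ₁ ζ₂ : XSp n d₁ d₂ → Cn (n + (d₁ + d₂)))
    (T₁ T₂ : Cn n × Cn (n + (d₁ + d₂)) → Cn (d₁ + d₂)),
    ZetaGood ζ₁ ∧ ZetaGood ζ₂ ∧ HalfData T₁ T₂ l ∧ HalfData T₂ T₁ l ∧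
    (∀ᶠ p : Cn (n + (d₁ + d₂)) × Cn (n + (d₁ + d₂)) in 𝓝 0, cxRel n d₁ d₂ Q p.1 p.2 →
      p.2 = ζ₁ (p.1, zPart n d₁ d₂ p.2) ∧ p.1 = ζ₂ (p.2, zPart n d₁ d₂ p.1)) ∧
    ∀ i, Adm ζ₁ T₁ T₂ (A i) (B i) (k i) ∧ Adm ζ₂ T₂ T₁ (B i) (A i) (k i)
  lt : ∀ i, l < k i
  det_conj : ∀ i, detFz n d₁ d₂ (B i) 0 = (starRingEnd ℂ) (detFz n d₁ d₂ (A i) 0)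

variable {Q : Cn n → Cn n → Cn d₁ → Cn d₂ → Cn d₁}
  {A B : I → Cn (n + (d₁ + d₂)) → Cn (n + (d₁ + d₂))}

theorem ChainData.flat (h : ChainData Q l k A B) : FlatFamily k A ∧ FlatFamily k B := by
  obtain ⟨ζ₁, ζ₂, T₁, T₂, g₁, g₂, H₁, H₂, -, hadm⟩ := h.exists_data
  exact ⟨⟨fun i => (hadm i).1.anA, fun i => (hadm i).1.A0,
    fun i m hm => (hadm i).2.jetZG_eq_zero g₂ H₂ hm⟩,
    ⟨fun i => (hadm i).1.anB, fun i => (hadm i).1.B0,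
    fun i m hm => (hadm i).1.jetZG_eq_zero g₁ H₁ hm⟩⟩

theorem ChainData.det_ne_zero (h : ChainData Q l k A B) (i : I) :
    detFz n d₁ d₂ (A i) 0 ≠ 0 := by
  obtain ⟨ζ₁, ζ₂, T₁, T₂, g₁, g₂, H₁, H₂, -, hadm⟩ := h.exists_data
  have := ((hadm i).2.good g₂ H₂ (r := 0) (h.lt i)).2.2.2
  rwa [H₂.qdet_eq (hadm i).2.anB] at this

/-- The projection of `ℂ^n × ℂ^d` to its first factor, as a continuous linear map. -/
def zPartL (n d₁ d₂ : ℕ) : Cn (n + (d₁ + d₂)) →L[ℂ] Cn n :=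
  LinearMap.toContinuousLinearMap
    (IsLinearMap.mk' (zPart n d₁ d₂) ⟨fun _ _ => rfl, fun _ _ => rfl⟩)

/-- The space containing the iterated complexification `𝓜^{2s}`. -/
abbrev ChainSp (n d₁ d₂ s : ℕ) : Type :=
  Cn (n + (d₁ + d₂)) × (Fin s → Cn (n + (d₁ + d₂)) × Cn (n + (d₁ + d₂)))

/-- The last point `Z^s` of a chain. -/
def chainLast (n d₁ d₂ t : ℕ) : ChainSp n d₁ d₂ (t + 1) →L[ℂ] Cn (n + (d₁ + d₂)) :=
  ContinuousLinearMap.snd ℂ _ _ ∘L ContinuousLinearMap.proj (Fin.last t) ∘L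
    ContinuousLinearMap.snd ℂ _ _

theorem ChainData.jetStep_one (h : ChainData Q l k A B) (r : ℕ) :
    JetStep k (fun i => detFz n d₁ d₂ (A i) 0)
      (fun i => (starRingEnd ℂ) (detFz n d₁ d₂ (A i) 0)) A A
      {P : ChainSp n d₁ d₂ 1 | McxChain n d₁ d₂ 1 Q P}
      (ContinuousLinearMap.fst ℂ _ _) (chainLast n d₁ d₂ 0) r (l + (l + r)) := by
  have hflat := h.flat
  have hne := h.det_ne_zero
  obtain ⟨ζ₁, ζ₂, T₁, T₂, g₁, g₂, H₁, H₂, hrel, hadm⟩ := h.exists_data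
  let Y := Cn (n + (d₁ + d₂)) × Cn (n + (d₁ + d₂))
  let δ := fun i => detFz n d₁ d₂ (A i) 0
  let δ' := fun i => (starRingEnd ℂ) (detFz n d₁ d₂ (A i) 0)
  have h₁ : JetStep k δ δ' A B {y : Y | cxRel n d₁ d₂ Q y.1 y.2}
      (ContinuousLinearMap.fst ℂ _ _) (ContinuousLinearMap.snd ℂ _ _) r (l + r) := by
    refine H₁.jetStep g₁ (fun i => (hadm i).1) (a := 0) (b := 1)
      (fun i => by rw [h.det_conj]; simp [δ']) (zPartL n d₁ d₂ ∘L ContinuousLinearMap.snd ℂ _ _)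
      ?_ r
    filter_upwards [nhdsWithin_le_nhds hrel, self_mem_nhdsWithin] with y hy hyS
    exact (hy hyS).1
  have h₂ : JetStep k δ δ' B A {y : Y | cxRel n d₁ d₂ Q y.2 y.1}
      (ContinuousLinearMap.fst ℂ _ _) (ContinuousLinearMap.snd ℂ _ _) (l + r) (l + (l + r)) := by
    refine H₂.jetStep g₂ (fun i => (hadm i).2) (a := 1) (b := 0)
      (fun i => by simp [δ]) (zPartL n d₁ d₂ ∘L ContinuousLinearMap.snd ℂ _ _)
      ?_ (l + r)
    have hrel' := (continuous_swap (X := Cn (n + (d₁ + d₂))) (Y := Cn (n + (d₁ + d₂)))).tendsto' 0 0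
      rfl |>.eventually hrel
    filter_upwards [nhdsWithin_le_nhds hrel', self_mem_nhdsWithin] with y hy hyS
    exact (hy hyS).2
  let ev : ChainSp n d₁ d₂ 1 →L[ℂ] Y :=
    ContinuousLinearMap.proj (0 : Fin 1) ∘L ContinuousLinearMap.snd ℂ _ _
  exact h₁.comp hflat.2 hflat.1 hne (fun i => (map_ne_zero _).2 (hne i)) h₂ (by omega)
    ((ContinuousLinearMap.fst ℂ _ _).prod (ContinuousLinearMap.fst ℂ _ _ ∘L ev)) ev
    (fun P hP => hP.1 one_pos) (fun P hP => hP.2.1 0) (fun P => rfl)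
    ⟨fun _ => h.rel_zero, fun _ => h.rel_zero, fun _ _ => h.rel_zero⟩

theorem ChainData.jetStep (h : ChainData Q l k A B) (r t : ℕ) :
    JetStep k (fun i => detFz n d₁ d₂ (A i) 0)
      (fun i => (starRingEnd ℂ) (detFz n d₁ d₂ (A i) 0)) A A
      {P : ChainSp n d₁ d₂ (t + 1) | McxChain n d₁ d₂ (t + 1) Q P}
      (ContinuousLinearMap.fst ℂ _ _) (chainLast n d₁ d₂ t) r (r + 2 * (t + 1) * l) := by
  induction t with
  | zero =>
    have := h.jetStep_one r
    rwa [show l + (l + r) = r + 2 * (0 + 1) * l by ring] at this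
  | succ t ih =>
    have h₂ := h.jetStep_one (r + 2 * (t + 1) * l)
    rw [show l + (l + (r + 2 * (t + 1) * l)) = r + 2 * (t + 1 + 1) * l by ring] at h₂
    have hne := h.det_ne_zero
    let ev (i : Fin (t + 2)) : ChainSp n d₁ d₂ (t + 2) →L[ℂ]
        Cn (n + (d₁ + d₂)) × Cn (n + (d₁ + d₂)) :=
      ContinuousLinearMap.proj i ∘L ContinuousLinearMap.snd ℂ _ _
    exact ih.comp h.flat.1 h.flat.1 hne (fun i => (map_ne_zero _).2 (hne i)) h₂
      (by gcongr; omega)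
      ((ContinuousLinearMap.fst ℂ _ _).prod (ContinuousLinearMap.pi fun i => ev i.castSucc))
      ((ContinuousLinearMap.snd ℂ _ _ ∘L ev (Fin.last t).castSucc).prod
        (ContinuousLinearMap.pi fun _ => ev (Fin.last (t + 1))))
      (fun P hP => ⟨fun _ => hP.1 (Nat.succ_pos _), fun i => hP.2.1 i.castSucc,
        fun i hi => hP.2.2 i.castSucc (hi.trans (Nat.lt_succ_self _))⟩)
      (fun P hP => ⟨fun _ => hP.2.2 (Fin.last t).castSucc (Nat.lt_succ_self _),
        fun i => hP.2.1 (Fin.last (t + 1)), fun i hi => absurd hi (by omega)⟩) (fun P => rfl)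
      ⟨fun _ => h.rel_zero, fun _ => h.rel_zero, fun _ _ => h.rel_zero⟩

end Chains

section Identity

variable {n d₁ d₂ l : ℕ} {I : Type*} {k : I → ℕ}
  {Q : Cn n → Cn n → Cn d₁ → Cn d₂ → Cn d₁}
  {A B : I → Cn (n + (d₁ + d₂)) → Cn (n + (d₁ + d₂))}

theorem ChainData.exists_identity (h : ChainData Q l k A B) (r t : ℕ) :
    ∃ (q : JetSp (r + 2 * (t + 1) * l) (n + (d₁ + d₂)) (n + (d₁ + d₂)) → ℂ) (a b : ℕ)
      (Ψ : VZero n d₁ d₂ (r + 2 * (t + 1) * l) ×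
        ((JetSp (r + 2 * (t + 1) * l) n (d₁ + d₂) × Cn n) × ChainSp n d₁ d₂ (t + 1)) →
          ESp n d₁ d₂ r),
      IsPolyFun q ∧ MemRingMap _ _ _ Ψ ∧ (∀ x0, (Ψ (x0, 0)).2 = 0) ∧
      (r = 0 → ∀ x0, Ψ (x0, 0) = 0) ∧
      ∀ i, r + 2 * (t + 1) * l < k i →
        q (jetFull _ _ (A i) 0) =
          detFz n d₁ d₂ (A i) 0 ^ a * (starRingEnd ℂ) (detFz n d₁ d₂ (A i) 0) ^ b ∧
        ∃ R : ChainSp n d₁ d₂ (t + 1) → ESp n d₁ d₂ r, AnalyticAt ℂ R 0 ∧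
          (∀ P, calJ n d₁ d₂ r (A i) P.1 =
            Ψ (jetPt q (A i) (P.2 (Fin.last t)).2 P) + R P) ∧
          ∃ C ε : ℝ, 0 < ε ∧ ∀ P, McxChain n d₁ d₂ (t + 1) Q P → ‖P‖ < ε →
            ‖R P‖ ≤ C * ‖P‖ ^ (k i - r - 2 * (t + 1) * l) := by
  obtain ⟨q, a, b, Ψ, hq, hΨ, hz, hzz, he⟩ := h.jetStep r t
  refine ⟨q, a, b, Ψ, hq, hΨ, hz, hzz, fun i hi => ⟨(he i hi).1, fun P =>
    calJ n d₁ d₂ r (A i) P.1 - Ψ (jetPt q (A i) (P.2 (Fin.last t)).2 P), ?_, fun P => ?_, ?_⟩⟩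
  · have hq0 : q (jetFull _ _ (A i) 0) ≠ 0 := by
      rw [(he i hi).1]
      exact mul_ne_zero (pow_ne_zero _ (h.det_ne_zero i))
        (pow_ne_zero _ ((map_ne_zero _).2 (h.det_ne_zero i)))
    have hp := h.flat.1.analyticAt_jetPt hq hq0 (chainLast n d₁ d₂ t)
    refine AnalyticAt.sub ?_ (AnalyticAt.comp (g := Ψ) ?_ hp)
    · exact AnalyticAt.comp (g := calJ n d₁ d₂ r (A i)) (f := Prod.fst)
        (analyticAt_calJ (h.flat.1.analyticAt i)) analyticAt_fst
    · have := h.flat.1.jetPt_zero (Y := ChainSp n d₁ d₂ (t + 1)) hi q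
      show AnalyticAt ℂ Ψ (jetPt q (A i) 0 0)
      rw [this]
      exact hΨ.analyticAt _
  · exact (add_sub_cancel _ _).symm
  · obtain ⟨C, hC⟩ := (he i hi).2.bound
    rw [eventually_nhdsWithin_iff, Metric.eventually_nhds_iff] at hC
    obtain ⟨ε, hε, hC⟩ := hC
    refine ⟨C, ε, hε, fun P hP hPε => ?_⟩
    have := hC (by simpa using hPε) hP
    rw [norm_pow, norm_norm, ← Nat.sub_sub] at this
    exact this

end Identity

section Conjugation

variable {E F : Type*} [NormedAddCommGroup E] [NormedSpace ℂ E] [StarAddMonoid E]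
  [NormedStarGroup E] [StarModule ℂ E] [NormedAddCommGroup F] [NormedSpace ℂ F]
  [StarAddMonoid F] [NormedStarGroup F] [StarModule ℂ F]

/-- The function whose power series coefficients are conjugate to those of `f`. -/
def cj {E F : Type*} [Star E] [Star F] (f : E → F) (x : E) : F := star (f (star x))

theorem cj_cj {E F : Type*} [InvolutiveStar E] [InvolutiveStar F] (f : E → F) :
    cj (cj f) = f := by
  funext x
  simp [cj]

/-- The conjugate of a continuous multilinear map. -/
def cjMultilinear {m : ℕ} (p : E [×m]→L[ℂ] F) : E [×m]→L[ℂ] F where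
  toFun v := star (p fun i => star (v i))
  map_update_add' v i x y := by
    have h : ∀ z, (fun j => star (Function.update v i z j)) =
        Function.update (fun j => star (v j)) i (star z) := fun z => by
      funext j
      by_cases hj : j = i
      · subst hj; simp
      · simp [hj]
    classical
    convert_to star (p fun j => star (Function.update v i (x + y) j)) =
      star (p fun j => star (Function.update v i x j)) +
      star (p fun j => star (Function.update v i y j))
    rw [h, h, h, star_add, p.map_update_add, star_add]
  map_update_smul' v i c x := by
    have h : ∀ z, (fun j => star (Function.update v i z j)) =
        Function.update (fun j => star (v j)) i (star z) := fun z => by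
      funext j
      by_cases hj : j = i
      · subst hj; simp
      · simp [hj]
    classical
    convert_to star (p fun j => star (Function.update v i (c • x) j)) =
      c • star (p fun j => star (Function.update v i x j))
    rw [h, h, star_smul, p.map_update_smul, star_smul, star_star]
  cont := by
    show Continuous fun v : Fin m → E => star (p fun i => star (v i))
    fun_prop

theorem norm_cjMultilinear_le {m : ℕ} (p : E [×m]→L[ℂ] F) : ‖cjMultilinear p‖ ≤ ‖p‖ := by
  refine ContinuousMultilinearMap.opNorm_le_bound (norm_nonneg _) fun v => ?_
  show ‖star (p fun i => star (v i))‖ ≤ _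
  rw [norm_star]
  simpa using p.le_opNorm fun i => star (v i)

theorem analyticAt_cj {f : E → F} {x : E} (hf : AnalyticAt ℂ f (star x)) :
    AnalyticAt ℂ (cj f) x := by
  obtain ⟨p, r, hp⟩ := hf
  refine ⟨fun m => cjMultilinear (p m), r, ?_, hp.r_pos, fun {y} hy => ?_⟩
  · exact hp.r_le.trans (FormalMultilinearSeries.radius_le_of_le fun m =>
      norm_cjMultilinear_le (p m))
  · have := (hp.hasSum (y := star y) (by
      simpa [edist_zero_right, enorm, nnnorm_star] using hy)).star
    rw [← star_add] at this
    exact this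

theorem fderiv_cj (f : E → F) (x v : E) :
    fderiv ℂ (cj f) x v = star (fderiv ℂ f (star x) (star v)) := by
  have key : ∀ {f : E → F} {x : E}, DifferentiableAt ℂ f (star x) →
      HasFDerivAt (_root_.cj f) _ x := fun {f x} h => by
    have := h.hasFDerivAt.star_star
    rw [star_star] at this
    exact this
  by_cases h : DifferentiableAt ℂ f (star x)
  · rw [(key h).fderiv]
    rfl
  · rw [fderiv_zero_of_not_differentiableAt h, fderiv_zero_of_not_differentiableAt]
    · simp
    · intro h'
      rw [← star_star x] at h'
      have := (key h').differentiableAt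
      rw [cj_cj] at this
      exact h this

omit [NormedSpace ℂ E] [StarModule ℂ E] in
theorem eventually_star {P : E → Prop} (h : ∀ᶠ x in 𝓝 0, P x) : ∀ᶠ x in 𝓝 0, P (star x) := by
  have : Tendsto (star : E → E) (𝓝 0) (𝓝 0) := by
    simpa using (continuous_star (R := E)).tendsto 0
  exact this.eventually h

omit [NormedSpace ℂ E] [StarModule ℂ E] [NormedSpace ℂ F] [StarModule ℂ F] in
theorem isBigO_cj {f : E → F} {k : ℕ} (h : f =O[𝓝 0] fun x => ‖x‖ ^ k) :
    cj f =O[𝓝 0] fun x => ‖x‖ ^ k := by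
  obtain ⟨C, hC⟩ := h.bound
  refine .of_bound C ?_
  filter_upwards [eventually_star hC] with x hx
  simpa [cj] using hx

omit [NormedStarGroup E] in
theorem span_star_eq_top {S T : Set E} (h : Submodule.span ℂ S = ⊤)
    (hST : ∀ v ∈ S, star v ∈ T) : Submodule.span ℂ T = ⊤ := by
  rw [eq_top_iff]
  rintro v -
  have hv : star v ∈ Submodule.span ℂ S := by rw [h]; trivial
  suffices ∀ w ∈ Submodule.span ℂ S, star w ∈ Submodule.span ℂ T by simpa using this _ hv
  intro w hw
  induction hw using Submodule.span_induction with
  | mem x hx => exact Submodule.subset_span (hST x hx)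
  | zero => simp
  | add x y _ _ hx hy => rw [star_add]; exact add_mem hx hy
  | smul c x _ hx => rw [star_smul]; exact Submodule.smul_mem _ _ hx

end Conjugation

section ConjugateData

variable {n d₁ d₂ l k : ℕ} {ζm : XSp n d₁ d₂ → Cn (n + (d₁ + d₂))}
  {T T2 : Cn n × Cn (n + (d₁ + d₂)) → Cn (d₁ + d₂)}
  {A B : Cn (n + (d₁ + d₂)) → Cn (n + (d₁ + d₂))}

theorem star_single {a : ℕ} (i : Fin a) : star (Pi.single i (1 : ℂ) : Cn a) = Pi.single i 1 := by
  funext j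
  by_cases h : j = i
  · subst h; simp
  · simp [h]

theorem star_append {a b : ℕ} (v : Cn a) (w : Cn b) :
    star (Fin.append v w) = Fin.append (star v) (star w) := by
  funext j
  refine Fin.addCases (fun i => ?_) (fun i => ?_) j <;> simp

theorem analyticAt_cj_zero {a b c : ℕ} {f : Cn a × Cn b → Cn c} (hf : AnalyticAt ℂ f 0) :
    AnalyticAt ℂ (cj f) 0 :=
  analyticAt_cj (by rwa [star_zero])

theorem ZetaGood.cj (h : ZetaGood ζm) : ZetaGood (cj ζm) where
  analyticAt := analyticAt_cj_zero h.analyticAt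
  left := by
    filter_upwards [eventually_star h.left] with χ hχ
    show star (ζm (star 0, star χ)) = _
    rw [star_zero, hχ, star_append, star_star, star_zero]
  right := by
    filter_upwards [eventually_star h.right] with Z hZ
    show star (ζm (star Z, star 0)) = _
    rw [star_zero, hZ, star_append, star_zero]
    congr 1
    funext j
    exact star_star _

theorem TD_cj (T : Cn n × Cn (n + (d₁ + d₂)) → Cn (d₁ + d₂)) (β : List (Fin n)) :
    TD (cj T) β = cj (TD T β) := by
  induction β with
  | nil => rfl
  | cons i β ih =>
    funext p
    show fderiv ℂ (TD (_root_.cj T) β) p (Pi.single i 1, 0) =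
      star (fderiv ℂ (TD T β) (star p) (Pi.single i 1, 0))
    rw [ih, fderiv_cj, show star ((Pi.single i 1, 0) : Cn n × Cn (n + (d₁ + d₂))) =
      (star (Pi.single i 1), star 0) from rfl, star_single, star_zero]

theorem HalfData.cj (h : HalfData T T2 l) : HalfData (cj T) (cj T2) l where
  analyticAt := analyticAt_cj_zero h.analyticAt
  left := by
    filter_upwards [eventually_star h.left] with Z hZ
    show star (T (star 0, star Z)) = _
    rw [star_zero, hZ]
    funext j
    exact star_star _
  right := by
    filter_upwards [eventually_star h.right] with p hp
    show star (T (star p.1, star (Fin.append 0 p.2))) = _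
    rw [star_append, star_zero]
    exact (congrArg star hp).trans (star_star _)
  analyticAt₂ := analyticAt_cj_zero h.analyticAt₂
  right₂ := by
    filter_upwards [eventually_star h.right₂] with z hz
    show star (T2 (star z, star 0)) = 0
    rw [star_zero, hz, star_zero]
  nondeg := by
    refine span_star_eq_top h.nondeg ?_
    rintro v ⟨j, β, hβ, hl, rfl⟩
    refine ⟨j, β, hβ, hl, ?_⟩
    funext i
    rw [TD_cj, fderiv_cj, star_zero, show star ((0, Pi.single (zIdx n d₁ d₂ i) 1) :
      Cn n × Cn (n + (d₁ + d₂))) = (star 0, star (Pi.single (zIdx n d₁ d₂ i) 1)) from rfl,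
      star_single, star_zero]
    rfl

theorem Gpart_cj (Z : Cn (n + (d₁ + d₂))) :
    Gpart n d₁ d₂ (cj B) Z = star (Gpart n d₁ d₂ B (star Z)) := rfl

theorem Fpart_cj (Z : Cn (n + (d₁ + d₂))) :
    Fpart n d₁ d₂ (cj B) Z = star (Fpart n d₁ d₂ B (star Z)) := rfl

theorem cj_prod {b c : ℕ} (T : Cn n × Cn b → Cn c) (z : Cn n) (w : Cn b) :
    cj T (z, w) = star (T (star z, star w)) := rfl

theorem Adm.cj (h : Adm ζm T T2 A B k) : Adm (cj ζm) (cj T) (cj T2) (cj A) (cj B) k where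
  anA := analyticAt_cj (by rw [star_zero]; exact h.anA)
  A0 := by
    show star (A (star 0)) = 0
    rw [star_zero, h.A0, star_zero]
  anB := analyticAt_cj (by rw [star_zero]; exact h.anB)
  B0 := by
    show star (B (star 0)) = 0
    rw [star_zero, h.B0, star_zero]
  inj := fun v hv => by
    rw [fderiv_cj, star_zero, star_eq_zero] at hv
    simpa using h.inj _ hv
  eq₁ := by
    refine (isBigO_cj h.eq₁).congr_left fun x => ?_
    rw [Gpart_cj, Fpart_cj, cj_prod T]
    simp only [_root_.cj, star_sub, star_star]
    rfl
  eq₂ := by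
    refine (isBigO_cj h.eq₂).congr_left fun x => ?_
    rw [Gpart_cj, Fpart_cj, cj_prod T2]
    simp only [_root_.cj, star_sub, star_star]
    rfl

theorem detFz_cj (A : Cn (n + (d₁ + d₂)) → Cn (n + (d₁ + d₂))) :
    detFz n d₁ d₂ (cj A) 0 = (starRingEnd ℂ) (detFz n d₁ d₂ A 0) := by
  rw [detFz, detFz, RingHom.map_det]
  congr 1
  ext i i'
  have := fderiv_cj (fun W => A W (zIdx n d₁ d₂ i)) 0 (Pi.single (zIdx n d₁ d₂ i') 1)
  rw [star_single, star_zero] at this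
  exact this

end ConjugateData

section Target

variable {n d₁ d₂ l : ℕ} {Q' : Cn n → Cn n → Cn (d₁ + d₂) → Cn (d₁ + d₂)}
  {M' : Set (Cn (n + (d₁ + d₂)))}

/-- The projection of `ℂ^n × ℂ^d` to its second factor, as a continuous linear map. -/
def wfPartL (n d₁ d₂ : ℕ) : Cn (n + (d₁ + d₂)) →L[ℂ] Cn (d₁ + d₂) :=
  LinearMap.toContinuousLinearMap
    (IsLinearMap.mk' (wfPart n d₁ d₂) ⟨fun _ _ => rfl, fun _ _ => rfl⟩)

/-- The defining function of the target, as a function of `z'` and `(χ',τ')`. -/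
def targetT (Q' : Cn n → Cn n → Cn (d₁ + d₂) → Cn (d₁ + d₂))
    (p : Cn n × Cn (n + (d₁ + d₂))) : Cn (d₁ + d₂) :=
  Q' p.1 (zPart n d₁ d₂ p.2) (wfPart n d₁ d₂ p.2)

/-- The splitting `(z',(χ',τ')) ↦ (z',χ',τ')`. -/
def splitL (n d₁ d₂ : ℕ) : Cn n × Cn (n + (d₁ + d₂)) →L[ℂ] Cn n × Cn n × Cn (d₁ + d₂) :=
  (ContinuousLinearMap.fst ℂ _ _).prod
    ((zPartL n d₁ d₂ ∘L ContinuousLinearMap.snd ℂ _ _).prod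
      (wfPartL n d₁ d₂ ∘L ContinuousLinearMap.snd ℂ _ _))

theorem TD_eq_iterDeriv (T : Cn n × Cn (n + (d₁ + d₂)) → Cn (d₁ + d₂)) (β : List (Fin n)) :
    TD T β = iterDeriv (β.reverse.map fun i => (Pi.single i 1, 0)) T := by
  induction β with
  | nil => rfl
  | cons i β ih => rw [TD, ih, List.reverse_cons, List.map_append, List.map_singleton,
      iterDeriv_concat]

theorem QpDescribes.analyticAt (h : QpDescribes n d₁ d₂ Q' M') :
    AnalyticAt ℂ (fun P : Cn n × Cn n × Cn (d₁ + d₂) => Q' P.1 P.2.1 P.2.2) 0 := by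
  have := (ContinuousLinearEquiv.prodAssoc ℂ (Cn n) (Cn n) (Cn (d₁ + d₂))).symm.toContinuousLinearMap.analyticAt 0
  exact AnalyticAt.comp (g := fun p : (Cn n × Cn n) × Cn (d₁ + d₂) => Q' p.1.1 p.1.2 p.2)
    (by rw [map_zero]; exact h.1) this

theorem nondeg_targetT (h : QpDescribes n d₁ d₂ Q' M') (hnd : QpLNondeg n (d₁ + d₂) l Q') :
    Submodule.span ℂ {v : Cn n | ∃ (j : Fin (d₁ + d₂)) (β : List (Fin n)),
      β ≠ [] ∧ β.length ≤ l ∧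
        v = fun i => fderiv ℂ (TD (targetT Q') β) 0 (0, Pi.single (zIdx n d₁ d₂ i) 1) j} = ⊤ := by
  have hg := h.analyticAt
  rw [eq_top_iff, ← hnd]
  refine Submodule.span_mono ?_
  rintro v ⟨j, β, h1, h2, rfl⟩
  let γ : List (Fin n) := (List.finRange n).flatMap fun i => List.replicate (β i) i
  have hγ : γ.length = ∑ i, β i := by
    simp [γ, List.length_flatMap, Fin.sum_univ_def]
  refine ⟨j, γ.reverse, ?_, by rw [List.length_reverse, hγ]; exact h2, ?_⟩
  · intro h0
    have : γ.length = 0 := by rw [← List.length_reverse, h0]; rfl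
    omega
  funext i
  have e1 : fderiv ℂ (TD (targetT Q') γ.reverse) 0 (0, Pi.single (zIdx n d₁ d₂ i) 1) =
      iterDeriv (γ.map (fun i => ((Pi.single i 1, 0) : Cn n × Cn (n + (d₁ + d₂)))) ++
        [(0, Pi.single (zIdx n d₁ d₂ i) 1)]) (targetT Q') 0 := by
    rw [iterDeriv_concat, TD_eq_iterDeriv, List.reverse_reverse]
  have e2 := (iterDeriv_comp_clm (splitL n d₁ d₂) (γ.map (fun i => ((Pi.single i 1, 0) :
    Cn n × Cn (n + (d₁ + d₂)))) ++ [(0, Pi.single (zIdx n d₁ d₂ i) 1)]) (x := 0)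
    (f := fun P : Cn n × Cn n × Cn (d₁ + d₂) => Q' P.1 P.2.1 P.2.2)
    (by rw [map_zero]; exact hg)).self_of_nhds
  have e3 := (iterDeriv_clm_comp (ContinuousLinearMap.proj (R := ℂ) (φ := fun _ : Fin (d₁ + d₂) => ℂ) j)
    ((((0 : Cn n), Pi.single i (1:ℂ), (0 : Cn (d₁ + d₂))) : Cn n × Cn n × Cn (d₁ + d₂)) ::
        ((List.finRange n).flatMap fun i' => List.replicate (β i')
          (((Pi.single i' (1:ℂ) : Cn n), (0 : Cn n), (0 : Cn (d₁ + d₂))) : Cn n × Cn n × Cn (d₁ + d₂))))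
    hg).self_of_nhds
  rw [e1]
  refine e3.trans ?_
  refine congrFun ?_ j
  refine Eq.trans ?_ e2.symm
  simp only [map_zero]
  rw [← iterDeriv]
  refine (iterDeriv_perm ?_ hg).self_of_nhds
  have hs1 : ∀ i, splitL n d₁ d₂ (Pi.single i 1, 0) = (Pi.single i 1, 0, 0) := fun i => by
    simp [splitL]
  have hs2 : splitL n d₁ d₂ (0, Pi.single (zIdx n d₁ d₂ i) 1) = (0, Pi.single i 1, 0) := by
    simp only [splitL, ContinuousLinearMap.prod_apply, ContinuousLinearMap.comp_apply,
      ContinuousLinearMap.coe_fst', ContinuousLinearMap.coe_snd']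
    refine Prod.ext rfl (Prod.ext ?_ ?_)
    · funext a
      show (Pi.single (zIdx n d₁ d₂ i) 1 : Cn (n + (d₁ + d₂))) (zIdx n d₁ d₂ a) =
        (Pi.single i 1 : Cn n) a
      simp [Pi.single_apply, (zIdx_injective).eq_iff]
    · funext a
      show (Pi.single (zIdx n d₁ d₂ i) 1 : Cn (n + (d₁ + d₂))) (wfIdx n d₁ d₂ a) = 0
      simp [wfIdx_ne_zIdx]
  rw [List.map_append, List.map_map, List.map_singleton, hs2]
  refine List.Perm.trans ?_ (List.perm_append_comm (l₁ := [_]))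
  refine List.Perm.of_eq ?_
  rw [List.singleton_append]
  congr 1
  rw [List.map_flatMap]
  congr 1
  funext i'
  rw [List.map_replicate, Function.comp_apply, hs1]

theorem halfData_targetT (h : QpDescribes n d₁ d₂ Q' M') (hnd : QpLNondeg n (d₁ + d₂) l Q') :
    HalfData (targetT Q') (cj (targetT Q')) l ∧ HalfData (cj (targetT Q')) (targetT Q') l := by
  have hT : AnalyticAt ℂ (targetT Q') 0 :=
    AnalyticAt.comp (g := fun P : Cn n × Cn n × Cn (d₁ + d₂) => Q' P.1 P.2.1 P.2.2)
      (f := splitL n d₁ d₂) (by rw [map_zero]; exact h.analyticAt) ((splitL n d₁ d₂).analyticAt 0)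
  obtain ⟨ε, hε, hn⟩ := h.2.1
  have hz : ∀ᶠ z in 𝓝 (0 : Cn n), targetT Q' (z, 0) = 0 := by
    filter_upwards [Metric.ball_mem_nhds (0 : Cn n) hε] with z hz
    exact (hn z 0 0 (by simpa using hz) (by simpa using hε) (by simpa using hε)).1
  have key : HalfData (targetT Q') (cj (targetT Q')) l := by
    refine ⟨hT, ?_, ?_, analyticAt_cj_zero hT, ?_, nondeg_targetT h hnd⟩
    · have h1 := (zPartL n d₁ d₂).continuous.tendsto 0
      have h2 := (wfPartL n d₁ d₂).continuous.tendsto 0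
      rw [map_zero] at h1 h2
      filter_upwards [h1 (Metric.ball_mem_nhds (0 : Cn n) hε),
        h2 (Metric.ball_mem_nhds (0 : Cn (d₁ + d₂)) hε)] with Z h1 h2
      exact (hn 0 _ _ (by simpa using hε) (mem_ball_zero_iff.1 h1)
        (mem_ball_zero_iff.1 h2)).2
    · filter_upwards [Metric.ball_mem_nhds (0 : Cn n × Cn (d₁ + d₂)) hε] with p hp
      rw [mem_ball_zero_iff, Prod.norm_def, max_lt_iff] at hp
      have := (hn p.1 0 p.2 hp.1 (by simpa using hε) hp.2).1
      have h1 : zPart n d₁ d₂ (Fin.append 0 p.2) = 0 := by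
        funext i
        simp [zPart, zIdx]
      have h2 : wfPart n d₁ d₂ (Fin.append 0 p.2) = p.2 := by
        funext i
        simp [wfPart, wfIdx]
      simp only [targetT, h1, h2, this]
    · filter_upwards [eventually_star hz] with z hz
      rw [cj_prod, star_zero, hz, star_zero]
  exact ⟨key, by simpa only [cj_cj] using key.cj⟩

end Target

section Source

variable {n d₁ d₂ : ℕ} {Q : Cn n → Cn n → Cn d₁ → Cn d₂ → Cn d₁}
  {M : Set (Cn (n + (d₁ + d₂)))}

/-- The solution `Z` of the complexified equations of the source, in terms of `ζ` and `z`. -/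
def zetaQ (Q : Cn n → Cn n → Cn d₁ → Cn d₂ → Cn d₁) (x : XSp n d₁ d₂) : Cn (n + (d₁ + d₂)) :=
  mk3 n d₁ d₂ x.2 (Q x.2 (zPart n d₁ d₂ x.1) (wPart n d₁ d₂ x.1) (uPart n d₁ d₂ x.1))
    (uPart n d₁ d₂ x.1)

theorem wfPart_eq (Z : Cn (n + (d₁ + d₂))) :
    wfPart n d₁ d₂ Z = Fin.append (wPart n d₁ d₂ Z) (uPart n d₁ d₂ Z) := by
  funext j
  refine Fin.addCases (fun i => ?_) (fun i => ?_) j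
  · rw [Fin.append_left]; rfl
  · rw [Fin.append_right]; rfl

theorem mk3_parts (Z : Cn (n + (d₁ + d₂))) :
    mk3 n d₁ d₂ (zPart n d₁ d₂ Z) (wPart n d₁ d₂ Z) (uPart n d₁ d₂ Z) = Z := by
  rw [mk3, ← wfPart_eq]
  funext j
  refine Fin.addCases (fun i => ?_) (fun i => ?_) j
  · rw [Fin.append_left]; rfl
  · rw [Fin.append_right]; rfl

/-- The projection of `ℂ^N` to the factor `ℂ^{d₁}`, as a continuous linear map. -/
def wPartL (n d₁ d₂ : ℕ) : Cn (n + (d₁ + d₂)) →L[ℂ] Cn d₁ :=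
  LinearMap.toContinuousLinearMap
    (IsLinearMap.mk' (wPart n d₁ d₂) ⟨fun _ _ => rfl, fun _ _ => rfl⟩)

/-- The projection of `ℂ^N` to the factor `ℂ^{d₂}`, as a continuous linear map. -/
def uPartL (n d₁ d₂ : ℕ) : Cn (n + (d₁ + d₂)) →L[ℂ] Cn d₂ :=
  LinearMap.toContinuousLinearMap
    (IsLinearMap.mk' (uPart n d₁ d₂) ⟨fun _ _ => rfl, fun _ _ => rfl⟩)

theorem eventually_norm_part_lt {a : ℕ} (L : Cn (n + (d₁ + d₂)) →L[ℂ] Cn a) {ε : ℝ} (hε : 0 < ε) :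
    ∀ᶠ Z in 𝓝 0, ‖L Z‖ < ε := by
  have h1 := L.continuous.tendsto 0
  rw [map_zero] at h1
  filter_upwards [h1 (Metric.ball_mem_nhds _ hε)] with Z h
  exact mem_ball_zero_iff.1 h

theorem analyticAt_append {E : Type*} [NormedAddCommGroup E] [NormedSpace ℂ E] {a b : ℕ}
    {f : E → Cn a} {g : E → Cn b} {x : E} (hf : AnalyticAt ℂ f x) (hg : AnalyticAt ℂ g x) :
    AnalyticAt ℂ (fun y => Fin.append (f y) (g y)) x := by
  rw [analyticAt_pi_iff] at hf hg ⊢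
  intro j
  refine Fin.addCases (fun i => ?_) (fun i => ?_) j
  · simpa only [Fin.append_left] using hf i
  · simpa only [Fin.append_right] using hg i

theorem zetaGood_zetaQ (h : QDescribes n d₁ d₂ Q M) : ZetaGood (zetaQ Q) := by
  obtain ⟨hQ, ⟨ε, hε, hn⟩, -⟩ := h
  refine ⟨?_, ?_, ?_⟩
  · have hu : AnalyticAt ℂ (fun x : XSp n d₁ d₂ => uPart n d₁ d₂ x.1) 0 :=
      (uPartL n d₁ d₂ ∘L ContinuousLinearMap.fst ℂ _ _ : XSp n d₁ d₂ →L[ℂ] Cn d₂).analyticAt 0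
    let L : XSp n d₁ d₂ →L[ℂ] (Cn n × Cn n) × (Cn d₁ × Cn d₂) :=
      ((ContinuousLinearMap.snd ℂ _ _).prod
        (zPartL n d₁ d₂ ∘L ContinuousLinearMap.fst ℂ _ _)).prod
        ((wPartL n d₁ d₂ ∘L ContinuousLinearMap.fst ℂ _ _).prod
          (uPartL n d₁ d₂ ∘L ContinuousLinearMap.fst ℂ _ _))
    have hq : AnalyticAt ℂ (fun x : XSp n d₁ d₂ => Q x.2 (zPart n d₁ d₂ x.1)
        (wPart n d₁ d₂ x.1) (uPart n d₁ d₂ x.1)) 0 :=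
      AnalyticAt.comp (g := fun p : (Cn n × Cn n) × (Cn d₁ × Cn d₂) =>
        Q p.1.1 p.1.2 p.2.1 p.2.2) (f := L) (by rw [map_zero]; exact hQ) (L.analyticAt 0)
    exact analyticAt_append analyticAt_snd (analyticAt_append hq hu)
  · filter_upwards [Metric.ball_mem_nhds (0 : Cn n) hε] with χ hχ
    have h1 := (hn χ 0 0 0 (mem_ball_zero_iff.1 hχ) (by simpa) (by simpa) (by simpa)).1
    show Fin.append χ (Fin.append (Q χ 0 0 0) 0) = _
    rw [h1, append_zero_zero]
  · filter_upwards [eventually_norm_part_lt (zPartL n d₁ d₂) hε,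
      eventually_norm_part_lt (wPartL n d₁ d₂) hε,
      eventually_norm_part_lt (uPartL n d₁ d₂) hε] with Z h1 h2 h3
    have := (hn 0 _ _ _ (by simpa) h1 h2 h3).2
    rw [wfPart_eq]
    exact congrArg (fun w => Fin.append 0 (Fin.append w (uPart n d₁ d₂ Z))) this

theorem eq_zetaQ_of_cxRel {Z ζ : Cn (n + (d₁ + d₂))} (h : cxRel n d₁ d₂ Q Z ζ) :
    Z = zetaQ Q (ζ, zPart n d₁ d₂ Z) := by
  have hu : uPart n d₁ d₂ ζ = uPart n d₁ d₂ Z := funext h.1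
  have hw : wPart n d₁ d₂ Z = _ := funext h.2
  rw [zetaQ, hu, ← hw, mk3_parts]

theorem cxRel_zero (h : QDescribes n d₁ d₂ Q M) : cxRel n d₁ d₂ Q 0 0 := by
  obtain ⟨-, ⟨ε, hε, hn⟩, -⟩ := h
  refine ⟨fun _ => rfl, fun j => ?_⟩
  exact (congrFun (hn 0 0 0 0 (by simpa) (by simpa) (by simpa) (by simpa)).1 j).symm

theorem eventually_zetaQ_real (h : QDescribes n d₁ d₂ Q M) :
    ∀ᶠ Z in 𝓝 (0 : Cn (n + (d₁ + d₂))), Z ∈ M →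
      zetaQ Q (star Z, zPart n d₁ d₂ Z) = Z := by
  obtain ⟨-, -, ε, hε, hM⟩ := h
  filter_upwards [Metric.ball_mem_nhds _ hε] with Z hZ hZM
  obtain ⟨hu, hw⟩ := (hM Z (mem_ball_zero_iff.1 hZ)).1 hZM
  refine (eq_zetaQ_of_cxRel ⟨fun j => ?_, hw⟩).symm
  exact Complex.conj_eq_iff_im.2 (hu j)

/-- `φ` parametrizes, to first order at `0`, a generic submanifold of `ℂ^N`
contained in the totally real set of the complexification given by `ζm`. -/
structure RealParam {X : Type*} [NormedAddCommGroup X] [NormedSpace ℝ X]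
    (ζm : XSp n d₁ d₂ → Cn (n + (d₁ + d₂))) (φ : X → Cn (n + (d₁ + d₂)))
    (L : X →L[ℝ] Cn (n + (d₁ + d₂))) : Prop where
  zero : φ 0 = 0
  hasFDerivAt : HasFDerivAt φ L 0
  injective : Function.Injective L
  finrank : Module.finrank ℝ X = 2 * (n + (d₁ + d₂)) - (d₁ + d₂)
  fix : ∀ᶠ x in 𝓝 0, ζm (star (φ x), zPart n d₁ d₂ (φ x)) = φ x

theorem IsLocalParam.realParam {Ω : Set (Rn (2 * (n + (d₁ + d₂)) - (d₁ + d₂)))}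
    {φ : Rn (2 * (n + (d₁ + d₂)) - (d₁ + d₂)) → Cn (n + (d₁ + d₂))}
    (hφ : IsLocalParam (n + (d₁ + d₂)) (d₁ + d₂) M 0 Ω φ) (h : QDescribes n d₁ d₂ Q M) :
    RealParam (zetaQ Q) φ (fderiv ℝ φ 0) := by
  obtain ⟨hΩ, h0, h1, han, -, hinj, U, -, -, hU⟩ := hφ
  have hd := (han 0 h0).differentiableAt
  refine ⟨h1, hd.hasFDerivAt, hinj 0 h0, by simp, ?_⟩
  have ht : Tendsto φ (𝓝 0) (𝓝 0) := by
    simpa only [h1] using hd.continuousAt.tendsto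
  filter_upwards [ht (eventually_zetaQ_real h), hΩ.mem_nhds h0] with x hx hxΩ
  have : φ x ∈ φ '' Ω := ⟨x, hxΩ, rfl⟩
  rw [hU] at this
  exact hx this.1

end Source

section TotallyReal

variable {n d₁ d₂ : ℕ} {ζm : XSp n d₁ d₂ → Cn (n + (d₁ + d₂))}
  {X : Type*} [NormedAddCommGroup X] [NormedSpace ℝ X] {φ : X → Cn (n + (d₁ + d₂))}
  {L : X →L[ℝ] Cn (n + (d₁ + d₂))}

theorem ZetaGood.wfPart_fderiv (h : ZetaGood ζm) (ζ : Cn (n + (d₁ + d₂))) (z : Cn n) :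
    wfPart n d₁ d₂ (fderiv ℂ ζm 0 (ζ, z)) = wfPart n d₁ d₂ ζ := by
  have hd : HasFDerivAt (fun x => wfPartL n d₁ d₂ (ζm x)) (wfPartL n d₁ d₂ ∘L fderiv ℂ ζm 0) 0 :=
    (wfPartL n d₁ d₂).hasFDerivAt.comp _ h.analyticAt.differentiableAt.hasFDerivAt
  have h1 : HasFDerivAt (fun ζ => wfPartL n d₁ d₂ (ζm (ζ, 0)))
      ((wfPartL n d₁ d₂ ∘L fderiv ℂ ζm 0) ∘L ContinuousLinearMap.inl ℂ _ _) 0 := by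
    exact HasFDerivAt.comp (g := fun x => wfPartL n d₁ d₂ (ζm x)) (0 : Cn (n + (d₁ + d₂))) hd
      (ContinuousLinearMap.inl ℂ (Cn (n + (d₁ + d₂))) (Cn n)).hasFDerivAt
  have h2 : HasFDerivAt (fun z => wfPartL n d₁ d₂ (ζm (0, z)))
      ((wfPartL n d₁ d₂ ∘L fderiv ℂ ζm 0) ∘L ContinuousLinearMap.inr ℂ _ _) 0 := by
    exact HasFDerivAt.comp (g := fun x => wfPartL n d₁ d₂ (ζm x)) (0 : Cn n) hd
      (ContinuousLinearMap.inr ℂ (Cn (n + (d₁ + d₂))) (Cn n)).hasFDerivAt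
  have e1 := h1.unique ((wfPartL n d₁ d₂).hasFDerivAt.congr_of_eventuallyEq
    (h.right.mono fun Z hZ => by
      funext j
      show ζm (Z, 0) (Fin.natAdd n j) = _
      rw [hZ, Fin.append_right]
      rfl))
  have e2 := h2.unique ((hasFDerivAt_const (0 : Cn (d₁ + d₂)) _).congr_of_eventuallyEq
    (h.left.mono fun Z hZ => by
      funext j
      show ζm (0, Z) (Fin.natAdd n j) = _
      rw [hZ, Fin.append_right]))
  have e3 : ((ζ, z) : XSp n d₁ d₂) = (ζ, 0) + (0, z) := by simp
  have e4 : wfPart n d₁ d₂ (fderiv ℂ ζm 0 (ζ, 0)) = wfPart n d₁ d₂ ζ := DFunLike.congr_fun e1 ζ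
  have e5 : wfPart n d₁ d₂ (fderiv ℂ ζm 0 (0, z)) = 0 := DFunLike.congr_fun e2 z
  rw [e3, map_add]
  show wfPart n d₁ d₂ _ + wfPart n d₁ d₂ _ = _
  rw [e4, e5, add_zero]

/-- The totally real embedding of the source into its complexification. -/
def realPt (φ : X → Cn (n + (d₁ + d₂))) (x : X) : XSp n d₁ d₂ :=
  (star (φ x), zPart n d₁ d₂ (φ x))

/-- The differential of `realPt`. -/
def realPtL (L : X →L[ℝ] Cn (n + (d₁ + d₂))) : X →L[ℝ] XSp n d₁ d₂ :=
  (((starL' ℝ : Cn (n + (d₁ + d₂)) ≃L[ℝ] Cn (n + (d₁ + d₂))) :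
    Cn (n + (d₁ + d₂)) →L[ℝ] Cn (n + (d₁ + d₂))) ∘L L).prod
    ((zPartL n d₁ d₂).restrictScalars ℝ ∘L L)

theorem RealParam.hasFDerivAt_realPt (h : RealParam ζm φ L) :
    HasFDerivAt (realPt φ) (realPtL L) 0 :=
  h.hasFDerivAt.star.prodMk
    (((zPartL n d₁ d₂).restrictScalars ℝ).hasFDerivAt.comp _ h.hasFDerivAt)

theorem RealParam.realPt_zero (h : RealParam ζm φ L) : realPt φ 0 = 0 := by
  rw [realPt, h.zero, star_zero]
  rfl

theorem RealParam.wfPart_star (hζ : ZetaGood ζm) (h : RealParam ζm φ L) (v : X) :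
    wfPart n d₁ d₂ (star (L v)) = wfPart n d₁ d₂ (L v) := by
  have h1 : HasFDerivAt ζm (fderiv ℂ ζm 0) (realPt φ 0) := by
    rw [h.realPt_zero]
    exact hζ.analyticAt.differentiableAt.hasFDerivAt
  have h2 := (h1.restrictScalars ℝ).comp (0 : X) h.hasFDerivAt_realPt
  have h3 := h2.unique (h.hasFDerivAt.congr_of_eventuallyEq h.fix)
  have h4 : fderiv ℂ ζm 0 (star (L v), zPart n d₁ d₂ (L v)) = L v := DFunLike.congr_fun h3 v
  rw [← hζ.wfPart_fderiv (star (L v)) (zPart n d₁ d₂ (L v)), h4]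

theorem RealParam.exists_tangent (hζ : ZetaGood ζm) (h : RealParam ζm φ L) (z : Cn n)
    (w : Fin (d₁ + d₂) → ℝ) :
    ∃ v, zPart n d₁ d₂ (L v) = z ∧ wfPart n d₁ d₂ (L v) = fun j => (w j : ℂ) := by
  let P : X →ₗ[ℝ] Cn n × Rn (d₁ + d₂) :=
    { toFun := fun v => (zPart n d₁ d₂ (L v), fun j => (wfPart n d₁ d₂ (L v) j).re)
      map_add' := fun v v' => by
        rw [map_add]
        exact Prod.ext rfl (funext fun j => Complex.add_re _ _)
      map_smul' := fun c v => by
        rw [map_smul]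
        exact Prod.ext rfl (funext fun j => Complex.smul_re _ _) }
  have hre : ∀ v j, (((wfPart n d₁ d₂ (L v) j).re : ℝ) : ℂ) = wfPart n d₁ d₂ (L v) j :=
    fun v j => Complex.conj_eq_iff_re.1 (congrFun (h.wfPart_star hζ v) j)
  have hinj : Function.Injective P := by
    rw [injective_iff_map_eq_zero]
    intro v hv
    refine h.injective ?_
    rw [map_zero]
    have h1 : zPart n d₁ d₂ (L v) = 0 := congrArg Prod.fst hv
    have h2 : (fun j => (wfPart n d₁ d₂ (L v) j).re) = 0 := congrArg Prod.snd hv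
    funext j
    refine Fin.addCases (fun i => congrFun h1 i) (fun i => ?_) j
    have := hre v i
    rw [congrFun h2 i] at this
    exact this.symm
  have hfr : Module.finrank ℝ X = Module.finrank ℝ (Cn n × Rn (d₁ + d₂)) := by
    rw [h.finrank, Module.finrank_prod, Module.finrank_pi_fintype, Module.finrank_fintype_fun_eq_card]
    simp only [Complex.finrank_real_complex, Finset.sum_const, Finset.card_univ, Fintype.card_fin,
      smul_eq_mul]
    omega
  have := Module.Finite.of_injective P hinj
  obtain ⟨v, hv⟩ := (LinearMap.injective_iff_surjective_of_finrank_eq_finrank hfr).1 hinj (z, w)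
  refine ⟨v, congrArg Prod.fst hv, ?_⟩
  funext j
  rw [← hre v j]
  exact congrArg (fun x : ℝ => (x : ℂ)) (congrFun (congrArg Prod.snd hv) j)

theorem RealParam.span (hζ : ZetaGood ζm) (h : RealParam ζm φ L) (y : XSp n d₁ d₂) :
    ∃ a b, y = realPtL L a + I • realPtL L b := by
  obtain ⟨a, ha, ha'⟩ := h.exists_tangent hζ (fun i => (y.2 i + star (zPart n d₁ d₂ y.1 i)) / 2)
    fun j => (wfPart n d₁ d₂ y.1 j).re
  obtain ⟨b, hb, hb'⟩ := h.exists_tangent hζ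
    (fun i => (y.2 i - star (zPart n d₁ d₂ y.1 i)) / (2 * I)) fun j => (wfPart n d₁ d₂ y.1 j).im
  refine ⟨a, b, Prod.ext ?_ ?_⟩
  · show y.1 = star (L a) + I • star (L b)
    funext j
    refine Fin.addCases (fun i => ?_) (fun i => ?_) j
    · have h1 : L a (Fin.castAdd _ i) = _ := congrFun ha i
      have h2 : L b (Fin.castAdd _ i) = _ := congrFun hb i
      have h3 : zPart n d₁ d₂ y.1 i = y.1 (Fin.castAdd _ i) := rfl
      simp only [Pi.add_apply, Pi.star_apply, Pi.smul_apply, h1, h2, h3, smul_eq_mul]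
      simp only [RCLike.star_def, map_div₀, map_add, map_sub, map_mul, Complex.conj_conj,
        Complex.conj_I, map_ofNat]
      field_simp
      ring
    · have h1 : L a (Fin.natAdd _ i) = _ := congrFun ha' i
      have h2 : L b (Fin.natAdd _ i) = _ := congrFun hb' i
      have h3 : wfPart n d₁ d₂ y.1 i = y.1 (Fin.natAdd _ i) := rfl
      simp only [Pi.add_apply, Pi.star_apply, Pi.smul_apply, h1, h2, h3, smul_eq_mul]
      simp only [RCLike.star_def, Complex.conj_ofReal]
      rw [mul_comm, Complex.re_add_im]
  · show y.2 = zPart n d₁ d₂ (L a) + I • zPart n d₁ d₂ (L b)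
    rw [ha, hb]
    funext i
    simp only [Pi.add_apply, Pi.smul_apply, smul_eq_mul]
    field_simp
    ring

end TotallyReal

section Admissible

variable {n d₁ d₂ k : ℕ} {ζm : XSp n d₁ d₂ → Cn (n + (d₁ + d₂))}
  {X : Type*} [NormedAddCommGroup X] [NormedSpace ℝ X] {φ : X → Cn (n + (d₁ + d₂))}
  {L : X →L[ℝ] Cn (n + (d₁ + d₂))}
  {Q : Cn n → Cn n → Cn d₁ → Cn d₂ → Cn d₁}
  {Q' : Cn n → Cn n → Cn (d₁ + d₂) → Cn (d₁ + d₂)}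
  {M M' : Set (Cn (n + (d₁ + d₂)))}

theorem RealParam.isBigO (hζ : ZetaGood ζm) (h : RealParam ζm φ L) {m : ℕ}
    {f : XSp n d₁ d₂ → Cn m} (hf : AnalyticAt ℂ f 0)
    (hO : (fun x => f (realPt φ x)) =O[𝓝 0] fun x => ‖x‖ ^ k) :
    f =O[𝓝 0] fun x => ‖x‖ ^ k := by
  refine isBigO_pi.2 fun i => isBigO_of_totally_real (analyticAt_pi_iff.1 hf i)
    h.hasFDerivAt_realPt h.realPt_zero (h.span hζ) (isBigO_pi.1 hO i)

theorem RealParam.eventually_left_inv (hζ : ZetaGood ζm) (h : RealParam ζm φ L) :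
    ∀ᶠ x : XSp n d₁ d₂ in 𝓝 0, cj ζm (ζm x, zPart n d₁ d₂ x.1) = x.1 := by
  have han : AnalyticAt ℂ (fun x : XSp n d₁ d₂ => cj ζm (ζm x, zPart n d₁ d₂ x.1) - x.1) 0 := by
    refine AnalyticAt.sub ?_ analyticAt_fst
    refine AnalyticAt.comp (g := cj ζm) (f := fun x => (ζm x, zPart n d₁ d₂ x.1)) ?_
      (hζ.analyticAt.prod ?_)
    · rw [hζ.zero]
      exact hζ.cj.analyticAt
    · exact (zPartL n d₁ d₂ ∘L ContinuousLinearMap.fst ℂ _ _ : XSp n d₁ d₂ →L[ℂ] Cn n).analyticAt 0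
  have : ∀ i, ∀ᶠ x : XSp n d₁ d₂ in 𝓝 0,
      (cj ζm (ζm x, zPart n d₁ d₂ x.1) - x.1) i = 0 := fun i =>
    eventually_eq_zero_of_totally_real (analyticAt_pi_iff.1 han i)
      h.hasFDerivAt_realPt h.realPt_zero (h.span hζ) (h.fix.mono fun x hx => by
        rw [realPt, hx, cj_prod]
        refine sub_eq_zero.2 (congrFun (congrArg star (?_ : _ = φ x)) i)
        rw [show star (zPart n d₁ d₂ (star (φ x))) = zPart n d₁ d₂ (φ x) from
          star_star (zPart n d₁ d₂ (φ x)), hx])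
  filter_upwards [eventually_all.2 this] with x hx
  exact sub_eq_zero.1 (funext hx)

/-- The defect of a point of the target from satisfying the equation of `M'`. -/
def defect (Q' : Cn n → Cn n → Cn (d₁ + d₂) → Cn (d₁ + d₂)) (W : Cn (n + (d₁ + d₂))) :
    Cn (d₁ + d₂) :=
  wfPart n d₁ d₂ W - targetT Q' (zPart n d₁ d₂ W, star W)

theorem analyticAt_targetT (h : QpDescribes n d₁ d₂ Q' M') : AnalyticAt ℂ (targetT Q') 0 :=
  AnalyticAt.comp (g := fun P : Cn n × Cn n × Cn (d₁ + d₂) => Q' P.1 P.2.1 P.2.2)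
    (f := splitL n d₁ d₂) (by rw [map_zero]; exact h.analyticAt) ((splitL n d₁ d₂).analyticAt 0)

theorem defect_bound (h : QpDescribes n d₁ d₂ Q' M') {U : Set (Cn (n + (d₁ + d₂)))}
    {ρ : Cn (n + (d₁ + d₂)) → Rn (d₁ + d₂)} (hρ : IsDefiningFun _ _ M' 0 U ρ)
    (h0 : (0 : Cn (n + (d₁ + d₂))) ∈ M') :
    defect Q' =O[𝓝 0] ρ := by
  obtain ⟨hU, h0U, han, hzero, hsurj⟩ := hρ
  have hρ0 : ρ 0 = 0 := (hzero 0 h0U).1 h0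
  have hstrict := (han 0 h0U).hasStrictFDerivAt
  obtain ⟨C, hC⟩ := exists_zero_near hstrict (hsurj 0 h0U) hρ0
  obtain ⟨ε, hε, hM⟩ := h.2.2
  have hg : AnalyticAt ℂ (fun p : Cn (n + (d₁ + d₂)) × Cn (n + (d₁ + d₂)) =>
      wfPart n d₁ d₂ p.1 - targetT Q' (zPart n d₁ d₂ p.1, p.2)) 0 := by
    refine AnalyticAt.sub ?_ ?_
    · exact (wfPartL n d₁ d₂ ∘L ContinuousLinearMap.fst ℂ _ _ :
        Cn (n + (d₁ + d₂)) × Cn (n + (d₁ + d₂)) →L[ℂ] Cn (d₁ + d₂)).analyticAt 0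
    · let L : Cn (n + (d₁ + d₂)) × Cn (n + (d₁ + d₂)) →L[ℂ] Cn n × Cn (n + (d₁ + d₂)) :=
        (zPartL n d₁ d₂ ∘L ContinuousLinearMap.fst ℂ _ _).prod (ContinuousLinearMap.snd ℂ _ _)
      exact AnalyticAt.comp (g := targetT Q') (f := L) (by rw [map_zero]; exact analyticAt_targetT h)
        (L.analyticAt 0)
  obtain ⟨K, s, hs, hK⟩ := hg.hasStrictFDerivAt.exists_lipschitzOnWith
  have hcs : ∀ᶠ y in 𝓝 (0 : Cn (n + (d₁ + d₂))), (y, star y) ∈ s :=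
    ((continuous_id.prodMk continuous_star).tendsto' (0 : Cn (n + (d₁ + d₂))) 0
      (by rw [star_zero]; rfl)) hs
  obtain ⟨δ, hδ, hgood⟩ := Metric.eventually_nhds_iff.1
    ((hcs.and (hU.mem_nhds h0U)).and (Metric.ball_mem_nhds _ hε))
  have hsmall : ∀ᶠ y in 𝓝 (0 : Cn (n + (d₁ + d₂))), ‖y‖ + C * ‖ρ y‖ < δ := by
    have : Tendsto (fun y => ‖y‖ + C * ‖ρ y‖) (𝓝 (0 : Cn (n + (d₁ + d₂)))) (𝓝 0) := by
      have hc : ContinuousAt (fun y => ‖y‖ + C * ‖ρ y‖) (0 : Cn (n + (d₁ + d₂))) := by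
        have := hstrict.continuousAt
        fun_prop
      have := hc.tendsto
      simpa [hρ0] using this
    exact this.eventually_lt_const hδ
  refine .of_bound (K * C) ?_
  filter_upwards [hC, hsmall, Metric.eventually_nhds_iff.2 ⟨δ, hδ, fun y => @hgood y⟩]
    with y hy hyδ hyg
  obtain ⟨z, hz, hyz⟩ := hy
  have hzδ : dist z 0 < δ := by
    rw [dist_zero_right]
    calc ‖z‖ = ‖y - (y - z)‖ := by rw [sub_sub_cancel]
      _ ≤ ‖y‖ + ‖y - z‖ := norm_sub_le _ _
      _ < δ := by linarith
  obtain ⟨⟨hzs, hzU⟩, hzε⟩ := hgood hzδ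
  have hz0 : defect Q' z = 0 := by
    have := (hM z (mem_ball_zero_iff.1 hzε)).1 ((hzero z hzU).2 hz)
    exact sub_eq_zero.2 (funext this)
  have := hK.norm_sub_le hyg.1.1 hzs
  have e : ‖((y, star y) : Cn (n + (d₁ + d₂)) × Cn (n + (d₁ + d₂))) - (z, star z)‖ = ‖y - z‖ := by
    rw [Prod.mk_sub_mk, ← star_sub, Prod.norm_mk, norm_star, max_self]
  rw [e] at this
  calc ‖defect Q' y‖ = ‖defect Q' y - defect Q' z‖ := by rw [hz0, sub_zero]
    _ ≤ K * ‖y - z‖ := this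
    _ ≤ K * (C * ‖ρ y‖) := by gcongr
    _ = K * C * ‖ρ y‖ := by ring

end Admissible

section Equivalence

variable {n d₁ d₂ l k : ℕ}
  {Q : Cn n → Cn n → Cn d₁ → Cn d₂ → Cn d₁}
  {Q' : Cn n → Cn n → Cn (d₁ + d₂) → Cn (d₁ + d₂)}
  {M M' : Set (Cn (n + (d₁ + d₂)))} {H : Cn (n + (d₁ + d₂)) → Cn (n + (d₁ + d₂))}

theorem IsKEquivalence.defect_isBigO (hQ' : QpDescribes n d₁ d₂ Q' M')
    (hM' : IsRASubmanifold (n + (d₁ + d₂)) (d₁ + d₂) M') (h0' : (0 : Cn (n + (d₁ + d₂))) ∈ M')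
    (hH : IsKEquivalence (n + (d₁ + d₂)) (d₁ + d₂) M M' 0 0 k H) :
    ∃ Ω φ, IsLocalParam (n + (d₁ + d₂)) (d₁ + d₂) M 0 Ω φ ∧
      (fun x => defect Q' (H (φ x))) =O[𝓝 0] fun x => ‖x‖ ^ k := by
  obtain ⟨han, hH0, -, Ω, φ, hφ, hρ⟩ := hH
  obtain ⟨U, ρ, hU⟩ := hM' 0 h0'
  obtain ⟨C, ε, hε, hC⟩ := hρ U ρ hU
  refine ⟨Ω, φ, hφ, ?_⟩
  obtain ⟨hΩ, h0Ω, hφ0, hφan, -⟩ := hφ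
  have ht : Tendsto (fun x => H (φ x)) (𝓝 0) (𝓝 0) := by
    have h1 : Tendsto φ (𝓝 0) (𝓝 0) := by
      have := (hφan 0 h0Ω).continuousAt.tendsto
      rwa [hφ0] at this
    have h2 : Tendsto H (𝓝 0) (𝓝 0) := by
      have := han.continuousAt.tendsto
      rwa [hH0] at this
    exact h2.comp h1
  refine ((defect_bound hQ' hU h0').comp_tendsto ht).trans (.of_bound C ?_)
  filter_upwards [Metric.ball_mem_nhds 0 hε] with x hx
  rw [norm_pow, norm_norm]
  exact hC x (mem_ball_zero_iff.1 hx)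

theorem IsKEquivalence.adm (hQ : QDescribes n d₁ d₂ Q M) (hQ' : QpDescribes n d₁ d₂ Q' M')
    (hM' : IsRASubmanifold (n + (d₁ + d₂)) (d₁ + d₂) M') (h0' : (0 : Cn (n + (d₁ + d₂))) ∈ M')
    (hH : IsKEquivalence (n + (d₁ + d₂)) (d₁ + d₂) M M' 0 0 k H) :
    Adm (zetaQ Q) (targetT Q') (cj (targetT Q')) (cj H) H k := by
  obtain ⟨Ω, φ, hφ, hO⟩ := hH.defect_isBigO hQ' hM' h0'
  obtain ⟨han, hH0, hbij, -⟩ := hH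
  have hζ := zetaGood_zetaQ hQ
  have hr := hφ.realParam hQ
  have hT := analyticAt_targetT hQ'
  have hA : AnalyticAt ℂ (cj H) 0 := analyticAt_cj (by rwa [star_zero])
  have hA0 : cj H 0 = 0 := by
    show star (H (star 0)) = 0
    rw [star_zero, hH0, star_zero]
  have hT' : AnalyticAt ℂ (cj (targetT Q')) 0 := analyticAt_cj_zero hT
  have hHζ0 : H (zetaQ Q 0) = 0 := by rw [hζ.zero, hH0]
  have hHζ : AnalyticAt ℂ H (zetaQ Q 0) := by rwa [hζ.zero]
  have hA1 : AnalyticAt ℂ (cj H) (0 : XSp n d₁ d₂).1 := hA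
  have e₁ : ∀ᶠ x in 𝓝 0, Gpart n d₁ d₂ H (zetaQ Q (realPt φ x)) -
      targetT Q' (Fpart n d₁ d₂ H (zetaQ Q (realPt φ x)), cj H (realPt φ x).1) =
        defect Q' (H (φ x)) := by
    filter_upwards [hr.fix] with x hx
    rw [realPt, hx, cj, star_star]
    rfl
  have e₂ : ∀ᶠ x in 𝓝 0, Gpart n d₁ d₂ (cj H) (realPt φ x).1 -
      cj (targetT Q') (Fpart n d₁ d₂ (cj H) (realPt φ x).1, H (zetaQ Q (realPt φ x))) =
        star (defect Q' (H (φ x))) := by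
    filter_upwards [hr.fix] with x hx
    rw [realPt, hx, defect, star_sub, cj_prod, Gpart_cj, Fpart_cj, star_star]
    simp only [star_star]
    rfl
  refine ⟨hA, hA0, han, hH0, fun v hv => hbij.injective (hv.trans (map_zero _).symm),
    hr.isBigO hζ ?_ (hO.congr' (e₁.mono fun x hx => hx.symm) .rfl),
    hr.isBigO hζ ?_ ((hO.norm_left.congr_left fun x => (norm_star _).symm).of_norm_left.congr'
      (e₂.mono fun x hx => hx.symm) .rfl)⟩
  · refine (hHζ.Gpart.comp hζ.analyticAt).sub (AnalyticAt.comp (g := targetT Q') ?_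
      ((hHζ.Fpart.comp hζ.analyticAt).prod (hA1.comp analyticAt_fst)))
    rw [Fpart_eq_zero hHζ0]
    show AnalyticAt ℂ _ ((0 : Cn n), cj H 0)
    rw [hA0]
    exact hT
  · refine (hA1.Gpart.comp analyticAt_fst).sub (AnalyticAt.comp (g := cj (targetT Q')) ?_
      ((hA1.Fpart.comp analyticAt_fst).prod (hHζ.comp hζ.analyticAt)))
    rw [hHζ0, Fpart_eq_zero (show cj H (0 : XSp n d₁ d₂).1 = 0 from hA0)]
    exact hT'

theorem chainData_of_isKEquivalence
    (hM' : IsRASubmanifold (n + (d₁ + d₂)) (d₁ + d₂) M') (h0' : (0 : Cn (n + (d₁ + d₂))) ∈ M')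
    (hQ : QDescribes n d₁ d₂ Q M) (hQ' : QpDescribes n d₁ d₂ Q' M')
    (hnd : QpLNondeg n (d₁ + d₂) l Q') {I : Type} [Nonempty I] {k : I → ℕ}
    {A : I → Cn (n + (d₁ + d₂)) → Cn (n + (d₁ + d₂))} (hl : ∀ i, l < k i)
    (hA : ∀ i, IsKEquivalence (n + (d₁ + d₂)) (d₁ + d₂) M M' 0 0 (k i) (A i)) :
    ChainData Q l k A fun i => conjMap _ (A i) := by
  have hζ := zetaGood_zetaQ hQ
  obtain ⟨hT, hT'⟩ := halfData_targetT hQ' hnd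
  have hadm := fun i => (hA i).adm hQ hQ' hM' h0'
  refine ⟨cxRel_zero hQ, ⟨cj (zetaQ Q), zetaQ Q, cj (targetT Q'), targetT Q', hζ.cj, hζ, hT', hT,
    ?_, fun i => ⟨?_, hadm i⟩⟩, hl, fun i => detFz_cj (A i)⟩
  · obtain ⟨-, -, -, Ω, φ, hφ, -⟩ := hA (Classical.arbitrary I)
    have hleft := (hφ.realParam hQ).eventually_left_inv hζ
    let L : Cn (n + (d₁ + d₂)) × Cn (n + (d₁ + d₂)) →L[ℂ] XSp n d₁ d₂ :=
      (ContinuousLinearMap.snd ℂ _ _).prod (zPartL n d₁ d₂ ∘L ContinuousLinearMap.fst ℂ _ _)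
    have hL : Tendsto L (𝓝 0) (𝓝 0) := L.continuous.tendsto' 0 0 (map_zero L)
    filter_upwards [hL.eventually hleft] with p hp hrel
    have h2 := eq_zetaQ_of_cxRel hrel
    have hLp : L p = (p.2, zPart n d₁ d₂ p.1) := rfl
    rw [hLp, ← h2] at hp
    exact ⟨hp.symm, h2⟩
  · have := (hadm i).cj
    rwa [cj_cj, cj_cj] at this

end Equivalence

/-- The iterated basic identity. -/
theorem statement10 (n d₁ d₂ l : ℕ)
    (Q : Cn n → Cn n → Cn d₁ → Cn d₂ → Cn d₁)
    (Q' : Cn n → Cn n → Cn (d₁ + d₂) → Cn (d₁ + d₂))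
    (M M' : Set (Cn (n + (d₁ + d₂))))
    (hM : IsRASubmanifold (n + (d₁ + d₂)) (d₁ + d₂) M)
    (hM' : IsRASubmanifold (n + (d₁ + d₂)) (d₁ + d₂) M')
    (h0 : (0 : Cn (n + (d₁ + d₂))) ∈ M) (h0' : (0 : Cn (n + (d₁ + d₂))) ∈ M')
    (hQ : QDescribes n d₁ d₂ Q M) (hQ' : QpDescribes n d₁ d₂ Q' M')
    (hnd : QpLNondeg n (d₁ + d₂) l Q') :
    ∀ r s : ℕ, ∀ hs : 1 ≤ s,
      ∃ (q : JetSp (r + 2*s*l) (n + (d₁ + d₂)) (n + (d₁ + d₂)) → ℂ) (a b : ℕ)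
        (Ψ : (ℂ × JetSp (r + 2*s*l) (n + (d₁ + d₂)) (n + (d₁ + d₂))) ×
          ((JetSp (r + 2*s*l) n (d₁ + d₂) × Cn n) ×
            (Cn (n + (d₁ + d₂)) × (Fin s → Cn (n + (d₁ + d₂)) × Cn (n + (d₁ + d₂))))) →
              ESp n d₁ d₂ r),
        -- `q^r_s` is a polynomial on `J^{r+2sl}_{N,N}`
        IsPolyFun q ∧
        -- the components of `Ψ^{r,s}` are in the ring `R^{r+2sl}_{(2s+1)N}`
        MemRingMap _ _ _ Ψ ∧
        (∀ (θ : ℂ) (Λ : JetSp (r + 2*s*l) (n + (d₁ + d₂)) (n + (d₁ + d₂))),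
          (Ψ ((θ, Λ), 0)).2 = 0) ∧
        (r = 0 → ∀ (θ : ℂ) (Λ : JetSp (r + 2*s*l) (n + (d₁ + d₂)) (n + (d₁ + d₂))),
          Ψ ((θ, Λ), 0) = 0) ∧
        ∀ (k : ℕ) (H : Cn (n + (d₁ + d₂)) → Cn (n + (d₁ + d₂))),
          2*s*l + r < k → IsKEquivalence (n + (d₁ + d₂)) (d₁ + d₂) M M' 0 0 k H →
          -- (a)  `q^r_s(j^{r+2sl}H(0)) = (det F_z(0))^a ⬝ conj(det F_z(0))^b`
          (q (jetFull (n + (d₁ + d₂)) (r + 2*s*l) H 0) =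
            detFz n d₁ d₂ H 0 ^ a * (starRingEnd ℂ) (detFz n d₁ d₂ H 0) ^ b) ∧
          -- (b)  the iterated basic identity
          ∃ R : Cn (n + (d₁ + d₂)) × (Fin s → Cn (n + (d₁ + d₂)) × Cn (n + (d₁ + d₂))) →
              ESp n d₁ d₂ r,
            AnalyticAt ℂ R 0 ∧
            (∀ᶠ P : Cn (n + (d₁ + d₂)) × (Fin s → Cn (n + (d₁ + d₂)) × Cn (n + (d₁ + d₂)))
                in nhds 0,
              calJ n d₁ d₂ r H P.1 =
                Ψ ((1 / q (jetFull (n + (d₁ + d₂)) (r + 2*s*l) H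
                      (P.2 ⟨s - 1, by omega⟩).2),
                    jetFull (n + (d₁ + d₂)) (r + 2*s*l) H (P.2 ⟨s - 1, by omega⟩).2),
                   ((jetZG n d₁ d₂ (r + 2*s*l) H (P.2 ⟨s - 1, by omega⟩).2,
                     Fpart n d₁ d₂ H (P.2 ⟨s - 1, by omega⟩).2),
                    P)) + R P) ∧
            -- the restriction of `R` to `𝓜^{2s}` vanishes of order `k - r - 2sl` at `0`
            ∃ C ε : ℝ, 0 < ε ∧
              ∀ P : Cn (n + (d₁ + d₂)) × (Fin s → Cn (n + (d₁ + d₂)) × Cn (n + (d₁ + d₂))),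
                McxChain n d₁ d₂ s Q P → ‖P‖ < ε →
                  ‖R P‖ ≤ C * ‖P‖ ^ (k - r - 2*s*l) := by
  rintro r (_ | t) hs
  · omega
  let I := {p : ℕ × (Cn (n + (d₁ + d₂)) → Cn (n + (d₁ + d₂))) //
    l < p.1 ∧ IsKEquivalence (n + (d₁ + d₂)) (d₁ + d₂) M M' 0 0 p.1 p.2}
  have hl : ∀ k, 2 * (t + 1) * l + r < k → l < k := fun k hk => by nlinarith
  by_cases hI : Nonempty I
  · obtain ⟨q, a, b, Ψ, hq, hΨ, hz, hzz, h⟩ := (chainData_of_isKEquivalence hM' h0' hQ hQ' hnd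
      (fun i : I => i.2.1) fun i => i.2.2).exists_identity r t
    refine ⟨q, a, b, Ψ, hq, hΨ, fun _ _ => hz _, fun h _ _ => hzz h _, fun k H hk hH => ?_⟩
    obtain ⟨ha, R, hR, hRP, hC⟩ := h ⟨(k, H), hl k hk, hH⟩ (by rw [add_comm]; exact hk)
    exact ⟨ha, R, hR, .of_forall hRP, hC⟩
  · refine ⟨fun _ => 1, 0, 0, fun _ => 0, .const 1, memRingMap_of_isLinearMap ⟨fun _ _ => by simp, fun _ _ => by simp⟩,
      fun _ _ => rfl, fun _ _ _ => rfl, fun k H hk hH => (hI ⟨⟨(k, H), hl k hk, hH⟩⟩).elim⟩
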